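/- Let 2/3 < β < 3/2, let W satisfy the potential assumption with Hölder exponent α, let M > 0, and let L* ≥ 2 be such that ‖W‖_∞ + ‖W'‖_∞ + ‖W''‖_∞ ≤ L* and W'' is α-Hölder continuous with constant at most L*. Then there exists a constant C > 0, depending only on β, M and α, such that every bounded stable solution u with |u| ≤ M satisfies, for every R ≥ 1: ∫_{B_R} |∇u(x)| dx ≤ C · R · log(L* R) and ℰ(u; B_R) ≤ C · R · (log(L* R))². -/

import Mathlib

open Real MeasureTheory Filter Topology Set
open scoped ENNReal NNReal RealInnerProductSpace

noncomputable section

/-- The forcing term `f_β(θ) = (β cos²θ + sin²θ)^(-5/2)`. -/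
def fker (β θ : ℝ) : ℝ := (β * Real.cos θ ^ 2 + Real.sin θ ^ 2) ^ (-(5:ℝ)/2)

/-- `v` is a π-periodic, twice continuously differentiable solution of `v'' + 9 v = f_β`. -/
def IsVBeta (β : ℝ) (v : ℝ → ℝ) : Prop :=
  ContDiff ℝ 2 v ∧ Function.Periodic v π ∧
    ∀ θ : ℝ, deriv (deriv v) θ + 9 * v θ = fker β θ


abbrev R2 : Type := EuclideanSpace ℝ (Fin 2)

/-- The anisotropic kernel `K̄(x) = 9 v(θ(x)) / |x|³`, with `θ(x)` a polar angle of `x`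
(chosen as `Complex.arg`; the choice is immaterial since `v` is π-periodic). -/
def Kbar (v : ℝ → ℝ) (x : R2) : ℝ :=
  9 * v (Complex.arg ((x 0 : ℂ) + (x 1 : ℂ) * Complex.I)) / ‖x‖^3

/-- The nonlocal operator `L̄ g(x) = -(1/(4π)) ∫ (g(x+y)+g(x−y)−2g(x)) K̄(y) dy`. -/
def Lop (v : ℝ → ℝ) (g : R2 → ℝ) (x : R2) : ℝ :=
  -(1/(4*π)) * ∫ y : R2, (g (x + y) + g (x - y) - 2 * g x) * Kbar v y

/-- `D_R = (ℝ²×ℝ²) \ (B_Rᶜ × B_Rᶜ)`. -/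
def DR (R : ℝ) : Set (R2 × R2) := ((Metric.ball (0:R2) R)ᶜ ×ˢ (Metric.ball (0:R2) R)ᶜ)ᶜ

/-- The nonlocal energy `ℰ(u; B_R) = ∬_{D_R} |u(x)−u(y)|² K̄(x−y) dx dy`. -/
def nEnergy (v : ℝ → ℝ) (u : R2 → ℝ) (R : ℝ) : ℝ≥0∞ :=
  ∫⁻ p in DR R, ENNReal.ofReal (|u p.1 - u p.2|^2 * Kbar v (p.1 - p.2))

/-- The potential assumption on `W` with Hölder exponent `α`: `W` is C² and bounded with
bounded first and second derivatives, `W''` is `α`-Hölder for some `α ∈ (0,1)`,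
`W(s) > W(±1)` on `(-1,1)`, and `W''(±1) > 0`. -/
def PotentialAssump (α : ℝ≥0) (W : ℝ → ℝ) : Prop :=
  ContDiff ℝ 2 W ∧ 0 < (α : ℝ) ∧ (α : ℝ) < 1 ∧
  (∃ C, ∀ s, |W s| ≤ C ∧ |deriv W s| ≤ C ∧ |deriv (deriv W) s| ≤ C) ∧
  (∃ Cα : ℝ≥0, HolderWith Cα α (deriv (deriv W))) ∧
  (∀ s ∈ Set.Ioo (-1:ℝ) 1, W 1 < W s ∧ W (-1) < W s) ∧
  0 < deriv (deriv W) 1 ∧ 0 < deriv (deriv W) (-1)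

/-- The point of `ℝ²` with coordinates `(x₁, x₂)`. -/
def pt (x₁ x₂ : ℝ) : R2 := (WithLp.equiv 2 (Fin 2 → ℝ)).symm ![x₁, x₂]

/-- A bounded stable solution of the reduced Peierls–Nabarro equation
`L̄ u = −β^{-1/2} W'(u)` with bi-states at infinity: `u` is C², bounded with bounded
first and second derivatives, solves the equation, satisfies
`lim_{x₁→±∞} u(x₁,x₂) = ±1` for each `x₂`, and the second variation of the energy is
nonnegative on compactly supported C² test functions. -/
def IsStableSolution (β : ℝ) (v W : ℝ → ℝ) (u : R2 → ℝ) : Prop :=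
  ContDiff ℝ 2 u ∧
  (∃ C, ∀ x, |u x| ≤ C ∧ ‖fderiv ℝ u x‖ ≤ C ∧ ‖iteratedFDeriv ℝ 2 u x‖ ≤ C) ∧
  (∀ x, Lop v u x = -(β ^ (-(1:ℝ)/2)) * deriv W (u x)) ∧
  (∀ x₂ : ℝ, Tendsto (fun x₁ => u (pt x₁ x₂)) atTop (𝓝 1) ∧
    Tendsto (fun x₁ => u (pt x₁ x₂)) atBot (𝓝 (-1))) ∧
  (∀ φ : R2 → ℝ, ContDiff ℝ 2 φ → HasCompactSupport φ →
    0 ≤ ∫ x : R2, (Lop v φ x + β ^ (-(1:ℝ)/2) * deriv (deriv W) (u x) * φ x) * φ x)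

/-- The numerator of the closed form of `v_β`, as a cubic form in `cos²θ` and `sin²θ`. -/
def vNum (β X Y : ℝ) : ℝ :=
  β^2 * X * (3 * Y - X) * (3 * Y + (2 * β - 3) * X) + Y * (3 * X - Y) * (3 * β * X + (2 - 3 * β) * Y)

theorem vNum_pos {β X Y : ℝ} (hβ1 : 2/3 < β) (hβ2 : β < 3/2) (hX : 0 ≤ X) (hY : 0 ≤ Y)
    (hXY : 0 < X + Y) : 0 < vNum β X Y := by
  have h1 : 0 < 3 - 4 * β + 2 * β ^ 2 := by nlinarith [sq_nonneg (β - 1)]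
  have h2 : 0 < 3 * β ^ 2 - 4 * β + 2 := by nlinarith [sq_nonneg (β - 2/3)]
  have hb : 0 < β := by linarith
  have e : vNum β X Y = β^2 * (3 - 2*β) * X^3 + 3 * β * (3 - 4 * β + 2 * β ^ 2) * X^2 * Y
      + 3 * (3 * β ^ 2 - 4 * β + 2) * X * Y^2 + (3*β - 2) * Y^3 := by
    unfold vNum; ring
  have hp : 0 < 3 - 2 * β := by linarith
  have hr : 0 < 3 * β - 2 := by linarith
  rw [e]
  rcases hX.eq_or_lt with rfl | hX'
  · have : 0 < Y := by linarith
    positivity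
  · positivity

theorem base_pos {β : ℝ} (hβ : 0 < β) (θ : ℝ) : 0 < β * cos θ ^ 2 + sin θ ^ 2 := by
  have h := sin_sq_add_cos_sq θ
  rcases eq_or_ne (cos θ) 0 with h0 | h0
  · rw [h0] at h ⊢; nlinarith
  · have : 0 < cos θ ^ 2 := by positivity
    positivity

/-- Closed form of the solution `v_β`. -/
theorem vBeta_closed_form {β : ℝ} (hβ : 0 < β) {v : ℝ → ℝ} (hv : IsVBeta β v) (θ : ℝ) :
    v θ = vNum β (cos θ ^ 2) (sin θ ^ 2) / (9 * β ^ 2)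
      * (β * cos θ ^ 2 + sin θ ^ 2) ^ (-(3:ℝ)/2) := by
  obtain ⟨hc, hper, hode⟩ := hv
  have hd1 : Differentiable ℝ v := hc.differentiable (by norm_num)
  have hd2 : Differentiable ℝ (deriv v) :=
    ((contDiff_succ_iff_deriv (n := 1)).1 hc).2.2.differentiable (by norm_num)
  let q : ℝ → ℝ := fun φ => β * cos φ ^ 2 + sin φ ^ 2
  have hq : ∀ φ, 0 < q φ := base_pos hβ
  have hqd : ∀ φ, HasDerivAt q (β * (2 * cos φ * (-sin φ)) + 2 * sin φ * cos φ) φ := by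
    intro φ
    have h1 := (((hasDerivAt_cos φ).pow 2).const_mul β).add ((hasDerivAt_sin φ).pow 2)
    refine h1.congr_deriv ?_
    norm_num
  have hqp : ∀ φ, HasDerivAt (fun φ => q φ ^ (-(3:ℝ)/2))
      ((β * (2 * cos φ * (-sin φ)) + 2 * sin φ * cos φ) * (-(3:ℝ)/2) * q φ ^ (-(5:ℝ)/2)) φ := by
    intro φ
    have := (hqd φ).rpow_const (p := -(3:ℝ)/2) (Or.inl (hq φ).ne')
    refine this.congr_deriv ?_
    norm_num
  have hq3 : ∀ φ, q φ ^ (-(3:ℝ)/2) = q φ * q φ ^ (-(5:ℝ)/2) := by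
    intro φ
    conv_rhs => rw [← Real.rpow_one (q φ), ← Real.rpow_mul (hq φ).le, ← Real.rpow_add (hq φ)]
    norm_num
  let F : ℝ → ℝ := fun φ => (cos φ + (2 * β - 6) / 3 * cos φ ^ 3) * q φ ^ (-(3:ℝ)/2)
  let G : ℝ → ℝ := fun φ =>
    (1 / β * sin φ + (2 - 6 * β) / (3 * β ^ 2) * sin φ ^ 3) * q φ ^ (-(3:ℝ)/2)
  have hF : ∀ φ, HasDerivAt F (fker β φ * sin (3 * φ)) φ := by
    intro φ
    have h1 := ((hasDerivAt_cos φ).add (((hasDerivAt_cos φ).pow 3).const_mul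
      ((2 * β - 6) / 3))).mul (hqp φ)
    refine h1.congr_deriv ?_
    have hs := sin_sq φ
    simp only [Pi.add_apply, Pi.pow_apply]
    rw [hq3, sin_three_mul, fker]
    change _ = q φ ^ _ * _
    have e : q φ = 1 + (β - 1) * cos φ ^ 2 := by simp only [q]; rw [hs]; ring
    set p := q φ ^ (-(5:ℝ)/2)
    rw [e]
    have h3 : sin φ ^ 3 = sin φ * (1 - cos φ ^ 2) := by rw [← hs]; ring
    rw [h3]
    push_cast
    ring
  have hG : ∀ φ, HasDerivAt G (fker β φ * cos (3 * φ)) φ := by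
    intro φ
    have h1 := (((hasDerivAt_sin φ).const_mul (1/β)).add (((hasDerivAt_sin φ).pow 3).const_mul
      ((2 - 6 * β) / (3 * β ^ 2)))).mul (hqp φ)
    refine h1.congr_deriv ?_
    have hs := cos_sq' φ
    simp only [Pi.add_apply, Pi.pow_apply]
    rw [hq3, cos_three_mul, fker]
    change _ = q φ ^ _ * _
    have e : q φ = β - (β - 1) * sin φ ^ 2 := by simp only [q]; rw [hs]; ring
    set p := q φ ^ (-(5:ℝ)/2)
    rw [e]
    have h3 : cos φ ^ 3 = cos φ * (1 - sin φ ^ 2) := by rw [← hs]; ring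
    rw [h3]
    push_cast
    field_simp
    ring
  let H : ℝ → ℝ := fun φ => deriv v φ * sin (3 * φ - 3 * θ) - 3 * v φ * cos (3 * φ - 3 * θ)
    - (cos (3 * θ) * F φ - sin (3 * θ) * G φ)
  have hH : ∀ φ, HasDerivAt H 0 φ := by
    intro φ
    have hl : HasDerivAt (fun φ : ℝ => 3 * φ - 3 * θ) 3 φ := by
      simpa using ((hasDerivAt_id φ).const_mul 3).sub_const (3 * θ)
    have h1 := ((((hd2 φ).hasDerivAt.mul hl.sin).sub
      (((hd1 φ).hasDerivAt.const_mul 3).mul hl.cos))).sub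
      (((hF φ).const_mul (cos (3 * θ))).sub ((hG φ).const_mul (sin (3 * θ))))
    refine h1.congr_deriv ?_
    have := hode φ
    have h2 : deriv (deriv v) φ = fker β φ - 9 * v φ := by linarith
    rw [h2, sin_sub]
    ring
  have hconst : H (θ + π) = H θ :=
    is_const_of_deriv_eq_zero (fun φ => (hH φ).differentiableAt) (fun φ => (hH φ).deriv) _ _
  have hqper : q (θ + π) = q θ := by simp [q, cos_add_pi, sin_add_pi]
  have hFper : F (θ + π) = - F θ := by
    simp only [F, hqper, cos_add_pi]; ring
  have hGper : G (θ + π) = - G θ := by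
    simp only [G, hqper, sin_add_pi]; ring
  have hc3 : cos (3 * (θ + π) - 3 * θ) = -1 := by
    have : 3 * (θ + π) - 3 * θ = π + 2 * π := by ring
    rw [this, cos_add_two_pi, cos_pi]
  have hs3 : sin (3 * (θ + π) - 3 * θ) = 0 := by
    have : 3 * (θ + π) - 3 * θ = π + 2 * π := by ring
    rw [this, sin_add_two_pi, sin_pi]
  simp only [H, hFper, hGper, hc3, hs3, hper θ, sub_self, sin_zero, cos_zero] at hconst
  have key : 3 * v θ = - cos (3 * θ) * F θ + sin (3 * θ) * G θ := by linarith
  have : v θ = (- cos (3 * θ) * F θ + sin (3 * θ) * G θ) / 3 := by linarith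
  rw [this]
  simp only [F, G]
  change _ = _ * q θ ^ _
  rw [cos_three_mul, sin_three_mul]
  have e : ∀ a b c p : ℝ, a * (b * p) = (a * b) * p := by intros; ring
  have hX : cos θ ^ 2 = 1 - sin θ ^ 2 := cos_sq' θ
  have h4 : cos θ ^ 4 = (1 - sin θ ^ 2) ^ 2 := by rw [← hX]; ring
  have h6 : cos θ ^ 6 = (1 - sin θ ^ 2) ^ 3 := by rw [← hX]; ring
  unfold vNum
  field_simp
  ring_nf
  simp only [h4, h6, hX]
  ring

/-- `f` is positively homogeneous of degree `-m` away from the origin. -/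
def HomogNeg (m : ℕ) (f : R2 → ℝ) : Prop :=
  ∀ t : ℝ, 0 < t → ∀ y : R2, y ≠ 0 → f (t • y) = (t ^ m)⁻¹ * f y

theorem HomogNeg.eq_normalized {m : ℕ} {f : R2 → ℝ} (hf : HomogNeg m f) {y : R2} (hy : y ≠ 0) :
    f y = (‖y‖ ^ m)⁻¹ * f (‖y‖⁻¹ • y) := by
  have hn : 0 < ‖y‖ := norm_pos_iff.2 hy
  have hy' : ‖y‖⁻¹ • y ≠ 0 := smul_ne_zero (inv_ne_zero hn.ne') hy
  rw [← hf ‖y‖ hn _ hy', smul_smul, mul_inv_cancel₀ hn.ne', one_smul]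

theorem normalized_mem_sphere {y : R2} (hy : y ≠ 0) : ‖y‖⁻¹ • y ∈ Metric.sphere (0 : R2) 1 := by
  have hn : 0 < ‖y‖ := norm_pos_iff.2 hy
  simp [norm_smul, hn.ne']

theorem sphere_subset_compl_zero : Metric.sphere (0 : R2) 1 ⊆ {0}ᶜ := by
  intro y hy h
  simp only [mem_singleton_iff] at h
  simp [h] at hy

theorem HomogNeg.exists_bound {m : ℕ} {f : R2 → ℝ} (hf : HomogNeg m f)
    (hc : ContinuousOn f {0}ᶜ) : ∃ C > 0, ∀ y ≠ 0, |f y| ≤ C * (‖y‖ ^ m)⁻¹ := by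
  obtain ⟨C, hC⟩ := (isCompact_sphere (0 : R2) 1).exists_bound_of_continuousOn
    (hc.mono sphere_subset_compl_zero)
  refine ⟨max C 1, by positivity, fun y hy => ?_⟩
  rw [hf.eq_normalized hy, abs_mul, abs_of_nonneg (by positivity), mul_comm]
  gcongr
  exact (hC _ (normalized_mem_sphere hy)).trans (le_max_left _ _)

theorem HomogNeg.exists_lower_bound {m : ℕ} {f : R2 → ℝ} (hf : HomogNeg m f)
    (hc : ContinuousOn f {0}ᶜ) (hpos : ∀ y ≠ 0, 0 < f y) :
    ∃ c > 0, ∀ y ≠ 0, c * (‖y‖ ^ m)⁻¹ ≤ f y := by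
  have hne : (Metric.sphere (0 : R2) 1).Nonempty := NormedSpace.sphere_nonempty.2 zero_le_one
  obtain ⟨z, hz, hmin⟩ := (isCompact_sphere (0 : R2) 1).exists_isMinOn hne
    (hc.mono sphere_subset_compl_zero)
  refine ⟨f z, hpos z (sphere_subset_compl_zero hz), fun y hy => ?_⟩
  rw [hf.eq_normalized hy, mul_comm]
  gcongr
  exact hmin (normalized_mem_sphere hy)

theorem HomogNeg.fderiv_apply {m : ℕ} {f : R2 → ℝ} (hf : HomogNeg m f)
    (hd : ∀ y ≠ 0, DifferentiableAt ℝ f y) (e : R2) :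
    HomogNeg (m + 1) (fun y => fderiv ℝ f y e) := by
  intro t ht y hy
  have hty : t • y ≠ 0 := smul_ne_zero ht.ne' hy
  have h1 : HasFDerivAt (fun z : R2 => t • z) (t • ContinuousLinearMap.id ℝ R2) y :=
    (hasFDerivAt_id y).const_smul t
  have h2 := (hd _ hty).hasFDerivAt.comp y h1
  have h3 : HasFDerivAt (fun z => (t ^ m)⁻¹ * f z) ((t ^ m)⁻¹ • fderiv ℝ f y) y :=
    (hd y hy).hasFDerivAt.const_mul _
  have heq : (f ∘ fun z : R2 => t • z) =ᶠ[𝓝 y] fun z => (t ^ m)⁻¹ * f z := by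
    filter_upwards [isOpen_compl_singleton.mem_nhds hy] with z hz
    exact hf t ht z hz
  have h4 := (h2.congr_of_eventuallyEq heq.symm).unique h3
  have h5 := congrArg (fun l : R2 →L[ℝ] ℝ => l e) h4
  simp at h5
  field_simp
  field_simp at h5
  rw [pow_succ]
  linarith

/-- The structural properties of the kernel used in the energy estimates: two-sided bounds
and approximation by smooth kernels vanishing near the origin. -/
structure EllipticKernel (K : R2 → ℝ) (lam Lam : ℝ) : Prop where
  lam_pos : 0 < lam
  Lam_pos : 0 < Lam
  meas : Measurable K
  lower : ∀ y, lam * (‖y‖ ^ 3)⁻¹ ≤ K y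
  upper : ∀ y, K y ≤ Lam * (‖y‖ ^ 3)⁻¹

/-- Approximation of `K` by smooth kernels vanishing near the origin, with derivative bounds
along `e`. -/
structure KernelApprox (K : R2 → ℝ) (Lam : ℝ) (e : R2) (k0 k1 k2 : ℕ → R2 → ℝ) : Prop where
  cont0 : ∀ n, Continuous (k0 n)
  cont1 : ∀ n, Continuous (k1 n)
  cont2 : ∀ n, Continuous (k2 n)
  deriv1 : ∀ n y, HasLineDerivAt ℝ (k0 n) (k1 n y) y e
  deriv2 : ∀ n y, HasLineDerivAt ℝ (k1 n) (k2 n y) y e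
  bound0 : ∀ n y, |k0 n y| ≤ Lam * (‖y‖ ^ 3)⁻¹
  bound1 : ∀ n y, |k1 n y| ≤ Lam * (‖y‖ ^ 4)⁻¹
  bound2 : ∀ n y, |k2 n y| ≤ Lam * (‖y‖ ^ 5)⁻¹
  zero : ∀ n, ∃ r > 0, ∀ y, ‖y‖ < r → k0 n y = 0 ∧ k1 n y = 0 ∧ k2 n y = 0
  tendsto : ∀ y, Tendsto (fun n => k0 n y) atTop (𝓝 (K y))

theorem exists_bound_of_eq_outside {m : ℕ} {f g : R2 → ℝ} {C : ℝ} (hC : 0 < C)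
    (hf : ∀ y ≠ 0, |f y| ≤ C * (‖y‖ ^ m)⁻¹) (hg : Continuous g)
    (h2 : ∀ y, 2 < ‖y‖ → g y = f y) (h1 : ∀ y, ‖y‖ < 1 → g y = 0) :
    ∃ C' > 0, ∀ y, |g y| ≤ C' * (‖y‖ ^ m)⁻¹ := by
  obtain ⟨B, hB⟩ := (isCompact_closedBall (0 : R2) 2).exists_bound_of_continuousOn
    hg.continuousOn
  refine ⟨max C (B * 2 ^ m), by positivity, fun y => ?_⟩
  by_cases hy : 2 < ‖y‖
  · rw [h2 y hy]
    have hy0 : y ≠ 0 := by rintro rfl; simp at hy; linarith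
    refine (hf y hy0).trans ?_
    gcongr
    exact le_max_left _ _
  · push Not at hy
    by_cases hy1 : ‖y‖ < 1
    · rw [h1 y hy1, abs_zero]; positivity
    · push Not at hy1
      have hn : 0 < ‖y‖ := by linarith
      have hb : |g y| ≤ B := hB y (by simpa using hy)
      have hB0 : 0 ≤ B := (abs_nonneg _).trans hb
      calc |g y| ≤ B * 1 := by linarith
        _ ≤ B * (2 ^ m * (‖y‖ ^ m)⁻¹) := by
          gcongr
          rw [← div_eq_mul_inv, one_le_div (by positivity)]
          gcongr
        _ = B * 2 ^ m * (‖y‖ ^ m)⁻¹ := by ring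
        _ ≤ _ := by gcongr; exact le_max_right _ _

theorem exists_kernelApprox {K : R2 → ℝ} (hK : ∀ y ≠ 0, ContDiffAt ℝ 2 K y)
    (hK0 : K 0 = 0) (hh : HomogNeg 3 K) (e : R2) :
    ∃ Lam > 0, ∃ k0 k1 k2, KernelApprox K Lam e k0 k1 k2 := by
  let b : ContDiffBump (0 : R2) := ⟨1, 2, one_pos, one_lt_two⟩
  let g0 : R2 → ℝ := fun y => (1 - b y) * K y
  have hbc : ContDiff ℝ 2 b := b.contDiff
  have hg0z : ∀ y, ‖y‖ < 1 → g0 y = 0 := by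
    intro y hy
    have : b y = 1 := b.one_of_mem_closedBall (by simpa using hy.le)
    simp [g0, this]
  have hg0e : ∀ y, 2 < ‖y‖ → g0 y = K y := by
    intro y hy
    have : b y = 0 := b.zero_of_le_dist (by simpa using hy.le)
    simp [g0, this]
  have hball : ∀ y : R2, ‖y‖ < 1 → {z : R2 | ‖z‖ < 1} ∈ 𝓝 y := fun y hy =>
    (isOpen_lt continuous_norm continuous_const).mem_nhds hy
  have hout : ∀ y : R2, 2 < ‖y‖ → {z : R2 | 2 < ‖z‖} ∈ 𝓝 y := fun y hy =>
    (isOpen_lt continuous_const continuous_norm).mem_nhds hy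
  have hne : ∀ y : R2, 2 < ‖y‖ → y ≠ 0 := by
    rintro y hy rfl; simp at hy; linarith
  have hg0c : ContDiff ℝ 2 g0 := by
    rw [contDiff_iff_contDiffAt]
    intro y
    rcases eq_or_ne y 0 with rfl | hy
    · have : g0 =ᶠ[𝓝 0] fun _ => (0 : ℝ) := by
        filter_upwards [hball 0 (by simp)] with z hz using hg0z z hz
      exact contDiffAt_const.congr_of_eventuallyEq this
    · exact (contDiffAt_const.sub hbc.contDiffAt).mul (hK y hy)
  let g1 : R2 → ℝ := fun y => fderiv ℝ g0 y e
  have hg1c : ContDiff ℝ 1 g1 :=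
    (hg0c.fderiv_right (m := 1) (by norm_num)).clm_apply contDiff_const
  let g2 : R2 → ℝ := fun y => fderiv ℝ g1 y e
  have hg2c : Continuous g2 :=
    ((hg1c.fderiv_right (m := 0) (by norm_num)).clm_apply contDiff_const).continuous
  let K1 : R2 → ℝ := fun y => fderiv ℝ K y e
  have hK1 : ∀ y ≠ 0, ContDiffAt ℝ 1 K1 y := fun y hy =>
    ((hK y hy).fderiv_right (m := 1) (by norm_num)).clm_apply contDiffAt_const
  let K2 : R2 → ℝ := fun y => fderiv ℝ K1 y e
  have hK2 : ∀ y ≠ 0, ContDiffAt ℝ 0 K2 y := fun y hy =>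
    ((hK1 y hy).fderiv_right (m := 0) (by norm_num)).clm_apply contDiffAt_const
  have hh1 : HomogNeg 4 K1 := hh.fderiv_apply
    (fun y hy => (hK y hy).differentiableAt (by norm_num)) e
  have hh2 : HomogNeg 5 K2 := hh1.fderiv_apply
    (fun y hy => (hK1 y hy).differentiableAt (by norm_num)) e
  have hg1z : ∀ y, ‖y‖ < 1 → g1 y = 0 := by
    intro y hy
    have : g0 =ᶠ[𝓝 y] fun _ => (0 : ℝ) := by
      filter_upwards [hball y hy] with z hz using hg0z z hz
    simp only [g1, this.fderiv_eq]; simp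
  have hg2z : ∀ y, ‖y‖ < 1 → g2 y = 0 := by
    intro y hy
    have : g1 =ᶠ[𝓝 y] fun _ => (0 : ℝ) := by
      filter_upwards [hball y hy] with z hz using hg1z z hz
    simp only [g2, this.fderiv_eq]; simp
  have hg1e : ∀ y, 2 < ‖y‖ → g1 y = K1 y := by
    intro y hy
    have : g0 =ᶠ[𝓝 y] K := by
      filter_upwards [hout y hy] with z hz using hg0e z hz
    simp only [g1, K1, this.fderiv_eq]
  have hg2e : ∀ y, 2 < ‖y‖ → g2 y = K2 y := by
    intro y hy
    have : g1 =ᶠ[𝓝 y] K1 := by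
      filter_upwards [hout y hy] with z hz using hg1e z hz
    simp only [g2, K2, this.fderiv_eq]
  obtain ⟨A0, hA0, hb0⟩ := hh.exists_bound fun y hy => (hK y hy).continuousAt.continuousWithinAt
  obtain ⟨A1, hA1, hb1⟩ := hh1.exists_bound fun y hy => (hK1 y hy).continuousAt.continuousWithinAt
  obtain ⟨A2, hA2, hb2⟩ := hh2.exists_bound fun y hy => (hK2 y hy).continuousAt.continuousWithinAt
  obtain ⟨C0, hC0, hc0⟩ := exists_bound_of_eq_outside hA0 hb0 hg0c.continuous hg0e hg0z
  obtain ⟨C1, hC1, hc1⟩ := exists_bound_of_eq_outside hA1 hb1 hg1c.continuous hg1e hg1z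
  obtain ⟨C2, hC2, hc2⟩ := exists_bound_of_eq_outside hA2 hb2 hg2c hg2e hg2z
  have hN : ∀ n : ℕ, (0 : ℝ) < n + 1 := fun n => by positivity
  have scale : ∀ (m : ℕ) (g : R2 → ℝ) (C : ℝ), 0 < C → C ≤ C0 + C1 + C2 →
      (∀ y, |g y| ≤ C * (‖y‖ ^ m)⁻¹) → ∀ (n : ℕ) (y : R2),
      |((n : ℝ) + 1) ^ m * g (((n : ℝ) + 1) • y)| ≤ (C0 + C1 + C2) * (‖y‖ ^ m)⁻¹ := by
    intro m g C hC hCle hg n y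
    rw [abs_mul, abs_of_pos (pow_pos (hN n) m)]
    have h1 := hg (((n : ℝ) + 1) • y)
    rw [norm_smul, Real.norm_of_nonneg (hN n).le, mul_pow, mul_inv] at h1
    have hp := pow_pos (hN n) m
    calc ((n : ℝ) + 1) ^ m * |g (((n : ℝ) + 1) • y)|
        ≤ ((n : ℝ) + 1) ^ m * (C * ((((n : ℝ) + 1) ^ m)⁻¹ * (‖y‖ ^ m)⁻¹)) := by gcongr
      _ = C * (‖y‖ ^ m)⁻¹ := by field_simp
      _ ≤ _ := by gcongr
  have dscale : ∀ (m : ℕ) (g : R2 → ℝ), Differentiable ℝ g → ∀ (n : ℕ) (y : R2),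
      HasLineDerivAt ℝ (fun y => ((n : ℝ) + 1) ^ m * g (((n : ℝ) + 1) • y))
        (((n : ℝ) + 1) ^ (m + 1) * fderiv ℝ g (((n : ℝ) + 1) • y) e) y e := by
    intro m g hg n y
    have h1 : HasFDerivAt (fun z : R2 => ((n : ℝ) + 1) • z)
      (((n : ℝ) + 1) • ContinuousLinearMap.id ℝ R2) y := (hasFDerivAt_id y).const_smul ((n : ℝ) + 1)
    have h2 := ((hg (((n : ℝ) + 1) • y)).hasFDerivAt.comp y h1).const_mul (((n : ℝ) + 1) ^ m)
    have h3 := h2.hasLineDerivAt e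
    convert! h3 using 1
    simp
    ring
  refine ⟨C0 + C1 + C2, by positivity, fun n y => ((n : ℝ) + 1) ^ 3 * g0 (((n : ℝ) + 1) • y),
    fun n y => ((n : ℝ) + 1) ^ 4 * g1 (((n : ℝ) + 1) • y),
    fun n y => ((n : ℝ) + 1) ^ 5 * g2 (((n : ℝ) + 1) • y), ?_⟩
  refine ⟨?_, ?_, ?_, ?_, ?_, ?_, ?_, ?_, ?_, ?_⟩
  · intro n
    exact continuous_const.mul (hg0c.continuous.comp (continuous_const_smul _))
  · intro n
    exact continuous_const.mul (hg1c.continuous.comp (continuous_const_smul _))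
  · intro n
    exact continuous_const.mul (hg2c.comp (continuous_const_smul _))
  · exact dscale 3 g0 (hg0c.differentiable (by norm_num))
  · exact dscale 4 g1 (hg1c.differentiable (by norm_num))
  · exact scale 3 g0 C0 hC0 (by linarith) hc0
  · exact scale 4 g1 C1 hC1 (by linarith) hc1
  · exact scale 5 g2 C2 hC2 (by linarith) hc2
  · intro n
    refine ⟨((n : ℝ) + 1)⁻¹, inv_pos.2 (hN n), fun y hy => ?_⟩
    have : ‖((n : ℝ) + 1) • y‖ < 1 := by
      rw [norm_smul, Real.norm_of_nonneg (hN n).le]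
      calc _ < ((n : ℝ) + 1) * ((n : ℝ) + 1)⁻¹ := by gcongr
        _ = 1 := mul_inv_cancel₀ (hN n).ne'
    simp [hg0z _ this, hg1z _ this, hg2z _ this]
  · intro y
    rcases eq_or_ne y 0 with rfl | hy
    · simp [hg0z 0 (by simp), hK0]
    · have hn : 0 < ‖y‖ := norm_pos_iff.2 hy
      refine tendsto_const_nhds.congr' ?_
      obtain ⟨N, hN'⟩ := exists_nat_gt (2 / ‖y‖)
      filter_upwards [eventually_ge_atTop N] with n hnN
      have h1 : 2 < ‖((n : ℝ) + 1) • y‖ := by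
        rw [norm_smul, Real.norm_of_nonneg (hN n).le]
        rw [div_lt_iff₀ hn] at hN'
        have : (N : ℝ) ≤ n := by exact_mod_cast hnN
        nlinarith
      rw [hg0e _ h1, hh _ (hN n) y hy]
      have := (hN n).ne'
      field_simp

theorem norm_toComplex (y : R2) : ‖((y 0 : ℂ) + (y 1 : ℂ) * Complex.I)‖ = ‖y‖ := by
  rw [Complex.norm_add_mul_I, EuclideanSpace.norm_eq]
  simp [Fin.sum_univ_two]

theorem toComplex_ne_zero {y : R2} (hy : y ≠ 0) : ((y 0 : ℂ) + (y 1 : ℂ) * Complex.I) ≠ 0 := by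
  rw [← norm_ne_zero_iff, norm_toComplex]
  exact norm_ne_zero_iff.2 hy

theorem Kbar_zero (v : ℝ → ℝ) : Kbar v 0 = 0 := by simp [Kbar]

theorem Kbar_homogNeg (v : ℝ → ℝ) : HomogNeg 3 (Kbar v) := by
  intro t ht y hy
  have : (((t • y) 0 : ℝ) : ℂ) + (((t • y) 1 : ℝ) : ℂ) * Complex.I
      = (t : ℂ) * ((y 0 : ℂ) + (y 1 : ℂ) * Complex.I) := by
    simp; ring
  unfold Kbar
  rw [this, Complex.arg_real_mul _ ht, norm_smul, Real.norm_of_nonneg ht.le, mul_pow]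
  have : 0 < ‖y‖ := norm_pos_iff.2 hy
  field_simp

theorem sq_coord_add (y : R2) : y 0 ^ 2 + y 1 ^ 2 = ‖y‖ ^ 2 := by
  rw [EuclideanSpace.norm_sq_eq]
  simp [Fin.sum_univ_two]

theorem Kbar_closed_form {β : ℝ} (hβ : 0 < β) {v : ℝ → ℝ} (hv : IsVBeta β v) {y : R2}
    (hy : y ≠ 0) :
    Kbar v y = vNum β (y 0 ^ 2) (y 1 ^ 2) / (β ^ 2 * ‖y‖ ^ 9)
      * ((β * y 0 ^ 2 + y 1 ^ 2) / ‖y‖ ^ 2) ^ (-(3:ℝ)/2) := by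
  have hn : 0 < ‖y‖ := norm_pos_iff.2 hy
  unfold Kbar
  rw [vBeta_closed_form hβ hv, Complex.cos_arg (toComplex_ne_zero hy), Complex.sin_arg,
    norm_toComplex]
  have h0 : ((y 0 : ℂ) + (y 1 : ℂ) * Complex.I).re = y 0 := by simp
  have h1 : ((y 0 : ℂ) + (y 1 : ℂ) * Complex.I).im = y 1 := by simp
  rw [h0, h1]
  have e : β * (y 0 / ‖y‖) ^ 2 + (y 1 / ‖y‖) ^ 2 = (β * y 0 ^ 2 + y 1 ^ 2) / ‖y‖ ^ 2 := by
    field_simp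
  rw [e]
  set p := ((β * y 0 ^ 2 + y 1 ^ 2) / ‖y‖ ^ 2) ^ (-(3:ℝ)/2)
  unfold vNum
  field_simp

theorem quad_pos {β : ℝ} (hβ : 0 < β) {y : R2} (hy : y ≠ 0) : 0 < β * y 0 ^ 2 + y 1 ^ 2 := by
  have hn : 0 < ‖y‖ ^ 2 := by have := norm_pos_iff.2 hy; positivity
  rw [← sq_coord_add] at hn
  rcases eq_or_ne (y 0) 0 with h | h
  · rw [h] at hn ⊢; linarith
  · have : 0 < y 0 ^ 2 := by positivity
    positivity

theorem Kbar_pos {β : ℝ} (hβ1 : 2/3 < β) (hβ2 : β < 3/2) {v : ℝ → ℝ} (hv : IsVBeta β v) {y : R2}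
    (hy : y ≠ 0) : 0 < Kbar v y := by
  have hβ : 0 < β := by linarith
  have hn : 0 < ‖y‖ := norm_pos_iff.2 hy
  rw [Kbar_closed_form hβ hv hy]
  have := quad_pos hβ hy
  have := vNum_pos hβ1 hβ2 (sq_nonneg (y 0)) (sq_nonneg (y 1))
    (by rw [sq_coord_add]; positivity)
  positivity

theorem Kbar_contDiffAt {β : ℝ} (hβ : 0 < β) {v : ℝ → ℝ} (hv : IsVBeta β v) {y : R2}
    (hy : y ≠ 0) : ContDiffAt ℝ 2 (Kbar v) y := by
  have hn : ‖y‖ ≠ 0 := norm_ne_zero_iff.2 hy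
  have heq : Kbar v =ᶠ[𝓝 y] fun y => vNum β (y 0 ^ 2) (y 1 ^ 2) / (β ^ 2 * ‖y‖ ^ 9)
      * ((β * y 0 ^ 2 + y 1 ^ 2) / ‖y‖ ^ 2) ^ (-(3:ℝ)/2) := by
    filter_upwards [isOpen_compl_singleton.mem_nhds hy] with z hz
    exact Kbar_closed_form hβ hv hz
  refine ContDiffAt.congr_of_eventuallyEq ?_ heq
  have h0 : ContDiffAt ℝ 2 (fun y : R2 => y 0) y := by fun_prop
  have h1 : ContDiffAt ℝ 2 (fun y : R2 => y 1) y := by fun_prop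
  have hnorm : ContDiffAt ℝ 2 (fun y : R2 => ‖y‖) y := contDiffAt_norm ℝ hy
  have hN : ContDiffAt ℝ 2 (fun y : R2 => vNum β (y 0 ^ 2) (y 1 ^ 2)) y := by
    unfold vNum; fun_prop
  have hq : ContDiffAt ℝ 2 (fun y : R2 => (β * y 0 ^ 2 + y 1 ^ 2) / ‖y‖ ^ 2) y := by
    refine ContDiffAt.div (by fun_prop) (hnorm.pow 2) (by positivity)
  refine (hN.div (contDiffAt_const.mul (hnorm.pow 9)) (by positivity)).mul
    (hq.rpow_const_of_ne ?_)
  have := quad_pos hβ hy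
  positivity

theorem Kbar_elliptic {β : ℝ} (hβ1 : 2/3 < β) (hβ2 : β < 3/2) {v : ℝ → ℝ} (hv : IsVBeta β v) :
    ∃ lam Lam, EllipticKernel (Kbar v) lam Lam ∧
      ∀ e, ∃ k0 k1 k2 Lam', 0 < Lam' ∧ KernelApprox (Kbar v) Lam' e k0 k1 k2 := by
  have hβ : 0 < β := by linarith
  have hsm : ∀ y ≠ 0, ContDiffAt ℝ 2 (Kbar v) y := fun y hy => Kbar_contDiffAt hβ hv hy
  have hc : ContinuousOn (Kbar v) {0}ᶜ := fun y hy =>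
    (hsm y hy).continuousAt.continuousWithinAt
  obtain ⟨lam, hlam, hl⟩ := (Kbar_homogNeg v).exists_lower_bound hc
    fun y hy => Kbar_pos hβ1 hβ2 hv hy
  obtain ⟨Lam, hLam, hu⟩ := (Kbar_homogNeg v).exists_bound hc
  refine ⟨lam, Lam, ⟨hlam, hLam, ?_, ?_, ?_⟩, fun e => ?_⟩
  · have hvm : Measurable v := hv.1.continuous.measurable
    unfold Kbar
    have : Measurable fun x : R2 => ((x 0 : ℂ) + (x 1 : ℂ) * Complex.I) := by fun_prop
    have := hvm.comp (Complex.measurable_arg.comp this)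
    exact (this.const_mul 9).div (measurable_norm.pow_const 3)
  · intro y
    rcases eq_or_ne y 0 with rfl | hy
    · simp [Kbar_zero]
    · exact hl y hy
  · intro y
    rcases eq_or_ne y 0 with rfl | hy
    · simp [Kbar_zero]
    · exact (le_abs_self _).trans (hu y hy)
  · obtain ⟨L', h', k0, k1, k2, h⟩ := exists_kernelApprox hsm (Kbar_zero v) (Kbar_homogNeg v) e
    exact ⟨k0, k1, k2, L', h', h⟩

/-- The area of the unit disc. -/
def discArea : ℝ := volume.real (Metric.ball (0 : R2) 1)

theorem discArea_pos : 0 < discArea :=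
  ENNReal.toReal_pos (Metric.measure_ball_pos _ _ one_pos).ne' measure_ball_lt_top.ne

theorem volume_real_ball_R2 {r : ℝ} (hr : 0 ≤ r) :
    volume.real (Metric.ball (0 : R2) r) = r ^ 2 * discArea := by
  unfold discArea Measure.real
  rw [Measure.addHaar_ball _ _ hr, ENNReal.toReal_mul, ENNReal.toReal_ofReal (by positivity)]
  simp

theorem integrable_radial {f : ℝ → ℝ} :
    Integrable (fun y : R2 => f ‖y‖) ↔ IntegrableOn (fun r => r * f r) (Ioi 0) := by
  have := integrable_fun_norm_addHaar (volume : Measure R2) (f := f)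
  simpa using this

theorem integral_radial (f : ℝ → ℝ) :
    ∫ y : R2, f ‖y‖ = 2 * discArea * ∫ r in Ioi (0 : ℝ), r * f r := by
  have := integral_fun_norm_addHaar (volume : Measure R2) f
  simp only [finrank_euclideanSpace, Fintype.card_fin] at this
  rw [this]
  simp [discArea, mul_assoc]

theorem radial_near {δ : ℝ} (hδ : 0 < δ) :
    Integrable (fun y : R2 => (Iic δ).indicator (fun r => r⁻¹) ‖y‖) ∧
      ∫ y : R2, (Iic δ).indicator (fun r => r⁻¹) ‖y‖ = 2 * discArea * δ := by
  have h : EqOn (fun r : ℝ => r * (Iic δ).indicator (fun r => r⁻¹) r)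
      ((Ioc 0 δ).indicator fun _ => (1 : ℝ)) (Ioi 0) := by
    intro r (hr : 0 < r)
    by_cases h : r ≤ δ <;> simp [indicator, h, hr, hr.ne']
  constructor
  · rw [integrable_radial, integrableOn_congr_fun h measurableSet_Ioi]
    exact ((integrable_indicator_iff measurableSet_Ioc).2
      (integrableOn_const (by simp))).integrableOn
  · rw [integral_radial, setIntegral_congr_fun measurableSet_Ioi h,
      setIntegral_indicator measurableSet_Ioc,
      inter_eq_right.2 (fun x hx => hx.1)]
    simp [hδ.le]

theorem radial_mid {δ R : ℝ} (hδ : 0 < δ) (hR : δ ≤ R) :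
    Integrable (fun y : R2 => (Ioc δ R).indicator (fun r => (r ^ 2)⁻¹) ‖y‖) ∧
      ∫ y : R2, (Ioc δ R).indicator (fun r => (r ^ 2)⁻¹) ‖y‖ = 2 * discArea * log (R / δ) := by
  have hR0 : 0 < R := hδ.trans_le hR
  have h : EqOn (fun r : ℝ => r * (Ioc δ R).indicator (fun r => (r ^ 2)⁻¹) r)
      ((Ioc δ R).indicator fun r => r⁻¹) (Ioi 0) := by
    intro r (hr : 0 < r)
    by_cases h : r ∈ Ioc δ R
    · simp only [indicator_of_mem h]; field_simp
    · simp only [indicator_of_notMem h]; simp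
  have hint : IntegrableOn (fun r : ℝ => r⁻¹) (Ioc δ R) := by
    refine IntegrableOn.mono_set (ContinuousOn.integrableOn_Icc ?_) Ioc_subset_Icc_self
    exact continuousOn_inv₀.mono fun x hx => (hδ.trans_le hx.1).ne'
  constructor
  · rw [integrable_radial, integrableOn_congr_fun h measurableSet_Ioi]
    exact ((integrable_indicator_iff measurableSet_Ioc).2 hint).integrableOn
  · rw [integral_radial, setIntegral_congr_fun measurableSet_Ioi h,
      setIntegral_indicator measurableSet_Ioc,
      inter_eq_right.2 (show Ioc δ R ⊆ Ioi 0 from fun x hx => hδ.trans hx.1), ← intervalIntegral.integral_of_le hR,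
      integral_inv_of_pos hδ hR0]

theorem radial_far {R : ℝ} (hR : 0 < R) :
    Integrable (fun y : R2 => (Ioi R).indicator (fun r => (r ^ 3)⁻¹) ‖y‖) ∧
      ∫ y : R2, (Ioi R).indicator (fun r => (r ^ 3)⁻¹) ‖y‖ = 2 * discArea * R⁻¹ := by
  have h : EqOn (fun r : ℝ => r * (Ioi R).indicator (fun r => (r ^ 3)⁻¹) r)
      ((Ioi R).indicator fun r => r ^ (-2 : ℝ)) (Ioi 0) := by
    intro r (hr : 0 < r)
    by_cases h : r ∈ Ioi R
    · simp only [indicator_of_mem h]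
      rw [Real.rpow_neg hr.le]
      norm_cast
      field_simp
    · simp only [indicator_of_notMem h]; simp
  have hint : IntegrableOn (fun r : ℝ => r ^ (-2 : ℝ)) (Ioi R) :=
    integrableOn_Ioi_rpow_of_lt (by norm_num) hR
  constructor
  · rw [integrable_radial, integrableOn_congr_fun h measurableSet_Ioi]
    exact ((integrable_indicator_iff measurableSet_Ioi).2 hint).integrableOn
  · rw [integral_radial, setIntegral_congr_fun measurableSet_Ioi h,
      setIntegral_indicator measurableSet_Ioi,
      inter_eq_right.2 (show Ioi R ⊆ Ioi 0 from fun x (hx : R < x) => hR.trans hx), integral_Ioi_rpow_of_lt (by norm_num) hR]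
    norm_num [Real.rpow_neg hR.le]

/-- `min(1, |y|²) / |y|³`, the integrable model for a kernel of order one acting on
quadratic differences. -/
def kmin (y : R2) : ℝ := min 1 (‖y‖ ^ 2) * (‖y‖ ^ 3)⁻¹

theorem kmin_nonneg (y : R2) : 0 ≤ kmin y := by unfold kmin; positivity

theorem kmin_neg (y : R2) : kmin (-y) = kmin y := by simp [kmin]

theorem measurable_kmin : Measurable kmin := by unfold kmin; fun_prop

theorem integrable_kmin : Integrable kmin := by
  refine ((radial_near one_pos).1.add (radial_far one_pos).1).mono'
    measurable_kmin.aestronglyMeasurable (Eventually.of_forall fun y => ?_)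
  rw [Real.norm_of_nonneg (kmin_nonneg y), kmin, Pi.add_apply]
  rcases eq_or_ne y 0 with rfl | hy
  · simp [indicator]
  have hn : 0 < ‖y‖ := norm_pos_iff.2 hy
  by_cases h : ‖y‖ ≤ 1
  · have h' : ¬ 1 < ‖y‖ := not_lt.2 h
    have : min 1 (‖y‖^2) ≤ ‖y‖^2 := min_le_right _ _
    simp only [indicator, mem_Iic, h, mem_Ioi, h', if_true, if_false, add_zero]
    calc _ ≤ ‖y‖^2 * (‖y‖^3)⁻¹ := by gcongr
      _ = ‖y‖⁻¹ := by field_simp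
  · have h' : 1 < ‖y‖ := not_le.1 h
    have : min 1 (‖y‖^2) ≤ 1 := min_le_left _ _
    simp only [indicator, mem_Iic, h, mem_Ioi, h', if_true, if_false, zero_add]
    calc _ ≤ 1 * (‖y‖^3)⁻¹ := by gcongr
      _ = _ := by simp

/-- The shear `(a, b) ↦ (a - b, b)`. -/
def shear : R2 × R2 ≃ₜ R2 × R2 where
  toFun z := (z.1 - z.2, z.2)
  invFun z := (z.1 + z.2, z.2)
  left_inv z := by simp
  right_inv z := by simp
  continuous_toFun := by fun_prop
  continuous_invFun := by fun_prop

theorem measurePreserving_shear : MeasurePreserving shear (volume : Measure (R2 × R2)) volume :=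
  measurePreserving_sub_prod volume volume

theorem integral_shear (F : R2 × R2 → ℝ) :
    ∫ p : R2 × R2, F (p.1 - p.2, p.2) = ∫ p, F p :=
  measurePreserving_shear.integral_comp shear.measurableEmbedding F

theorem integral_shear_symm (F : R2 × R2 → ℝ) :
    ∫ p : R2 × R2, F (p.1 + p.2, p.2) = ∫ p, F p := by
  rw [← integral_shear]; simp

theorem integrable_shear {F : R2 × R2 → ℝ} :
    Integrable (fun p : R2 × R2 => F (p.1 - p.2, p.2)) ↔ Integrable F :=
  measurePreserving_shear.integrable_comp_emb shear.measurableEmbedding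

theorem integrable_shear_symm {F : R2 × R2 → ℝ} :
    Integrable (fun p : R2 × R2 => F (p.1 + p.2, p.2)) ↔ Integrable F := by
  rw [← integrable_shear]; simp

theorem integral_swap_R2 (F : R2 × R2 → ℝ) :
    ∫ p : R2 × R2, F (p.2, p.1) = ∫ p, F p :=
  (Measure.measurePreserving_swap (μ := (volume : Measure R2)) (ν := (volume : Measure R2))).integral_comp
    MeasurableEquiv.prodComm.measurableEmbedding F

theorem integrable_swap_R2 {F : R2 × R2 → ℝ} :
    Integrable (fun p : R2 × R2 => F (p.2, p.1)) ↔ Integrable F :=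
  (Measure.measurePreserving_swap (μ := (volume : Measure R2)) (ν := (volume : Measure R2))).integrable_comp_emb
    MeasurableEquiv.prodComm.measurableEmbedding

/-- The indicator of the ball of radius `S`, as a real function. -/
def ballInd (S : ℝ) : R2 → ℝ := (Metric.ball (0 : R2) S).indicator 1

theorem ballInd_of_lt {S : ℝ} {x : R2} (h : ‖x‖ < S) : ballInd S x = 1 := by
  simp [ballInd, h]

theorem ballInd_of_ge {S : ℝ} {x : R2} (h : S ≤ ‖x‖) : ballInd S x = 0 := by
  simp [ballInd, h]

theorem ballInd_nonneg (S : ℝ) (x : R2) : 0 ≤ ballInd S x :=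
  indicator_nonneg (fun _ _ => zero_le_one) _

theorem measurable_ballInd (S : ℝ) : Measurable (ballInd S) :=
  measurable_one.indicator measurableSet_ball

theorem integrable_ballInd (S : ℝ) : Integrable (ballInd S) :=
  (integrable_indicator_iff measurableSet_ball).2
    (integrableOn_const (C := (1 : ℝ)) measure_ball_lt_top.ne)

theorem integral_ballInd {S : ℝ} (hS : 0 ≤ S) : ∫ x, ballInd S x = S ^ 2 * discArea := by
  rw [← volume_real_ball_R2 hS]
  exact integral_indicator_one measurableSet_ball

theorem integrable_ballInd_mul {k : R2 → ℝ} (hk : Integrable k) (S : ℝ) :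
    Integrable (fun p : R2 × R2 => k (p.1 - p.2) * ballInd S p.2) :=
  (integrable_shear (F := fun p => k p.1 * ballInd S p.2)).2 (hk.mul_prod (integrable_ballInd S))

theorem integral_ballInd_mul (k : R2 → ℝ) {S : ℝ} (hS : 0 ≤ S) :
    ∫ p : R2 × R2, k (p.1 - p.2) * ballInd S p.2 = (∫ y, k y) * (S ^ 2 * discArea) := by
  rw [integral_shear (fun p => k p.1 * ballInd S p.2), ← integral_ballInd hS]
  exact integral_prod_mul k (ballInd S)

/-- The dominating function for the double integrals localized in the ball of radius `S`. -/
def bd (S : ℝ) (p : R2 × R2) : ℝ := (ballInd S p.1 + ballInd S p.2) * kmin (p.1 - p.2)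

theorem integrable_bd (S : ℝ) : Integrable (bd S) := by
  have h1 := integrable_ballInd_mul integrable_kmin S
  have h2 := integrable_swap_R2.2 h1
  refine (h1.add h2).congr (Eventually.of_forall fun p => ?_)
  have : kmin (p.2 - p.1) = kmin (p.1 - p.2) := by rw [← kmin_neg, neg_sub]
  simp only [Pi.add_apply, bd, this]
  ring

/-- Domination criterion used for every localized double integral. -/
theorem integrable_of_le_bd {F : R2 × R2 → ℝ} (hF : Measurable F) {S C : ℝ}
    (h0 : ∀ p, S ≤ ‖p.1‖ → S ≤ ‖p.2‖ → F p = 0) (h : ∀ p, |F p| ≤ C * kmin (p.1 - p.2)) :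
    Integrable F ∧ ∀ p, |F p| ≤ C * bd S p := by
  have key : ∀ p, |F p| ≤ C * bd S p := by
    intro p
    by_cases h1 : S ≤ ‖p.1‖ ∧ S ≤ ‖p.2‖
    · rw [h0 p h1.1 h1.2, bd, ballInd_of_ge h1.1, ballInd_of_ge h1.2]; simp
    · have : 1 ≤ ballInd S p.1 + ballInd S p.2 := by
        by_cases h2 : S ≤ ‖p.1‖
        · have h3 : ‖p.2‖ < S := by by_contra h4; exact h1 ⟨h2, not_lt.1 h4⟩
          rw [ballInd_of_lt h3]; linarith [ballInd_nonneg S p.1]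
        · rw [ballInd_of_lt (not_le.1 h2)]; linarith [ballInd_nonneg S p.2]
      have h5 := h p
      have h6 : 0 ≤ C * kmin (p.1 - p.2) := (abs_nonneg _).trans h5
      calc |F p| ≤ 1 * (C * kmin (p.1 - p.2)) := by linarith
        _ ≤ (ballInd S p.1 + ballInd S p.2) * (C * kmin (p.1 - p.2)) := by gcongr
        _ = C * bd S p := by unfold bd; ring
  exact ⟨((integrable_bd S).const_mul C).mono' hF.aestronglyMeasurable
    (Eventually.of_forall fun p => by rw [Real.norm_eq_abs]; exact key p), key⟩

/-- Functions bounded by `L` and `L`-Lipschitz. -/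
structure BL (L : ℝ) (g : R2 → ℝ) : Prop where
  bound : ∀ x, |g x| ≤ L
  lip : ∀ a b, |g a - g b| ≤ L * ‖a - b‖

namespace BL

variable {L L' : ℝ} {g h : R2 → ℝ}

theorem nonneg (hg : BL L g) : 0 ≤ L := (abs_nonneg _).trans (hg.bound 0)

theorem continuous (hg : BL L g) : Continuous g := by
  refine (LipschitzWith.of_dist_le_mul (K := L.toNNReal) fun a b => ?_).continuous
  rw [Real.coe_toNNReal _ hg.nonneg, Real.dist_eq, dist_eq_norm]
  exact hg.lip a b

theorem mul (hg : BL L g) (hh : BL L' h) : BL (2 * L * L') (fun x => g x * h x) := by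
  have h1 := hg.nonneg
  have h2 := hh.nonneg
  refine ⟨fun x => ?_, fun a b => ?_⟩
  · rw [abs_mul]
    calc _ ≤ L * L' := by gcongr <;> [exact hg.bound x; exact hh.bound x]
      _ ≤ 2 * L * L' := by nlinarith [mul_nonneg h1 h2]
  · calc |g a * h a - g b * h b| = |(g a - g b) * h a + g b * (h a - h b)| := by ring_nf
      _ ≤ |g a - g b| * |h a| + |g b| * |h a - h b| := by
        rw [← abs_mul, ← abs_mul]; exact abs_add_le _ _
      _ ≤ (L * ‖a - b‖) * L' + L * (L' * ‖a - b‖) := by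
        gcongr
        · exact hg.lip a b
        · exact hh.bound a
        · exact hg.bound b
        · exact hh.lip a b
      _ = _ := by ring

theorem abs (hg : BL L g) : BL L (fun x => |g x|) :=
  ⟨fun x => by rw [abs_abs]; exact hg.bound x,
    fun a b => (abs_abs_sub_abs_le_abs_sub _ _).trans (hg.lip a b)⟩

theorem abs_mul_sub_le (hg : BL L g) (hh : BL L' h) (a b : R2) :
    |(g a - g b) * (h a - h b)| ≤ 4 * L * L' * min 1 (‖a - b‖ ^ 2) := by
  have h1 := hg.nonneg
  have h2 := hh.nonneg
  have h3 := hg.lip a b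
  have h4 := hh.lip a b
  have h5 : |g a - g b| ≤ 2 * L := by
    have := abs_sub (g a) (g b); linarith [hg.bound a, hg.bound b]
  have h6 : |h a - h b| ≤ 2 * L' := by
    have := abs_sub (h a) (h b); linarith [hh.bound a, hh.bound b]
  rw [abs_mul]
  rcases min_choice 1 (‖a - b‖ ^ 2) with e | e <;> rw [e]
  · calc _ ≤ (2 * L) * (2 * L') := by gcongr
      _ = _ := by ring
  · calc _ ≤ (L * ‖a - b‖) * (L' * ‖a - b‖) := by gcongr
      _ = L * L' * ‖a - b‖ ^ 2 := by ring
      _ ≤ _ := by gcongr; nlinarith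

end BL

theorem EllipticKernel.nonneg {K : R2 → ℝ} {lam Lam : ℝ} (hK : EllipticKernel K lam Lam) (y : R2) :
    0 ≤ K y := le_trans (by have := hK.lam_pos; positivity) (hK.lower y)

theorem EllipticKernel.abs_le {K : R2 → ℝ} {lam Lam : ℝ} (hK : EllipticKernel K lam Lam) (y : R2) :
    |K y| ≤ Lam * (‖y‖ ^ 3)⁻¹ := by rw [abs_of_nonneg (hK.nonneg y)]; exact hK.upper y

/-- The integrand of the bilinear form of the kernel `K`. -/
def bil (K g h : R2 → ℝ) (p : R2 × R2) : ℝ :=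
  (g p.1 - g p.2) * (h p.1 - h p.2) * K (p.1 - p.2)

section bil

variable {K g h : R2 → ℝ} {lam Lam L L' S : ℝ}

theorem measurable_bil (hK : Measurable K) (hg : Continuous g) (hh : Continuous h) :
    Measurable (bil K g h) := by
  have := hg.measurable
  have := hh.measurable
  unfold bil; fun_prop

theorem abs_bil_le (hK : ∀ y, |K y| ≤ Lam * (‖y‖ ^ 3)⁻¹) (hg : BL L g) (hh : BL L' h) (p : R2 × R2) :
    |bil K g h p| ≤ 4 * L * L' * Lam * kmin (p.1 - p.2) := by
  have h1 := hg.nonneg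
  have h2 := hh.nonneg
  rw [bil, abs_mul]
  calc _ ≤ (4 * L * L' * min 1 (‖p.1 - p.2‖ ^ 2)) * (Lam * (‖p.1 - p.2‖ ^ 3)⁻¹) := by
        gcongr
        · exact hg.abs_mul_sub_le hh _ _
        · exact hK _
    _ = _ := by unfold kmin; ring

theorem bil_dominated (hK : EllipticKernel K lam Lam) (hg : BL L g) (hh : BL L' h)
    (hS : ∀ x, S ≤ ‖x‖ → h x = 0) :
    Integrable (bil K g h) ∧ ∀ p, |bil K g h p| ≤ 4 * L * L' * Lam * bd S p :=
  integrable_of_le_bd (measurable_bil hK.meas hg.continuous hh.continuous)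
    (fun p h1 h2 => by simp [bil, hS _ h1, hS _ h2]) (abs_bil_le hK.abs_le hg hh)

theorem tendsto_integral_bil (hK : EllipticKernel K lam Lam) {gs hs : ℕ → R2 → ℝ}
    (hg : ∀ n, BL L (gs n)) (hh : ∀ n, BL L' (hs n)) (hS : ∀ n x, S ≤ ‖x‖ → hs n x = 0)
    (hgt : ∀ x, Tendsto (fun n => gs n x) atTop (𝓝 (g x)))
    (hht : ∀ x, Tendsto (fun n => hs n x) atTop (𝓝 (h x))) :
    Tendsto (fun n => ∫ p, bil K (gs n) (hs n) p) atTop (𝓝 (∫ p, bil K g h p)) := by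
  refine tendsto_integral_of_dominated_convergence (fun p => 4 * L * L' * Lam * bd S p)
    (fun n => (bil_dominated hK (hg n) (hh n) (hS n)).1.aestronglyMeasurable)
    ((integrable_bd S).const_mul _) (fun n => Eventually.of_forall fun p => ?_)
    (Eventually.of_forall fun p => ?_)
  · exact (bil_dominated hK (hg n) (hh n) (hS n)).2 p
  · exact (((hgt _).sub (hgt _)).mul ((hht _).sub (hht _))).mul_const _

end bil

/-- `C²` functions which are bounded, together with a bounded and Lipschitz derivative. -/
structure BC2 (L : ℝ) (u : R2 → ℝ) : Prop where
  contDiff : ContDiff ℝ 2 u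
  bound : ∀ x, |u x| ≤ L
  dbound : ∀ x, ‖fderiv ℝ u x‖ ≤ L
  dlip : ∀ x y, ‖fderiv ℝ u x - fderiv ℝ u y‖ ≤ L * ‖x - y‖

namespace BC2

variable {L : ℝ} {u : R2 → ℝ}

theorem nonneg (hu : BC2 L u) : 0 ≤ L := (abs_nonneg _).trans (hu.bound 0)

theorem differentiable (hu : BC2 L u) : Differentiable ℝ u := hu.contDiff.differentiable (by norm_num)

theorem bl (hu : BC2 L u) : BL L u :=
  ⟨hu.bound, fun a b => by
    have := convex_univ.norm_image_sub_le_of_norm_fderiv_le (𝕜 := ℝ) (f := u)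
      (fun x _ => hu.differentiable x) (fun x _ => hu.dbound x) (mem_univ b) (mem_univ a)
    simpa using this⟩

theorem bl_fderiv (hu : BC2 L u) {e : R2} (he : ‖e‖ ≤ 1) : BL L (fun x => fderiv ℝ u x e) := by
  have hL := hu.nonneg
  refine ⟨fun x => ?_, fun a b => ?_⟩
  · calc |fderiv ℝ u x e| ≤ ‖fderiv ℝ u x‖ * ‖e‖ := (fderiv ℝ u x).le_opNorm e
      _ ≤ L * 1 := by gcongr; exact hu.dbound x
      _ = L := mul_one L
  · calc |fderiv ℝ u a e - fderiv ℝ u b e| ≤ ‖fderiv ℝ u a - fderiv ℝ u b‖ * ‖e‖ :=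
          (fderiv ℝ u a - fderiv ℝ u b).le_opNorm e
      _ ≤ (L * ‖a - b‖) * 1 := by gcongr; exact hu.dlip a b
      _ = _ := mul_one _

theorem comp_add (hu : BC2 L u) (z : R2) : BC2 L (fun x => u (x + z)) := by
  refine ⟨hu.contDiff.comp (contDiff_id.add contDiff_const), fun x => hu.bound _, fun x => ?_,
    fun x y => ?_⟩
  · rw [fderiv_comp_add_right]; exact hu.dbound _
  · rw [fderiv_comp_add_right, fderiv_comp_add_right]; simpa using hu.dlip (x + z) (y + z)

theorem taylor (hu : BC2 L u) (x y : R2) : |u (x + y) - u x - fderiv ℝ u x y| ≤ L * ‖y‖ ^ 2 := by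
  have hL := hu.nonneg
  have := (convex_segment x (x + y)).norm_image_sub_le_of_norm_fderiv_le' (𝕜 := ℝ) (f := u)
    (φ := fderiv ℝ u x) (C := L * ‖y‖)
    (fun z _ => hu.differentiable z) (fun z hz => ?_) (left_mem_segment ℝ x _)
    (right_mem_segment ℝ x (x + y))
  · simpa [sq, mul_assoc] using this
  · refine (hu.dlip z x).trans ?_
    gcongr
    obtain ⟨t, ht, rfl⟩ := (segment_eq_image' ℝ x (x + y) ▸ hz :)
    simp only [add_sub_cancel_left, norm_smul, Real.norm_eq_abs, abs_of_nonneg ht.1]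
    exact mul_le_of_le_one_left (norm_nonneg _) ht.2

theorem abs_second_diff_le (hu : BC2 L u) (x y : R2) :
    |u (x + y) + u (x - y) - 2 * u x| ≤ 4 * L * min 1 (‖y‖ ^ 2) := by
  have hL := hu.nonneg
  rcases min_choice 1 (‖y‖ ^ 2) with e | e <;> rw [e]
  · have h1 := abs_le.1 (hu.bound (x + y))
    have h2 := abs_le.1 (hu.bound (x - y))
    have h3 := abs_le.1 (hu.bound x)
    rw [abs_le]; constructor <;> linarith
  · have h1 := abs_le.1 (hu.taylor x y)
    have h2 := abs_le.1 (hu.taylor x (-y))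
    rw [map_neg, norm_neg, ← sub_eq_add_neg] at h2
    have : 0 ≤ L * ‖y‖ ^ 2 := by positivity
    rw [abs_le]; constructor <;> linarith

theorem of_bounds (hu : ContDiff ℝ 2 u)
    (h : ∀ x, |u x| ≤ L ∧ ‖fderiv ℝ u x‖ ≤ L ∧ ‖iteratedFDeriv ℝ 2 u x‖ ≤ L) : BC2 L u := by
  refine ⟨hu, fun x => (h x).1, fun x => (h x).2.1, fun x y => ?_⟩
  have h1 : ContDiff ℝ 1 (fderiv ℝ u) := hu.fderiv_right (by norm_num)
  refine convex_univ.norm_image_sub_le_of_norm_fderiv_le (𝕜 := ℝ) (f := fderiv ℝ u)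
    (fun x _ => h1.differentiable (by norm_num) x) (fun x _ => ?_) (mem_univ y) (mem_univ x)
  have := (h x).2.2
  rwa [← norm_iteratedFDeriv_fderiv, norm_iteratedFDeriv_one] at this

theorem exists_of_hasCompactSupport (hu : ContDiff ℝ 2 u) (hc : HasCompactSupport u) :
    ∃ L, BC2 L u := by
  have h1 : ContDiff ℝ 1 (fderiv ℝ u) := hu.fderiv_right (by norm_num)
  obtain ⟨C0, h0⟩ := hc.exists_bound_of_continuous hu.continuous
  obtain ⟨C1, h1'⟩ := (hc.fderiv (𝕜 := ℝ)).exists_bound_of_continuous h1.continuous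
  obtain ⟨C2, h2'⟩ := ContDiff.lipschitzWith_of_hasCompactSupport (hc.fderiv (𝕜 := ℝ)) h1 one_ne_zero
  refine ⟨max C0 (max C1 C2), hu, fun x => (h0 x).trans (le_max_left _ _),
    fun x => (h1' x).trans (by simp), fun x y => ?_⟩
  have := h2'.dist_le_mul x y
  rw [dist_eq_norm, dist_eq_norm] at this
  exact this.trans (by gcongr; simp)

end BC2

/-- A fixed cutoff profile, scaled. -/
theorem exists_cutoff : ∃ C0 > (0 : ℝ), ∀ R > (0 : ℝ), ∃ η : R2 → ℝ, ContDiff ℝ 2 η ∧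
    (∀ x, 0 ≤ η x) ∧ (∀ x, η x ≤ 1) ∧ (∀ x, ‖x‖ ≤ R → η x = 1) ∧ (∀ x, 2 * R ≤ ‖x‖ → η x = 0) ∧
    (∀ x, ‖fderiv ℝ η x‖ ≤ C0 / R) ∧ ∀ a b, |η a - η b| ≤ C0 / R * ‖a - b‖ := by
  let f : ContDiffBump (0 : R2) := ⟨1, 2, one_pos, one_lt_two⟩
  have hf : ContDiff ℝ 2 (f : R2 → ℝ) := f.contDiff
  obtain ⟨C, hC⟩ := (f.hasCompactSupport.fderiv (𝕜 := ℝ)).exists_bound_of_continuous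
    (hf.continuous_fderiv (by norm_num))
  have hC1 : 0 < |C| + 1 := by positivity
  refine ⟨|C| + 1, hC1, fun R hR => ?_⟩
  have hd : ∀ x, HasFDerivAt (fun x => f (R⁻¹ • x)) (R⁻¹ • fderiv ℝ f (R⁻¹ • x)) x := by
    intro x
    have h1 : HasFDerivAt (fun x : R2 => R⁻¹ • x) (R⁻¹ • ContinuousLinearMap.id ℝ R2) x :=
      (hasFDerivAt_id x).const_smul R⁻¹
    have h2 := ((hf.differentiable (by norm_num) (R⁻¹ • x)).hasFDerivAt).comp x h1
    have h3 : (fderiv ℝ f (R⁻¹ • x)).comp (R⁻¹ • ContinuousLinearMap.id ℝ R2) =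
        R⁻¹ • fderiv ℝ f (R⁻¹ • x) := by ext; simp
    rw [h3] at h2
    exact h2
  have hb : ∀ x, ‖fderiv ℝ (fun x => f (R⁻¹ • x)) x‖ ≤ (|C| + 1) / R := by
    intro x
    rw [(hd x).fderiv, norm_smul, norm_inv, Real.norm_of_nonneg hR.le, div_eq_inv_mul]
    gcongr
    exact (hC _).trans (by linarith [le_abs_self C])
  refine ⟨fun x => f (R⁻¹ • x), hf.comp (contDiff_const_smul _), fun x => f.nonneg, fun x => f.le_one,
    fun x hx => f.one_of_mem_closedBall ?_, fun x hx => f.zero_of_le_dist ?_, hb, fun a b => ?_⟩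
  · rw [mem_closedBall_zero_iff, norm_smul, norm_inv, Real.norm_of_nonneg hR.le]
    rw [inv_mul_le_iff₀ hR]; change ‖x‖ ≤ R * 1; rwa [mul_one]
  · rw [dist_zero_right, norm_smul, norm_inv, Real.norm_of_nonneg hR.le]
    change (2 : ℝ) ≤ _
    rw [le_inv_mul_iff₀ hR]; linarith
  · exact convex_univ.norm_image_sub_le_of_norm_fderiv_le (𝕜 := ℝ)
      (fun x _ => (hd x).differentiableAt) (fun x _ => hb x) (mem_univ b) (mem_univ a)

theorem BL.integrable {L S : ℝ} {g : R2 → ℝ} (hg : BL L g) (hS : ∀ x, S ≤ ‖x‖ → g x = 0) :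
    Integrable g := by
  refine ((integrable_ballInd S).const_mul L).mono' hg.continuous.aestronglyMeasurable
    (Eventually.of_forall fun x => ?_)
  by_cases h : S ≤ ‖x‖
  · simp [hS x h, ballInd_of_ge h]
  · rw [ballInd_of_lt (not_le.1 h), mul_one]; exact hg.bound x

theorem BL.abs_le_ballInd {L S : ℝ} {g : R2 → ℝ} (hg : BL L g) (hS : ∀ x, S ≤ ‖x‖ → g x = 0)
    (x : R2) : |g x| ≤ L * ballInd S x := by
  by_cases h : S ≤ ‖x‖
  · simp [hS x h, ballInd_of_ge h]
  · rw [ballInd_of_lt (not_le.1 h), mul_one]; exact hg.bound x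

/-- A discrete summation by parts for the second difference. -/
theorem integral_mul_second_diff {g ψ : R2 → ℝ} (hg : Continuous g) {L L' S : ℝ} (hgb : ∀ x, |g x| ≤ L)
    (hψ : BL L' ψ) (hS : ∀ x, S ≤ ‖x‖ → ψ x = 0) (y : R2) :
    ∫ x, ψ x * (g (x + y) + g (x - y) - 2 * g x) =
      -∫ x, (g (y + x) - g x) * (ψ (y + x) - ψ x) := by
  have hψi := hψ.integrable hS
  have hi : ∀ z, Integrable fun x => ψ x * g (x + z) := fun z =>
    hψi.mul_bdd (c := L) (by fun_prop) (Eventually.of_forall fun x => hgb _)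
  have h0 : Integrable fun x => ψ x * g x := by simpa using hi 0
  have hm : Integrable fun x => ψ x * g (x - y) := by simpa [sub_eq_add_neg] using hi (-y)
  have h1 : Integrable fun x => ψ (x + y) * g (x + y) := h0.comp_add_right y
  have h2 : Integrable fun x => ψ (x + y) * g x := by
    simpa using hm.comp_add_right y
  have e1 : ∫ x, ψ (x + y) * g (x + y) = ∫ x, ψ x * g x :=
    integral_add_right_eq_self (fun x => ψ x * g x) y
  have e2 : ∫ x, ψ (x + y) * g x = ∫ x, ψ x * g (x - y) := by
    rw [← integral_add_right_eq_self (fun x => ψ x * g (x - y)) y]; simp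
  have l : ∫ x, ψ x * (g (x + y) + g (x - y) - 2 * g x) =
      ((∫ x, ψ x * g (x + y)) + ∫ x, ψ x * g (x - y)) - 2 * ∫ x, ψ x * g x := by
    have h3 : Integrable fun x => ψ x * g (x + y) + ψ x * g (x - y) := (hi y).add hm
    rw [← integral_const_mul, ← integral_add (hi y) hm, ← integral_sub h3 (h0.const_mul 2)]
    congr 1; ext x; ring
  have r : ∫ x, (g (y + x) - g x) * (ψ (y + x) - ψ x) =
      (((∫ x, ψ (x + y) * g (x + y)) - ∫ x, ψ x * g (x + y)) - ∫ x, ψ (x + y) * g x) +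
        ∫ x, ψ x * g x := by
    have h3 : Integrable fun x => ψ (x + y) * g (x + y) - ψ x * g (x + y) := h1.sub (hi y)
    have h4 : Integrable fun x => ψ (x + y) * g (x + y) - ψ x * g (x + y) - ψ (x + y) * g x :=
      h3.sub h2
    rw [← integral_sub h1 (hi y), ← integral_sub h3 h2, ← integral_add h4 h0]
    congr 1; ext x; simp only [add_comm y x]; ring
  rw [l, r, e1, e2]; ring

/-- The weak form of the nonlocal operator. -/
theorem integral_mul_Lop {v : ℝ → ℝ} {lam Lam : ℝ} (hK : EllipticKernel (Kbar v) lam Lam)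
    {g ψ : R2 → ℝ} {L L' S : ℝ} (hg : BC2 L g) (hψ : BL L' ψ) (hS : ∀ x, S ≤ ‖x‖ → ψ x = 0) :
    Integrable (fun x => ψ x * Lop v g x) ∧
      ∫ x, ψ x * Lop v g x = (1 / (4 * π)) * ∫ p, bil (Kbar v) g ψ p := by
  set K := Kbar v
  have hL := hg.nonneg
  have hKm := hK.meas
  have hgc := hg.bl.continuous
  have hψc := hψ.continuous
  have hgm := hgc.measurable
  have hψm := hψc.measurable
  let F : R2 × R2 → ℝ := fun p => ψ p.2 * ((g (p.2 + p.1) + g (p.2 - p.1) - 2 * g p.2) * K p.1)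
  have hFm : Measurable F := by fun_prop
  have hF : Integrable F := by
    refine ((integrable_kmin.mul_prod (integrable_ballInd S)).const_mul
      (L' * (4 * L * Lam))).mono' hFm.aestronglyMeasurable (Eventually.of_forall fun p => ?_)
    rw [Real.norm_eq_abs, abs_mul, abs_mul]
    have h1 := hψ.abs_le_ballInd hS p.2
    have h2 := hg.abs_second_diff_le p.2 p.1
    have h3 := hK.abs_le p.1
    have h4 := hψ.nonneg
    have h5 := ballInd_nonneg S p.2
    calc _ ≤ (L' * ballInd S p.2) * ((4 * L * min 1 (‖p.1‖ ^ 2)) * (Lam * (‖p.1‖ ^ 3)⁻¹)) := by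
          gcongr
      _ = _ := by unfold kmin; ring
  have hbil := (bil_dominated hK hg.bl hψ hS).1
  have hfun : (fun x => ψ x * Lop v g x) = fun x => -(1 / (4 * π)) * ∫ y, F (y, x) := by
    ext x
    simp only [F, Lop, integral_const_mul]; ring
  refine ⟨by rw [hfun]; exact hF.integral_prod_right.const_mul _, ?_⟩
  calc ∫ x, ψ x * Lop v g x = ∫ x, -(1 / (4 * π)) * ∫ y, F (y, x) := by rw [hfun]
    _ = -(1 / (4 * π)) * ∫ y, ∫ x, F (y, x) := by
        rw [integral_const_mul, integral_integral_swap]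
        exact hF.swap
    _ = -(1 / (4 * π)) * ∫ y, ∫ x, -bil K g ψ (y + x, x) := by
        congr 2; ext y
        calc ∫ x, F (y, x) = ∫ x, (ψ x * (g (x + y) + g (x - y) - 2 * g x)) * K y := by
              congr 1; ext x; simp only [F]; ring
          _ = _ := by
              rw [integral_mul_const, integral_mul_second_diff hgc hg.bound hψ hS, ← integral_neg,
                ← integral_mul_const]
              congr 1; ext x; simp [bil]
    _ = _ := by
        have := integral_shear_symm (bil K g ψ)
        have hi := integrable_shear_symm.2 hbil
        rw [← this]
        erw [integral_prod _ hi]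
        simp only [integral_neg, mul_neg, neg_mul, neg_neg]

/-- The difference quotient of `u` in the direction `e`, with step `1 / (n + 1)`. -/
def dq (u : R2 → ℝ) (e : R2) (n : ℕ) (x : R2) : ℝ := ((n : ℝ) + 1) * (u (x + (1 / ((n : ℝ) + 1)) • e) - u x)

section dq
variable {u : R2 → ℝ} {L : ℝ} {e : R2}

theorem contDiff_dq (hu : ContDiff ℝ 2 u) (n : ℕ) : ContDiff ℝ 2 (dq u e n) := by
  unfold dq; fun_prop

theorem dq_bl (hu : BC2 L u) (he : ‖e‖ ≤ 1) (n : ℕ) : BL L (dq u e n) := by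
  have hL := hu.nonneg
  have hn : (0 : ℝ) < n + 1 := by positivity
  have hz : ‖(1 / ((n : ℝ) + 1)) • e‖ ≤ 1 / ((n : ℝ) + 1) := by
    rw [norm_smul, Real.norm_of_nonneg (by positivity)]
    exact mul_le_of_le_one_right (by positivity) he
  set z := (1 / ((n : ℝ) + 1)) • e
  have hd := hu.differentiable
  have hz' := (hu.comp_add z).differentiable
  refine ⟨fun x => ?_, fun a b => ?_⟩
  · have := hu.bl.lip (x + z) x
    rw [add_sub_cancel_left] at this
    rw [dq, abs_mul, abs_of_pos hn]
    calc _ ≤ (n + 1) * (L * (1 / ((n : ℝ) + 1))) := by gcongr; exact this.trans (by gcongr)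
      _ = L := by field_simp
  · have := convex_univ.norm_image_sub_le_of_norm_fderiv_le (𝕜 := ℝ)
      (f := fun x => u (x + z) - u x) (C := L * (1 / ((n : ℝ) + 1)))
      (fun x _ => (hz' x).sub (hd x)) (fun x _ => ?_) (mem_univ b) (mem_univ a)
    · rw [dq, dq, ← mul_sub, abs_mul, abs_of_pos hn]
      calc _ ≤ (n + 1) * (L * (1 / ((n : ℝ) + 1)) * ‖a - b‖) := by gcongr; exact this
        _ = _ := by field_simp
    · rw [fderiv_fun_sub (hz' x) (hd x), fderiv_comp_add_right]
      have := hu.dlip (x + z) x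
      rw [add_sub_cancel_left] at this
      exact this.trans (by gcongr)

theorem tendsto_one_div_succ : Tendsto (fun n : ℕ => 1 / ((n : ℝ) + 1)) atTop (𝓝[≠] 0) :=
  tendsto_nhdsWithin_iff.2 ⟨tendsto_one_div_add_atTop_nhds_zero_nat,
    Eventually.of_forall fun n => by
      have : (0 : ℝ) < 1 / ((n : ℝ) + 1) := by positivity
      exact this.ne'⟩

theorem tendsto_dq (hu : Differentiable ℝ u) (x : R2) :
    Tendsto (fun n => dq u e n x) atTop (𝓝 (fderiv ℝ u x e)) := by
  have h := ((hu x).hasFDerivAt.hasLineDerivAt e).tendsto_slope_zero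
  refine (h.comp tendsto_one_div_succ).congr fun n => ?_
  simp [dq]

end dq

/-- What is used of a solution: regularity, the equation and stability. -/
structure StableData (c : ℝ) (v W : ℝ → ℝ) (L : ℝ) (u : R2 → ℝ) : Prop where
  bc2 : BC2 L u
  eqn : ∀ x, Lop v u x = -c * deriv W (u x)
  stable : ∀ φ : R2 → ℝ, ContDiff ℝ 2 φ → HasCompactSupport φ →
    0 ≤ ∫ x : R2, (Lop v φ x + c * deriv (deriv W) (u x) * φ x) * φ x

section lin

variable {c : ℝ} {v W : ℝ → ℝ} {u : R2 → ℝ} {L lam Lam A : ℝ}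

theorem contDiff_deriv_of_two (hW : ContDiff ℝ 2 W) : ContDiff ℝ 1 (deriv W) := by
  have : ContDiff ℝ (1 + 1) W := by norm_num; exact hW
  exact ((contDiff_succ_iff_deriv).1 this).2.2

/-- The linearized equation, satisfied by the directional derivatives. -/
theorem linearized (hK : EllipticKernel (Kbar v) lam Lam) (hu : StableData c v W L u)
    (hW : ContDiff ℝ 2 W) (hA : ∀ s, |deriv (deriv W) s| ≤ A) {e : R2} (he : ‖e‖ ≤ 1)
    {ψ : R2 → ℝ} {L' S : ℝ} (hψ : BL L' ψ) (hS : ∀ x, S ≤ ‖x‖ → ψ x = 0) :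
    ∫ p, bil (Kbar v) (fun x => fderiv ℝ u x e) ψ p =
      -(4 * π * c) * ∫ x, ψ x * (deriv (deriv W) (u x) * fderiv ℝ u x e) := by
  have hL := hu.bc2.nonneg
  have hdW := contDiff_deriv_of_two hW
  have hA0 : 0 ≤ A := (abs_nonneg _).trans (hA 0)
  have hWl : ∀ s t, |deriv W s - deriv W t| ≤ A * |s - t| := fun s t =>
    convex_univ.norm_image_sub_le_of_norm_deriv_le (𝕜 := ℝ)
      (fun x _ => hdW.differentiable (by norm_num) x) (fun x _ => hA x) (mem_univ t) (mem_univ s)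
  have hcu : Continuous (fun x => deriv W (u x)) := hdW.continuous.comp hu.bc2.bl.continuous
  have hψi := hψ.integrable hS
  -- the equation for the difference quotients
  have hstep : ∀ n, ∫ p, bil (Kbar v) (dq u e n) ψ p =
      -(4 * π * c) * ∫ x, ψ x * dq (fun x => deriv W (u x)) e n x := by
    intro n
    set z := (1 / ((n : ℝ) + 1)) • e
    have hz := hu.bc2.comp_add z
    have h1 := (integral_mul_Lop hK hu.bc2 hψ hS).2
    have h2 := (integral_mul_Lop hK hz hψ hS).2
    have h3 : ∀ x, Lop v (fun x => u (x + z)) x = -c * deriv W (u (x + z)) := by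
      intro x
      rw [← hu.eqn (x + z)]
      simp only [Lop]
      congr 2; ext y
      rw [show x + y + z = x + z + y by abel, show x - y + z = x + z - y by abel]
    simp only [h3] at h2
    simp only [hu.eqn] at h1
    have i1 := (bil_dominated hK hu.bc2.bl hψ hS).1
    have i2 := (bil_dominated hK hz.bl hψ hS).1
    have hb : ∀ x, |deriv W (u x)| ≤ |deriv W 0| + A * L := by
      intro x
      have h4 := hWl (u x) 0
      rw [sub_zero] at h4
      have h5 : A * |u x| ≤ A * L := by gcongr; exact hu.bc2.bound x
      have := abs_sub_abs_le_abs_sub (deriv W (u x)) (deriv W 0)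
      linarith
    have j1 : Integrable fun x => ψ x * deriv W (u x) :=
      hψi.mul_bdd (c := _) hcu.aestronglyMeasurable (Eventually.of_forall hb)
    have j2 : Integrable fun x => ψ x * deriv W (u (x + z)) :=
      hψi.mul_bdd (c := _) (hcu.comp (by fun_prop : Continuous fun x => x + z)).aestronglyMeasurable
        (Eventually.of_forall fun x => hb (x + z))
    have e1 : ∫ p, bil (Kbar v) (dq u e n) ψ p = ((n : ℝ) + 1) *
        ((∫ p, bil (Kbar v) (fun x => u (x + z)) ψ p) - ∫ p, bil (Kbar v) u ψ p) := by
      rw [← integral_sub i2 i1, ← integral_const_mul]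
      congr 1; ext p; simp only [bil, dq]; ring
    have e2 : ∫ x, ψ x * dq (fun x => deriv W (u x)) e n x = ((n : ℝ) + 1) *
        ((∫ x, ψ x * deriv W (u (x + z))) - ∫ x, ψ x * deriv W (u x)) := by
      rw [← integral_sub j2 j1, ← integral_const_mul]
      congr 1; ext x; simp only [dq]; ring
    have e3 : ∫ x, ψ x * (-c * deriv W (u x)) = -c * ∫ x, ψ x * deriv W (u x) := by
      rw [← integral_const_mul]; congr 1; ext x; ring
    have e4 : ∫ x, ψ x * (-c * deriv W (u (x + z))) = -c * ∫ x, ψ x * deriv W (u (x + z)) := by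
      rw [← integral_const_mul]; congr 1; ext x; ring
    rw [e3] at h1
    rw [e4] at h2
    have hpi := Real.pi_pos
    have h1' : ∫ p, bil (Kbar v) u ψ p = 4 * π * (-c * ∫ x, ψ x * deriv W (u x)) := by
      rw [h1]; field_simp
    have h2' : ∫ p, bil (Kbar v) (fun x => u (x + z)) ψ p =
        4 * π * (-c * ∫ x, ψ x * deriv W (u (x + z))) := by
      rw [h2]; field_simp
    rw [e1, e2, h1', h2']; ring
  have lim1 := tendsto_integral_bil hK (dq_bl hu.bc2 he) (fun _ => hψ) (fun _ => hS)
    (tendsto_dq (e := e) hu.bc2.differentiable) (fun _ => tendsto_const_nhds)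
  have hcomp : ∀ x, HasFDerivAt (fun x => deriv W (u x))
      (deriv (deriv W) (u x) • fderiv ℝ u x) x := fun x =>
    ((hdW.differentiable (by norm_num) (u x)).hasDerivAt.comp_hasFDerivAt x
      (hu.bc2.differentiable x).hasFDerivAt)
  have hlim : ∀ x, Tendsto (fun n => dq (fun x => deriv W (u x)) e n x) atTop
      (𝓝 (deriv (deriv W) (u x) * fderiv ℝ u x e)) := by
    intro x
    have := tendsto_dq (e := e) (u := fun x => deriv W (u x)) (fun x => (hcomp x).differentiableAt) x
    rwa [(hcomp x).fderiv] at this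
  have lim2 : Tendsto (fun n => ∫ x, ψ x * dq (fun x => deriv W (u x)) e n x) atTop
      (𝓝 (∫ x, ψ x * (deriv (deriv W) (u x) * fderiv ℝ u x e))) := by
    refine tendsto_integral_of_dominated_convergence (fun x => L' * ballInd S x * (A * L))
      (fun n => ?_) (((integrable_ballInd S).const_mul L').mul_const _)
      (fun n => Eventually.of_forall fun x => ?_)
      (Eventually.of_forall fun x => (hlim x).const_mul _)
    · refine (hψ.continuous.mul ?_).aestronglyMeasurable
      unfold dq
      exact continuous_const.mul ((hcu.comp (by fun_prop : Continuous fun x => x + _)).sub hcu)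
    · rw [Real.norm_eq_abs, abs_mul]
      have h0 := hψ.abs_le_ballInd hS x
      have h1 := (dq_bl hu.bc2 he n).bound x
      have hn : (0 : ℝ) < n + 1 := by positivity
      have h2 : |dq (fun x => deriv W (u x)) e n x| ≤ A * L := by
        calc _ ≤ (n + 1) * (A * |u (x + (1 / ((n : ℝ) + 1)) • e) - u x|) := by
              rw [dq, abs_mul, abs_of_pos hn]; gcongr; exact hWl _ _
          _ = A * |dq u e n x| := by rw [dq, abs_mul, abs_of_pos hn]; ring
          _ ≤ _ := by gcongr
      exact mul_le_mul h0 h2 (abs_nonneg _) ((abs_nonneg _).trans h0)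
  simp only [hstep] at lim1
  exact tendsto_nhds_unique lim1 (lim2.const_mul _)

end lin

theorem abs_sqrt_sq_add_sub_le (s t h : ℝ) :
    |√(s ^ 2 + h ^ 2) - √(t ^ 2 + h ^ 2)| ≤ |s - t| := by
  have h1 : ∀ s : ℝ, √(s ^ 2 + h ^ 2) = ‖(⟨s, h⟩ : ℂ)‖ := fun s => by
    rw [Complex.norm_def, Complex.normSq_mk]; ring_nf
  rw [h1, h1]
  refine (abs_norm_sub_norm_le _ _).trans (le_of_eq ?_)
  rw [Complex.norm_def, Complex.normSq_apply]
  simp [Real.sqrt_mul_self_eq_abs]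

/-- Regularized absolute value of a function. -/
theorem BL.sqrt_sq_add {L h : ℝ} {g : R2 → ℝ} (hg : BL L g) (h0 : 0 ≤ h) (h1 : h ≤ 1) :
    BL (L + 1) (fun x => √(g x ^ 2 + h ^ 2)) := by
  refine ⟨fun x => ?_, fun a b => ?_⟩
  · rw [abs_of_nonneg (Real.sqrt_nonneg _)]
    have := abs_le.1 (abs_sqrt_sq_add_sub_le (g x) 0 h)
    have h2 : √(0 ^ 2 + h ^ 2) = h := by simp [Real.sqrt_sq h0]
    rw [h2, sub_zero] at this
    linarith [hg.bound x]
  · exact (abs_sqrt_sq_add_sub_le _ _ _).trans ((hg.lip a b).trans (by gcongr; linarith))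

section
variable {c : ℝ} {v W : ℝ → ℝ} {u : R2 → ℝ} {L lam Lam A : ℝ}

/-- Stability tested with `η |∂_e u|`. -/
theorem stability_abs (hK : EllipticKernel (Kbar v) lam Lam) (hu : StableData c v W L u)
    (hW : ContDiff ℝ 2 W) (hA : ∀ s, |deriv (deriv W) s| ≤ A) {e : R2} (he : ‖e‖ ≤ 1)
    {η : R2 → ℝ} {L' S : ℝ} (hη : BL L' η) (hη2 : ContDiff ℝ 2 η) (hS : ∀ x, S ≤ ‖x‖ → η x = 0) :
    0 ≤ (1 / (4 * π)) * (∫ p, bil (Kbar v) (fun x => η x * |fderiv ℝ u x e|)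
        (fun x => η x * |fderiv ℝ u x e|) p) +
      c * ∫ x, deriv (deriv W) (u x) * (η x * |fderiv ℝ u x e|) ^ 2 := by
  have hcW : Continuous (fun x => deriv (deriv W) (u x)) :=
    ((contDiff_deriv_of_two hW).continuous_deriv (by norm_num)).comp hu.bc2.bl.continuous
  let h : ℕ → ℝ := fun n => 1 / ((n : ℝ) + 1)
  have h0 : ∀ n, 0 < h n := fun n => by positivity
  have h1 : ∀ n, h n ≤ 1 := fun n => by
    simp only [h]; rw [div_le_one (by positivity)]; linarith [(Nat.cast_nonneg n : (0 : ℝ) ≤ n)]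
  let φ : ℕ → R2 → ℝ := fun n x => η x * √(dq u e n x ^ 2 + h n ^ 2)
  have hbl : ∀ n, BL (2 * L' * (L + 1)) (φ n) := fun n =>
    hη.mul ((dq_bl hu.bc2 he n).sqrt_sq_add (h0 n).le (h1 n))
  have hφS : ∀ n x, S ≤ ‖x‖ → φ n x = 0 := fun n x hx => by simp [φ, hS x hx]
  have hφC : ∀ n, ContDiff ℝ 2 (φ n) := by
    intro n
    refine hη2.mul (ContDiff.sqrt ?_ fun x => ?_)
    · exact ((contDiff_dq hu.bc2.contDiff n).pow 2).add contDiff_const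
    · have := h0 n; positivity
  have hφc : ∀ n, HasCompactSupport (φ n) := fun n =>
    HasCompactSupport.intro (isCompact_closedBall (0 : R2) S) fun x hx => hφS n x (by
      rw [mem_closedBall_zero_iff, not_le] at hx; exact hx.le)
  have hlim : ∀ x, Tendsto (fun n => φ n x) atTop (𝓝 (η x * |fderiv ℝ u x e|)) := by
    intro x
    have hh : Tendsto h atTop (𝓝 0) := tendsto_one_div_add_atTop_nhds_zero_nat
    have := (((tendsto_dq (e := e) hu.bc2.differentiable x).pow 2).add (hh.pow 2)).sqrt
    have h2 : √((fderiv ℝ u x) e ^ 2 + 0 ^ 2) = |fderiv ℝ u x e| := by simp [Real.sqrt_sq_eq_abs]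
    rw [h2] at this
    exact this.const_mul _
  have hdom : ∀ n x, |deriv (deriv W) (u x) * φ n x ^ 2| ≤
      A * ((2 * L' * (L + 1)) * ((2 * L' * (L + 1)) * ballInd S x)) := by
    intro n x
    have hb := (hbl n).bound x
    have hb' := (hbl n).abs_le_ballInd (hφS n) x
    have h3 := (hbl n).nonneg
    have h4 : 0 ≤ A := (abs_nonneg _).trans (hA 0)
    rw [abs_mul, sq, abs_mul]
    gcongr
    exact hA _
  have hdomi : Integrable fun x => A * ((2 * L' * (L + 1)) * ((2 * L' * (L + 1)) * ballInd S x)) :=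
    (((integrable_ballInd S).const_mul _).const_mul _).const_mul _
  have hm : ∀ n, AEStronglyMeasurable (fun x => deriv (deriv W) (u x) * φ n x ^ 2) volume := fun n =>
    (hcW.mul ((hbl n).continuous.pow 2)).aestronglyMeasurable
  have hstab : ∀ n, 0 ≤ (1 / (4 * π)) * (∫ p, bil (Kbar v) (φ n) (φ n) p) +
      c * ∫ x, deriv (deriv W) (u x) * φ n x ^ 2 := by
    intro n
    have h3 := hu.stable (φ n) (hφC n) (hφc n)
    obtain ⟨Lφ, hLφ⟩ := BC2.exists_of_hasCompactSupport (hφC n) (hφc n)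
    obtain ⟨h4, h5⟩ := integral_mul_Lop hK hLφ (hbl n) (hφS n)
    have h6 : Integrable fun x => deriv (deriv W) (u x) * φ n x ^ 2 :=
      hdomi.mono' (hm n) (Eventually.of_forall (hdom n))
    rw [← h5, ← integral_const_mul, ← integral_add h4 (h6.const_mul c)]
    convert h3 using 2
    ext x; ring
  have lim1 := tendsto_integral_bil hK hbl hbl hφS hlim hlim
  have lim2 : Tendsto (fun n => ∫ x, deriv (deriv W) (u x) * φ n x ^ 2) atTop
      (𝓝 (∫ x, deriv (deriv W) (u x) * (η x * |fderiv ℝ u x e|) ^ 2)) :=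
    tendsto_integral_of_dominated_convergence _ hm hdomi
      (fun n => Eventually.of_forall (hdom n))
      (Eventually.of_forall fun x => ((hlim x).pow 2).const_mul _)
  exact ge_of_tendsto' ((lim1.const_mul _).add (lim2.const_mul c)) hstab

/-- The commutator integrand `w_a w_b (η_a - η_b)² K(a - b)`. -/
def commut (K η w : R2 → ℝ) (p : R2 × R2) : ℝ :=
  w p.1 * w p.2 * (η p.1 - η p.2) ^ 2 * K (p.1 - p.2)

/-- The sign-change integrand `(|w_a w_b| - w_a w_b) η_a η_b K(a - b)`. -/
def signDefect (K η w : R2 → ℝ) (p : R2 × R2) : ℝ :=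
  (|w p.1| * |w p.2| - w p.1 * w p.2) * (η p.1 * η p.2) * K (p.1 - p.2)

theorem commut_dominated {K : R2 → ℝ} (hKm : Measurable K) (hK : ∀ y, |K y| ≤ Lam * (‖y‖ ^ 3)⁻¹) {η w : R2 → ℝ} {L' S : ℝ}
    (hη : BL L' η) (hw : BL L w) (hS : ∀ x, S ≤ ‖x‖ → η x = 0) :
    Integrable (commut K η w) ∧
      ∀ p, |commut K η w p| ≤ L * L * (4 * L' * L' * Lam) * bd S p := by
  have hηm := hη.continuous.measurable
  have hwm := hw.continuous.measurable
  refine (integrable_of_le_bd (F := commut K η w) (by unfold commut; fun_prop) (S := S)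
    (C := L * L * (4 * L' * L' * Lam))
    (fun p h1 h2 => by simp [commut, hS _ h1, hS _ h2]) fun p => ?_)
  have h1 := abs_bil_le hK hη hη p
  have h2 := hw.nonneg
  calc |commut K η w p| = |w p.1| * |w p.2| * |bil K η η p| := by
        rw [← abs_mul, ← abs_mul]; congr 1; unfold commut bil; ring
    _ ≤ L * L * (4 * L' * L' * Lam * kmin (p.1 - p.2)) := by
        gcongr
        · exact hw.bound _
        · exact hw.bound _
    _ = _ := by ring

/-- Stability controls the sign defect by the commutator. -/
theorem signDefect_le (hK : EllipticKernel (Kbar v) lam Lam) (hu : StableData c v W L u)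
    (hW : ContDiff ℝ 2 W) (hA : ∀ s, |deriv (deriv W) s| ≤ A) {e : R2} (he : ‖e‖ ≤ 1)
    {η : R2 → ℝ} {L' S : ℝ} (hη : BL L' η) (hη2 : ContDiff ℝ 2 η) (hS : ∀ x, S ≤ ‖x‖ → η x = 0) :
    Integrable (signDefect (Kbar v) η (fun x => fderiv ℝ u x e)) ∧
      2 * ∫ p, signDefect (Kbar v) η (fun x => fderiv ℝ u x e) p ≤
        ∫ p, commut (Kbar v) η (fun x => fderiv ℝ u x e) p := by
  have hw := hu.bc2.bl_fderiv he
  have hlin := linearized hK hu hW hA he (hη.mul (hη.mul hw)) (S := S) (fun x hx => by simp [hS x hx])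
  have hstab := stability_abs hK hu hW hA he hη hη2 hS
  have hcommut := (commut_dominated hK.meas hK.abs_le hη hw hS).1
  have hφ := hη.mul hw.abs
  have i1 := (bil_dominated hK hφ hφ (S := S) (fun x hx => by simp [hS x hx])).1
  have i2 := (bil_dominated hK hw (hη.mul (hη.mul hw)) (S := S) (fun x hx => by simp [hS x hx])).1
  set w : R2 → ℝ := fun x => fderiv ℝ u x e
  set K := Kbar v
  have key : ∀ p, signDefect K η w p = (1 / 2) * (commut K η w p -
      (bil K (fun x => η x * |w x|) (fun x => η x * |w x|) p -
        bil K w (fun x => η x * (η x * w x)) p)) := by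
    intro p
    simp only [signDefect, commut, bil]
    linear_combination (1 / 2 * (η p.1 ^ 2) * K (p.1 - p.2)) * sq_abs (w p.1) +
      (1 / 2 * (η p.2 ^ 2) * K (p.1 - p.2)) * sq_abs (w p.2)
  have hint : Integrable (fun p => (1 / 2) * (commut K η w p -
      (bil K (fun x => η x * |w x|) (fun x => η x * |w x|) p -
        bil K w (fun x => η x * (η x * w x)) p))) := (hcommut.sub (i1.sub i2)).const_mul _
  have hfun : signDefect K η w = fun p => (1 / 2) * (commut K η w p -
      (bil K (fun x => η x * |w x|) (fun x => η x * |w x|) p -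
        bil K w (fun x => η x * (η x * w x)) p)) := funext key
  rw [hfun]
  refine ⟨hint, ?_⟩
  have i12 : Integrable (fun p => bil K (fun x => η x * |w x|) (fun x => η x * |w x|) p -
        bil K w (fun x => η x * (η x * w x)) p) := i1.sub i2
  rw [integral_const_mul, integral_sub hcommut i12, integral_sub i1 i2, hlin]
  have e1 : ∫ x, η x * (η x * w x) * (deriv (deriv W) (u x) * w x) =
      ∫ x, deriv (deriv W) (u x) * (η x * |w x|) ^ 2 := by
    congr 1; ext x; rw [mul_pow, sq_abs]; ring
  rw [e1]
  have hpi := Real.pi_pos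
  set B := ∫ p, bil K (fun x => η x * |w x|) (fun x => η x * |w x|) p
  set I := ∫ x, deriv (deriv W) (u x) * (η x * |w x|) ^ 2
  have : 0 ≤ 4 * π * (1 / (4 * π) * B + c * I) := by positivity
  have h2 : 4 * π * (1 / (4 * π) * B + c * I) = B + 4 * π * c * I := by field_simp
  linarith

/-- The quadratic form of the localized derivative. -/
theorem integral_bil_localized_le (hK : EllipticKernel (Kbar v) lam Lam) (hu : StableData c v W L u)
    (hc : 0 ≤ c) (hW : ContDiff ℝ 2 W) (hA : ∀ s, |deriv (deriv W) s| ≤ A) {e : R2} (he : ‖e‖ ≤ 1)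
    {η : R2 → ℝ} {L' S : ℝ} (hη : BL L' η) (hS : ∀ x, S ≤ ‖x‖ → η x = 0) :
    ∫ p, bil (Kbar v) (fun x => η x * fderiv ℝ u x e) (fun x => η x * fderiv ℝ u x e) p ≤
      (∫ p, commut (Kbar v) η (fun x => fderiv ℝ u x e) p) +
        4 * π * c * A * ∫ x, (η x * fderiv ℝ u x e) ^ 2 := by
  have hw := hu.bc2.bl_fderiv he
  have hlin := linearized hK hu hW hA he (hη.mul (hη.mul hw)) (S := S) (fun x hx => by simp [hS x hx])
  have hcommut := (commut_dominated hK.meas hK.abs_le hη hw hS).1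
  have i2 := (bil_dominated hK hw (hη.mul (hη.mul hw)) (S := S) (fun x hx => by simp [hS x hx])).1
  have hcW : Continuous (fun x => deriv (deriv W) (u x)) :=
    ((contDiff_deriv_of_two hW).continuous_deriv (by norm_num)).comp hu.bc2.bl.continuous
  have hsq := ((hη.mul hw).mul (hη.mul hw)).integrable (S := S) (fun x hx => by simp [hS x hx])
  set w : R2 → ℝ := fun x => fderiv ℝ u x e
  set K := Kbar v
  have key : ∀ p, bil K (fun x => η x * w x) (fun x => η x * w x) p =
      commut K η w p + bil K w (fun x => η x * (η x * w x)) p := by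
    intro p; simp only [commut, bil]; ring
  have e0 : ∀ x, (η x * w x) ^ 2 = η x * w x * (η x * w x) := fun x => sq _
  change (∫ p, bil K (fun x => η x * w x) (fun x => η x * w x) p) ≤
    (∫ p, commut K η w p) + 4 * π * c * A * ∫ x, (η x * w x) ^ 2
  simp only [key, e0]
  rw [integral_add hcommut i2, hlin]
  have h1 : |∫ x, η x * (η x * w x) * (deriv (deriv W) (u x) * w x)| ≤
      A * ∫ x, η x * w x * (η x * w x) := by
    rw [← integral_const_mul, ← Real.norm_eq_abs]
    refine norm_integral_le_of_norm_le (hsq.const_mul A) (Eventually.of_forall fun x => ?_)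
    have : η x * (η x * w x) * (deriv (deriv W) (u x) * w x) =
      deriv (deriv W) (u x) * (η x * w x * (η x * w x)) := by ring
    rw [this, Real.norm_eq_abs, abs_mul, abs_of_nonneg (mul_self_nonneg (η x * w x))]
    exact mul_le_mul_of_nonneg_right (hA _) (mul_self_nonneg _)
  have h2 := (abs_le.1 h1).1
  have hpi := Real.pi_pos
  have h3 : 0 ≤ 4 * π * c := by positivity
  nlinarith [mul_le_mul_of_nonneg_left h2 h3]

end

/-- A cutoff function supported in the ball of radius `S` with gradient at most `G`. -/
structure Cutoff (G S : ℝ) (η : R2 → ℝ) : Prop where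
  contDiff : ContDiff ℝ 2 η
  nonneg : ∀ x, 0 ≤ η x
  le_one : ∀ x, η x ≤ 1
  zero : ∀ x, S ≤ ‖x‖ → η x = 0
  dbound : ∀ x, ‖fderiv ℝ η x‖ ≤ G
  lip : ∀ a b, |η a - η b| ≤ G * ‖a - b‖

namespace Cutoff

variable {G S : ℝ} {η : R2 → ℝ} {e : R2}

theorem G_nonneg (h : Cutoff G S η) : 0 ≤ G := (norm_nonneg _).trans (h.dbound 0)

theorem abs_le_one (h : Cutoff G S η) (x : R2) : |η x| ≤ 1 := by
  rw [abs_of_nonneg (h.nonneg x)]; exact h.le_one x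

theorem bl (h : Cutoff G S η) : BL (max 1 G) η :=
  ⟨fun x => (h.abs_le_one x).trans (le_max_left _ _),
    fun a b => (h.lip a b).trans (by gcongr; exact le_max_right _ _)⟩

theorem abs_sub_le_one (h : Cutoff G S η) (a b : R2) : |η a - η b| ≤ 1 := by
  rw [abs_le]
  constructor <;> linarith [h.nonneg a, h.nonneg b, h.le_one a, h.le_one b]

theorem fderiv_zero (h : Cutoff G S η) {x : R2} (hx : S ≤ ‖x‖) : fderiv ℝ η x = 0 := by
  refine IsLocalMin.fderiv_eq_zero (Eventually.of_forall fun y => ?_)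
  rw [h.zero x hx]; exact h.nonneg y

theorem abs_fderiv_apply_le (h : Cutoff G S η) (he : ‖e‖ ≤ 1) (x : R2) : |fderiv ℝ η x e| ≤ G := by
  have := h.G_nonneg
  calc |fderiv ℝ η x e| ≤ ‖fderiv ℝ η x‖ * ‖e‖ := (fderiv ℝ η x).le_opNorm e
    _ ≤ G * 1 := by gcongr; exact h.dbound x
    _ = G := mul_one G

theorem hasLineDerivAt (h : Cutoff G S η) (x e : R2) : HasLineDerivAt ℝ η (fderiv ℝ η x e) x e :=
  (h.contDiff.differentiable (by norm_num) x).hasFDerivAt.hasLineDerivAt e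

theorem continuous_fderiv_apply (h : Cutoff G S η) (e : R2) : Continuous fun x => fderiv ℝ η x e :=
  (h.contDiff.continuous_fderiv (by norm_num)).clm_apply continuous_const

end Cutoff

theorem BC2.hasLineDerivAt {L : ℝ} {u : R2 → ℝ} (hu : BC2 L u) (x e : R2) :
    HasLineDerivAt ℝ u (fderiv ℝ u x e) x e :=
  (hu.differentiable x).hasFDerivAt.hasLineDerivAt e

theorem integral_mul_lineDeriv {f f' g g' : R2 × R2 → ℝ} {z : R2 × R2}
    (h1 : Integrable fun p => f' p * g p) (h2 : Integrable fun p => f p * g' p)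
    (h3 : Integrable fun p => f p * g p) (hf : ∀ p, HasLineDerivAt ℝ f (f' p) p z)
    (hg : ∀ p, HasLineDerivAt ℝ g (g' p) p z) : ∫ p, f p * g' p = -∫ p, f' p * g p := by
  have : (volume : Measure (R2 × R2)).IsAddHaarMeasure :=
    inferInstanceAs ((volume : Measure R2).prod (volume : Measure R2)).IsAddHaarMeasure
  exact integral_bilinear_hasLineDerivAt_right_eq_neg_left_of_integrable (B := ContinuousLinearMap.mul ℝ ℝ)
    h1 h2 h3 (fun p _ => hf p) (fun p _ => hg p)

theorem KernelApprox.le_kmin {K : R2 → ℝ} {Lam : ℝ} {e : R2} {k0 k1 k2 : ℕ → R2 → ℝ} (hLam : 0 < Lam)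
    (hk : KernelApprox K Lam e k0 k1 k2) (n : ℕ) :
    ∃ C, 0 ≤ C ∧ ∀ y, |k0 n y| ≤ C * kmin y ∧ |k1 n y| ≤ C * kmin y ∧ |k2 n y| ≤ C * kmin y := by
  obtain ⟨r, hr, h0⟩ := hk.zero n
  set s := min r 1
  have hs : 0 < s := lt_min hr one_pos
  have hs1 : s ≤ 1 := min_le_right _ _
  refine ⟨Lam * (s ^ 4)⁻¹, by positivity, fun y => ?_⟩
  have hn := kmin_nonneg y
  have hC : 0 ≤ Lam * (s ^ 4)⁻¹ * kmin y := by positivity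
  by_cases hy : ‖y‖ < s
  · obtain ⟨e0, e1, e2⟩ := h0 y (hy.trans_le (min_le_left _ _))
    rw [e0, e1, e2]; simpa using hC
  · rw [not_lt] at hy
    have hy0 : 0 < ‖y‖ := hs.trans_le hy
    have h1 : s ^ 2 ≤ min 1 (‖y‖ ^ 2) := le_min (pow_le_one₀ hs.le hs1) (by gcongr)
    have h2 : (s ^ 2)⁻¹ * (‖y‖ ^ 3)⁻¹ ≤ (s ^ 4)⁻¹ * kmin y := by
      calc (s ^ 2)⁻¹ * (‖y‖ ^ 3)⁻¹ = (s ^ 4)⁻¹ * (s ^ 2 * (‖y‖ ^ 3)⁻¹) := by field_simp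
        _ ≤ _ := by unfold kmin; gcongr
    have h5 : (‖y‖ ^ 5)⁻¹ ≤ (s ^ 2)⁻¹ * (‖y‖ ^ 3)⁻¹ := by
      rw [← mul_inv]; gcongr
      calc _ ≤ ‖y‖ ^ 2 * ‖y‖ ^ 3 := by gcongr
        _ = _ := by ring
    have h4 : (‖y‖ ^ 4)⁻¹ ≤ (s ^ 2)⁻¹ * (‖y‖ ^ 3)⁻¹ := by
      rw [← mul_inv]; gcongr
      calc s ^ 2 * ‖y‖ ^ 3 ≤ s * ‖y‖ ^ 3 := by
            gcongr; rw [sq]; exact mul_le_of_le_one_left hs.le hs1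
        _ ≤ ‖y‖ * ‖y‖ ^ 3 := by gcongr
        _ = _ := by ring
    have h3 : (‖y‖ ^ 3)⁻¹ ≤ (s ^ 2)⁻¹ * (‖y‖ ^ 3)⁻¹ :=
      le_mul_of_one_le_left (by positivity) ((one_le_inv₀ (by positivity)).2 (pow_le_one₀ hs.le hs1))
    refine ⟨(hk.bound0 n y).trans ?_, (hk.bound1 n y).trans ?_, (hk.bound2 n y).trans ?_⟩ <;>
    · rw [mul_assoc]; gcongr
      exact le_trans (by assumption) h2

/-- The local `H^{1/2}` energy of `u`, localized in the second variable. -/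
def enInt (u : R2 → ℝ) (S : ℝ) (p : R2 × R2) : ℝ :=
  (u p.1 - u p.2) ^ 2 * (‖p.1 - p.2‖ ^ 3)⁻¹ * ballInd S p.2

/-- The local energy of `u`. -/
def en (u : R2 → ℝ) (S : ℝ) : ℝ := ∫ p, enInt u S p

theorem enInt_nonneg (u : R2 → ℝ) (S : ℝ) (p : R2 × R2) : 0 ≤ enInt u S p := by
  have := ballInd_nonneg S p.2
  unfold enInt; positivity

theorem integrable_enInt {L : ℝ} {u : R2 → ℝ} (hu : BL L u) (S : ℝ) : Integrable (enInt u S) := by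
  have hum := hu.continuous.measurable
  have hb := measurable_ballInd S
  refine (integrable_of_le_bd (F := enInt u S) (by unfold enInt; fun_prop) (S := S)
    (C := 4 * L * L) (fun p _ h2 => by simp [enInt, ballInd_of_ge h2]) fun p => ?_).1
  have h1 := hu.abs_mul_sub_le hu p.1 p.2
  have h2 : |ballInd S p.2| ≤ 1 := by
    rcases lt_or_ge ‖p.2‖ S with h | h
    · simp [ballInd_of_lt h]
    · simp [ballInd_of_ge h]
  have h3 := hu.nonneg
  rw [enInt, abs_mul, abs_mul, sq, abs_of_nonneg (show 0 ≤ (‖p.1 - p.2‖ ^ 3)⁻¹ by positivity)]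
  calc _ ≤ (4 * L * L * min 1 (‖p.1 - p.2‖ ^ 2)) * (‖p.1 - p.2‖ ^ 3)⁻¹ * 1 := by gcongr
    _ = _ := by unfold kmin; ring

section ibp
variable {K : R2 → ℝ} {Lam L G S : ℝ} {e : R2} {k0 k1 k2 : ℕ → R2 → ℝ} {u η : R2 → ℝ}

/-- First derivative of the weight `(η_a - η_b)² k(a - b)`. -/
def wt1 (η d k k' : R2 → ℝ) (p : R2 × R2) : ℝ :=
  2 * (η p.1 - η p.2) * d p.1 * k (p.1 - p.2) + (η p.1 - η p.2) ^ 2 * k' (p.1 - p.2)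

/-- Second (mixed) derivative of the weight `(η_a - η_b)² k(a - b)`, up to sign. -/
def wt2 (η d k k' k'' : R2 → ℝ) (p : R2 × R2) : ℝ :=
  2 * d p.1 * d p.2 * k (p.1 - p.2) + 2 * (η p.1 - η p.2) * (d p.1 + d p.2) * k' (p.1 - p.2) +
    (η p.1 - η p.2) ^ 2 * k'' (p.1 - p.2)

theorem HasLineDerivAt.fst {f : R2 → ℝ} {f' : ℝ} {p : R2 × R2} (h : HasLineDerivAt ℝ f f' p.1 e) :
    HasLineDerivAt ℝ (fun p : R2 × R2 => f p.1) f' p (e, 0) := h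

theorem HasLineDerivAt.snd {f : R2 → ℝ} {f' : ℝ} {p : R2 × R2} (h : HasLineDerivAt ℝ f f' p.2 e) :
    HasLineDerivAt ℝ (fun p : R2 × R2 => f p.2) f' p (0, e) := h

theorem hasLineDerivAt_snd_left (f : R2 → ℝ) (p : R2 × R2) :
    HasLineDerivAt ℝ (fun p : R2 × R2 => f p.2) 0 p (e, 0) := by
  simpa [HasLineDerivAt] using hasDerivAt_const (0 : ℝ) (f p.2)

theorem hasLineDerivAt_fst_right (f : R2 → ℝ) (p : R2 × R2) :
    HasLineDerivAt ℝ (fun p : R2 × R2 => f p.1) 0 p (0, e) := by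
  simpa [HasLineDerivAt] using hasDerivAt_const (0 : ℝ) (f p.1)

theorem HasLineDerivAt.sub_left {f : R2 → ℝ} {f' : ℝ} {p : R2 × R2}
    (h : HasLineDerivAt ℝ f f' (p.1 - p.2) e) :
    HasLineDerivAt ℝ (fun p : R2 × R2 => f (p.1 - p.2)) f' p (e, 0) := by
  unfold HasLineDerivAt at *
  simpa [add_sub_right_comm] using h

theorem HasLineDerivAt.sub_right {f : R2 → ℝ} {f' : ℝ} {p : R2 × R2}
    (h : HasLineDerivAt ℝ f f' (p.1 - p.2) e) :
    HasLineDerivAt ℝ (fun p : R2 × R2 => f (p.1 - p.2)) (-f') p (0, e) := by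
  have h2 := h.smul (-1 : ℝ)
  unfold HasLineDerivAt at *
  simpa [sub_add_eq_sub_sub, ← sub_eq_add_neg] using h2

theorem HasLineDerivAt.mul' {f g : R2 × R2 → ℝ} {f' g' : ℝ} {p z : R2 × R2}
    (hf : HasLineDerivAt ℝ f f' p z) (hg : HasLineDerivAt ℝ g g' p z) :
    HasLineDerivAt ℝ (fun p => f p * g p) (f' * g p + f p * g') p z := by
  have := HasDerivAt.fun_mul hf hg
  simpa [HasLineDerivAt] using this

theorem HasLineDerivAt.sub' {f g : R2 × R2 → ℝ} {f' g' : ℝ} {p z : R2 × R2}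
    (hf : HasLineDerivAt ℝ f f' p z) (hg : HasLineDerivAt ℝ g g' p z) :
    HasLineDerivAt ℝ (fun p => f p - g p) (f' - g') p z := HasDerivAt.fun_sub hf hg

theorem HasLineDerivAt.add' {f g : R2 × R2 → ℝ} {f' g' : ℝ} {p z : R2 × R2}
    (hf : HasLineDerivAt ℝ f f' p z) (hg : HasLineDerivAt ℝ g g' p z) :
    HasLineDerivAt ℝ (fun p => f p + g p) (f' + g') p z := HasDerivAt.fun_add hf hg

theorem commut_approx (hLam : 0 < Lam) (hk : KernelApprox K Lam e k0 k1 k2) (hu : BC2 L u)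
    (hη : Cutoff G S η) (he : ‖e‖ ≤ 1) (n : ℕ) :
    ∫ p, commut (k0 n) η (fun x => fderiv ℝ u x e) p =
      (1 / 2) * ∫ p : R2 × R2, (u p.1 - u p.2) ^ 2 *
        wt2 η (fun x => fderiv ℝ η x e) (k0 n) (k1 n) (k2 n) p := by
  obtain ⟨C, hC, hb⟩ := hk.le_kmin hLam n
  set d : R2 → ℝ := fun x => fderiv ℝ η x e
  set w : R2 → ℝ := fun x => fderiv ℝ u x e
  have hwb := hu.bl_fderiv he
  have hL := hu.nonneg
  have hG := hη.G_nonneg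
  have mu := hu.bl.continuous.measurable
  have mw : Measurable w := hwb.continuous.measurable
  have mη := hη.bl.continuous.measurable
  have md : Measurable d := (hη.continuous_fderiv_apply e).measurable
  have m0 := (hk.cont0 n).measurable
  have m1 := (hk.cont1 n).measurable
  have m2 := (hk.cont2 n).measurable
  have hη1 := hη.abs_sub_le_one
  have hd : ∀ x, |d x| ≤ G := hη.abs_fderiv_apply_le he
  have hu2 : ∀ a b, |u a - u b| ≤ 2 * L := fun a b => by
    have := abs_sub (u a) (u b); linarith [hu.bound a, hu.bound b]
  have hz : ∀ x, S ≤ ‖x‖ → η x = 0 ∧ d x = 0 := fun x hx =>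
    ⟨hη.zero x hx, by simp [d, hη.fderiv_zero hx]⟩
  have hw1 : ∀ p, |wt1 η d (k0 n) (k1 n) p| ≤ (2 * G * C + C) * kmin (p.1 - p.2) := by
    intro p
    obtain ⟨b0, b1, -⟩ := hb (p.1 - p.2)
    have hn := kmin_nonneg (p.1 - p.2)
    refine (abs_add_le _ _).trans ?_
    rw [abs_mul, abs_mul, abs_mul, abs_mul, abs_pow, abs_two]
    calc _ ≤ 2 * 1 * G * (C * kmin (p.1 - p.2)) + 1 ^ 2 * (C * kmin (p.1 - p.2)) := by
          gcongr
          · exact hη1 _ _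
          · exact hd _
          · exact hη1 _ _
      _ = _ := by ring
  have hw2 : ∀ p, |wt2 η d (k0 n) (k1 n) (k2 n) p| ≤
      (2 * G * G * C + 2 * (G + G) * C + C) * kmin (p.1 - p.2) := by
    intro p
    obtain ⟨b0, b1, b2⟩ := hb (p.1 - p.2)
    have hn := kmin_nonneg (p.1 - p.2)
    refine (abs_add_three _ _ _).trans ?_
    rw [abs_mul, abs_mul, abs_mul, abs_mul, abs_mul, abs_mul, abs_mul, abs_pow, abs_two]
    calc _ ≤ 2 * G * G * (C * kmin (p.1 - p.2)) + 2 * 1 * (G + G) * (C * kmin (p.1 - p.2)) +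
          1 ^ 2 * (C * kmin (p.1 - p.2)) := by
          gcongr
          · exact hd _
          · exact hd _
          · exact hη1 _ _
          · exact (abs_add_le _ _).trans (add_le_add (hd _) (hd _))
          · exact hη1 _ _
      _ = _ := by ring
  have hw0 : ∀ p : R2 × R2, |(η p.1 - η p.2) ^ 2 * k0 n (p.1 - p.2)| ≤ C * kmin (p.1 - p.2) := by
    intro p
    rw [abs_mul, abs_pow]
    calc _ ≤ 1 ^ 2 * (C * kmin (p.1 - p.2)) := by
          gcongr
          · exact hη1 _ _
          · exact (hb _).1
      _ = _ := by ring
  have mul_bd : ∀ {f g : R2 × R2 → ℝ} {A B : ℝ}, (∀ p, |f p| ≤ A) →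
      (∀ p, |g p| ≤ B * kmin (p.1 - p.2)) → ∀ p, |f p * g p| ≤ (A * B) * kmin (p.1 - p.2) := by
    intro f g A B hf hg p
    rw [abs_mul, mul_assoc]
    exact mul_le_mul (hf p) (hg p) (abs_nonneg _) ((abs_nonneg _).trans (hf p))
  -- first integration by parts, in the first variable
  have step1 : ∫ p : R2 × R2, (u p.1 - u p.2) * (w p.2 * wt1 η d (k0 n) (k1 n) p) =
      -∫ p : R2 × R2, w p.1 * (w p.2 * ((η p.1 - η p.2) ^ 2 * k0 n (p.1 - p.2))) := by
    refine integral_mul_lineDeriv (z := (e, 0)) ?_ ?_ ?_ (fun p => ?_) (fun p => ?_)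
    · exact (integrable_of_le_bd (by fun_prop) (S := S)
        (fun p h1 h2 => by simp [hz _ h1, hz _ h2])
        (mul_bd (fun p => hwb.bound p.1) (mul_bd (fun p => hwb.bound p.2) hw0))).1
    · exact (integrable_of_le_bd (by unfold wt1; fun_prop) (S := S)
        (fun p h1 h2 => by simp [wt1, hz _ h1, hz _ h2])
        (mul_bd (fun p => hu2 p.1 p.2) (mul_bd (fun p => hwb.bound p.2) hw1))).1
    · exact (integrable_of_le_bd (by fun_prop) (S := S)
        (fun p h1 h2 => by simp [hz _ h1, hz _ h2])
        (mul_bd (fun p => hu2 p.1 p.2) (mul_bd (fun p => hwb.bound p.2) hw0))).1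
    · simpa using (hu.hasLineDerivAt p.1 e).fst.sub' (hasLineDerivAt_snd_left (e := e) u p)
    · have h1 := (hη.hasLineDerivAt p.1 e).fst.sub' (hasLineDerivAt_snd_left (e := e) η p)
      have h2 := (h1.mul' h1).mul' (hk.deriv1 n (p.1 - p.2)).sub_left
      have h3 := (hasLineDerivAt_snd_left (e := e) w p).mul' h2
      simp only [← sq] at h3
      convert h3 using 1
      simp only [wt1, d]; ring
  -- second integration by parts, in the second variable
  have step2 : ∫ p : R2 × R2, (u p.1 - u p.2) ^ 2 * (-wt2 η d (k0 n) (k1 n) (k2 n) p) =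
      -∫ p : R2 × R2, (-2 * ((u p.1 - u p.2) * w p.2)) * wt1 η d (k0 n) (k1 n) p := by
    have hu4 : ∀ p : R2 × R2, |(u p.1 - u p.2) ^ 2| ≤ (2 * L) ^ 2 := fun p => by
      rw [abs_pow]; gcongr; exact hu2 _ _
    refine integral_mul_lineDeriv (z := (0, e)) ?_ ?_ ?_ (fun p => ?_) (fun p => ?_)
    · refine (integrable_of_le_bd (by unfold wt1; fun_prop) (S := S)
        (fun p h1 h2 => by simp [wt1, hz _ h1, hz _ h2])
        (mul_bd (A := 2 * (2 * L * L)) (fun p => ?_) hw1)).1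
      rw [abs_mul, abs_mul, abs_neg, abs_two]
      gcongr
      · exact hu2 _ _
      · exact hwb.bound _
    · exact (integrable_of_le_bd (by unfold wt2; fun_prop) (S := S)
        (fun p h1 h2 => by simp [wt2, hz _ h1, hz _ h2])
        (mul_bd hu4 (fun p => by rw [abs_neg]; exact hw2 p))).1
    · exact (integrable_of_le_bd (by unfold wt1; fun_prop) (S := S)
        (fun p h1 h2 => by simp [wt1, hz _ h1, hz _ h2]) (mul_bd hu4 hw1)).1
    · have h1 := (hasLineDerivAt_fst_right (e := e) u p).sub' (hu.hasLineDerivAt p.2 e).snd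
      have h2 := h1.mul' h1
      simp only [← sq] at h2
      convert h2 using 1
      simp only [w]; ring
    · have h1 := (hasLineDerivAt_fst_right (e := e) η p).sub' (hη.hasLineDerivAt p.2 e).snd
      have hconst : HasLineDerivAt ℝ (fun _ : R2 × R2 => (2 : ℝ)) 0 p (0, e) :=
        hasDerivAt_const (0 : ℝ) (2 : ℝ)
      have h2 := ((hconst.mul' h1).mul' (hasLineDerivAt_fst_right (e := e) d p)).mul'
        (hk.deriv1 n (p.1 - p.2)).sub_right
      have h3 := (h1.mul' h1).mul' (hk.deriv2 n (p.1 - p.2)).sub_right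
      have h4 := h2.add' h3
      simp only [← sq] at h4
      refine (congrArg (fun t => HasLineDerivAt ℝ (wt1 η d (k0 n) (k1 n)) t p (0, e)) ?_).mpr h4
      simp only [wt2, d]; ring
  have e1 : ∀ p : R2 × R2, w p.1 * (w p.2 * ((η p.1 - η p.2) ^ 2 * k0 n (p.1 - p.2))) =
      commut (k0 n) η w p := fun p => by unfold commut; ring
  have e2 : ∀ p : R2 × R2, (-2 * ((u p.1 - u p.2) * w p.2)) * wt1 η d (k0 n) (k1 n) p =
      -2 * ((u p.1 - u p.2) * (w p.2 * wt1 η d (k0 n) (k1 n) p)) := fun p => by ring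
  simp only [e1] at step1
  simp only [e2, mul_neg, integral_neg, integral_const_mul] at step2
  linarith

/-- The commutator is controlled by the energy of `u`, through two integrations by parts. -/
theorem commut_le_en (hLam : 0 < Lam) (hk : KernelApprox K Lam e k0 k1 k2) (hu : BC2 L u)
    (hη : Cutoff G S η) (he : ‖e‖ ≤ 1) :
    |∫ p, commut K η (fun x => fderiv ℝ u x e) p| ≤ 7 * Lam * G ^ 2 * en u S := by
  have hG := hη.G_nonneg
  set d : R2 → ℝ := fun x => fderiv ℝ η x e
  have hd : ∀ x, |d x| ≤ G := hη.abs_fderiv_apply_le he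
  have hz : ∀ x, S ≤ ‖x‖ → η x = 0 ∧ d x = 0 := fun x hx =>
    ⟨hη.zero x hx, by simp [d, hη.fderiv_zero hx]⟩
  have hdom := fun n => commut_dominated (hk.cont0 n).measurable (hk.bound0 n) hη.bl
    (hu.bl_fderiv he) hη.zero
  have lim : Tendsto (fun n => ∫ p, commut (k0 n) η (fun x => fderiv ℝ u x e) p) atTop
      (𝓝 (∫ p, commut K η (fun x => fderiv ℝ u x e) p)) :=
    tendsto_integral_of_dominated_convergence _ (fun n => (hdom n).1.aestronglyMeasurable)
      ((integrable_bd S).const_mul _) (fun n => Eventually.of_forall (hdom n).2)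
      (Eventually.of_forall fun p => (hk.tendsto _).const_mul _)
  refine le_of_tendsto lim.abs (Eventually.of_forall fun n => ?_)
  rw [commut_approx hLam hk hu hη he n]
  have i1 := integrable_enInt hu.bl S
  have i2 := integrable_swap_R2.2 i1
  have hw2 : ∀ p : R2 × R2, |wt2 η d (k0 n) (k1 n) (k2 n) p| ≤
      7 * Lam * G ^ 2 * (‖p.1 - p.2‖ ^ 3)⁻¹ := by
    intro p
    obtain ⟨r, hr, h0⟩ := hk.zero n
    rcases eq_or_ne (p.1 - p.2) 0 with h | h
    · have := h0 0 (by simpa using hr)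
      simp [wt2, h, this]
    · have hy := norm_pos_iff.2 h
      have hl := hη.lip p.1 p.2
      refine (abs_add_three _ _ _).trans ?_
      rw [abs_mul, abs_mul, abs_mul, abs_mul, abs_mul, abs_mul, abs_mul, abs_pow, abs_two]
      set y := p.1 - p.2
      calc _ ≤ 2 * G * G * (Lam * (‖y‖ ^ 3)⁻¹) + 2 * (G * ‖y‖) * (G + G) * (Lam * (‖y‖ ^ 4)⁻¹) +
          (G * ‖y‖) ^ 2 * (Lam * (‖y‖ ^ 5)⁻¹) := by
            gcongr
            · exact hd _
            · exact hd _
            · exact hk.bound0 n y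
            · exact (abs_add_le _ _).trans (add_le_add (hd _) (hd _))
            · exact hk.bound1 n y
            · exact hk.bound2 n y
        _ = _ := by field_simp; ring
  have hle : ∀ p : R2 × R2, |(u p.1 - u p.2) ^ 2 * wt2 η d (k0 n) (k1 n) (k2 n) p| ≤
      7 * Lam * G ^ 2 * (enInt u S p + enInt u S (p.2, p.1)) := by
    intro p
    have hsum : enInt u S p + enInt u S (p.2, p.1) = (u p.1 - u p.2) ^ 2 *
        (‖p.1 - p.2‖ ^ 3)⁻¹ * (ballInd S p.1 + ballInd S p.2) := by
      simp only [enInt, norm_sub_rev p.2 p.1]; ring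
    have hnn : 0 ≤ enInt u S p + enInt u S (p.2, p.1) :=
      add_nonneg (enInt_nonneg _ _ _) (enInt_nonneg _ _ _)
    by_cases h1 : S ≤ ‖p.1‖ ∧ S ≤ ‖p.2‖
    · have : wt2 η d (k0 n) (k1 n) (k2 n) p = 0 := by
        simp [wt2, hz _ h1.1, hz _ h1.2]
      rw [this]; simp only [mul_zero, abs_zero]; positivity
    · have h3 : 1 ≤ ballInd S p.1 + ballInd S p.2 := by
        have n1 := ballInd_nonneg S p.1
        have n2 := ballInd_nonneg S p.2
        rcases lt_or_ge ‖p.1‖ S with h | h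
        · rw [ballInd_of_lt h]; linarith
        · rcases lt_or_ge ‖p.2‖ S with h' | h'
          · rw [ballInd_of_lt h']; linarith
          · exact absurd ⟨h, h'⟩ h1
      rw [abs_mul, abs_of_nonneg (sq_nonneg (u p.1 - u p.2)), hsum]
      calc _ ≤ (u p.1 - u p.2) ^ 2 * (7 * Lam * G ^ 2 * (‖p.1 - p.2‖ ^ 3)⁻¹) := by
            gcongr; exact hw2 p
        _ = 7 * Lam * G ^ 2 * ((u p.1 - u p.2) ^ 2 * (‖p.1 - p.2‖ ^ 3)⁻¹ * 1) := by ring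
        _ ≤ _ := by gcongr
  have hint : ∫ p, 7 * Lam * G ^ 2 * (enInt u S p + enInt u S (p.2, p.1)) =
      7 * Lam * G ^ 2 * (2 * en u S) := by
    rw [integral_const_mul, integral_add i1 i2, integral_swap_R2 (enInt u S), en]; ring
  have hI : Integrable (fun p : R2 × R2 =>
      7 * Lam * G ^ 2 * (enInt u S p + enInt u S (p.2, p.1))) := (i1.add i2).const_mul _
  have := norm_integral_le_of_norm_le hI (f := fun p : R2 × R2 =>
    (u p.1 - u p.2) ^ 2 * wt2 η d (k0 n) (k1 n) (k2 n) p) (Eventually.of_forall hle)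
  rw [hint, Real.norm_eq_abs] at this
  rw [abs_mul, abs_of_nonneg (by norm_num : (0 : ℝ) ≤ 1 / 2)]
  linarith

end ibp

theorem integral_conv_mul (k h : R2 → ℝ) :
    ∫ p : R2 × R2, k (p.1 - p.2) * h p.2 = (∫ y, k y) * ∫ x, h x := by
  rw [integral_shear (fun p => k p.1 * h p.2)]
  exact integral_prod_mul k h

theorem integrable_conv_mul {k h : R2 → ℝ} (hk : Integrable k) (hh : Integrable h) :
    Integrable (fun p : R2 × R2 => k (p.1 - p.2) * h p.2) :=
  (integrable_shear (F := fun p => k p.1 * h p.2)).2 (hk.mul_prod hh)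

section dbound

variable {c M C A lam Lam Lam' L G S : ℝ} {v W : ℝ → ℝ} {u η : R2 → ℝ} {e : R2}

theorem Cutoff.integrable (h : Cutoff G S η) : Integrable η := h.bl.integrable h.zero

theorem Cutoff.abs_fderiv_le_ballInd (h : Cutoff G S η) (he : ‖e‖ ≤ 1) (x : R2) :
    |fderiv ℝ η x e| ≤ G * ballInd S x := by
  rcases lt_or_ge ‖x‖ S with hx | hx
  · rw [ballInd_of_lt hx, mul_one]; exact h.abs_fderiv_apply_le he x
  · simp [h.fderiv_zero hx, ballInd_of_ge hx]

theorem Cutoff.bl_mul (hη : Cutoff G S η) {w : R2 → ℝ} (hw : BL L w) :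
    BL (2 * max 1 G * L) (fun x => η x * w x) := hη.bl.mul hw

theorem Cutoff.mul_zero_of_ge (hη : Cutoff G S η) (w : R2 → ℝ) (x : R2) (hx : S ≤ ‖x‖) :
    η x * w x = 0 := by rw [hη.zero x hx, zero_mul]

theorem Cutoff.integrable_mul (hη : Cutoff G S η) {w : R2 → ℝ} (hw : BL L w) :
    Integrable (fun x => η x * w x) := (hη.bl_mul hw).integrable (hη.mul_zero_of_ge w)

theorem Cutoff.integrable_fderiv_apply (h : Cutoff G S η) (he : ‖e‖ ≤ 1) :
    Integrable (fun x => fderiv ℝ η x e) :=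
  ((integrable_ballInd S).const_mul G).mono' (h.continuous_fderiv_apply e).aestronglyMeasurable
    (Eventually.of_forall (h.abs_fderiv_le_ballInd he))

/-- The signed integral of a directional derivative is small. -/
theorem abs_integral_cutoff_mul_fderiv_le (hu : BC2 L u) (hM : ∀ x, |u x| ≤ M) (hη : Cutoff G S η)
    (hS : 0 ≤ S) (he : ‖e‖ ≤ 1) :
    |∫ x, η x * fderiv ℝ u x e| ≤ M * G * (S ^ 2 * discArea) := by
  have hM0 : 0 ≤ M := (abs_nonneg _).trans (hM 0)
  have hG := hη.G_nonneg
  have hi : Integrable (fun x => fderiv ℝ η x e * u x) :=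
    (hη.integrable_fderiv_apply he).mul_bdd hu.bl.continuous.aestronglyMeasurable
      (Eventually.of_forall hM)
  have h := integral_bilinear_hasLineDerivAt_right_eq_neg_left_of_integrable (μ := (volume : Measure R2))
    (B := ContinuousLinearMap.mul ℝ ℝ) (f := η) (g := u) (f' := fun x => fderiv ℝ η x e)
    (g' := fun x => fderiv ℝ u x e) (v := e) hi (hη.integrable_mul (hu.bl_fderiv he))
    (hη.integrable_mul hu.bl) (fun x _ => hη.hasLineDerivAt x e) (fun x _ => hu.hasLineDerivAt x e)
  simp only [ContinuousLinearMap.mul_apply'] at h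
  rw [h, abs_neg, ← integral_ballInd hS, ← integral_const_mul]
  refine norm_integral_le_of_norm_le (f := fun x => fderiv ℝ η x e * u x)
    ((integrable_ballInd S).const_mul _) (Eventually.of_forall fun x => ?_)
  rw [Real.norm_eq_abs, abs_mul]
  calc _ ≤ (G * ballInd S x) * M := by
        gcongr
        · exact mul_nonneg hG (ballInd_nonneg _ _)
        · exact hη.abs_fderiv_le_ballInd he x
        · exact hM x
    _ = _ := by ring

/-- Stability bounds the total variation of a directional derivative by the energy. -/
theorem sq_integral_abs_le (hK : EllipticKernel (Kbar v) lam Lam) (hu : StableData c v W L u)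
    (hW : ContDiff ℝ 2 W) (hA : ∀ s, |deriv (deriv W) s| ≤ A) (hM : ∀ x, |u x| ≤ M)
    {k0 k1 k2 : ℕ → R2 → ℝ} (hLam : 0 < Lam') (hk : KernelApprox (Kbar v) Lam' e k0 k1 k2)
    (hη : Cutoff G S η) (hS : 0 < S) (he : ‖e‖ ≤ 1) :
    (∫ x, η x * |fderiv ℝ u x e|) ^ 2 ≤ (M * G * (S ^ 2 * discArea)) ^ 2 +
      (2 * S) ^ 3 / (2 * lam) * (7 * Lam' * G ^ 2 * en u S) := by
  have hlam := hK.lam_pos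
  set w : R2 → ℝ := fun x => fderiv ℝ u x e
  have hw := hu.bc2.bl_fderiv he
  obtain ⟨hi, hle⟩ := signDefect_le hK hu hW hA he hη.bl hη.contDiff hη.zero
  have hP := (le_abs_self _).trans (commut_le_en hLam hk hu.bc2 hη he)
  have hJ := abs_integral_cutoff_mul_fderiv_le hu.bc2 hM hη hS.le he
  have i1 := hη.integrable_mul hw
  have i2 := hη.integrable_mul hw.abs
  set q := lam * ((2 * S) ^ 3)⁻¹
  have hq : 0 < q := by positivity
  have hpt : ∀ p : R2 × R2, q * ((η p.1 * |w p.1|) * (η p.2 * |w p.2|) -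
      (η p.1 * w p.1) * (η p.2 * w p.2)) ≤ signDefect (Kbar v) η w p := by
    intro p
    have hsd : (η p.1 * |w p.1|) * (η p.2 * |w p.2|) - (η p.1 * w p.1) * (η p.2 * w p.2) =
      (|w p.1| * |w p.2| - w p.1 * w p.2) * (η p.1 * η p.2) := by ring
    rw [hsd, signDefect]
    have h0 : 0 ≤ |w p.1| * |w p.2| - w p.1 * w p.2 := by
      rw [← abs_mul]; linarith [le_abs_self (w p.1 * w p.2)]
    have h1 := mul_nonneg (hη.nonneg p.1) (hη.nonneg p.2)
    by_cases hp : S ≤ ‖p.1‖ ∨ S ≤ ‖p.2‖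
    · rcases hp with h | h <;> simp [hη.zero _ h]
    · push Not at hp
      rcases eq_or_ne (p.1 - p.2) 0 with h | h
      · rw [sub_eq_zero.1 h]; simp
      · have hy := norm_pos_iff.2 h
        have : q ≤ Kbar v (p.1 - p.2) := by
          refine le_trans ?_ (hK.lower _)
          simp only [q]
          gcongr
          linarith [norm_sub_le p.1 p.2]
        nlinarith [mul_nonneg (mul_nonneg h0 h1) (sub_nonneg.2 this)]
  have j1 : Integrable (fun p : R2 × R2 => (η p.1 * |w p.1|) * (η p.2 * |w p.2|)) := i2.mul_prod i2
  have j2 : Integrable (fun p : R2 × R2 => (η p.1 * w p.1) * (η p.2 * w p.2)) := i1.mul_prod i1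
  have hint := integral_mono ((j1.sub j2).const_mul q) hi hpt
  have e1 : ∫ p : R2 × R2, (η p.1 * |w p.1|) * (η p.2 * |w p.2|) = (∫ x, η x * |w x|) ^ 2 := by
    rw [sq]; exact integral_prod_mul (fun x => η x * |w x|) (fun x => η x * |w x|)
  have e2 : ∫ p : R2 × R2, (η p.1 * w p.1) * (η p.2 * w p.2) = (∫ x, η x * w x) ^ 2 := by
    rw [sq]; exact integral_prod_mul (fun x => η x * w x) (fun x => η x * w x)
  simp only [Pi.sub_apply] at hint
  rw [integral_const_mul, integral_sub j1 j2, e1, e2] at hint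
  have h2 : (∫ x, η x * |w x|) ^ 2 - (∫ x, η x * w x) ^ 2 ≤
      q⁻¹ / 2 * (7 * Lam' * G ^ 2 * en u S) := by
    have : (∫ x, η x * |w x|) ^ 2 - (∫ x, η x * w x) ^ 2 ≤
      q⁻¹ * ∫ p, signDefect (Kbar v) η w p := by
      rw [le_inv_mul_iff₀ hq]; exact hint
    have h3 : 0 ≤ q⁻¹ := by positivity
    nlinarith
  have h3 : q⁻¹ / 2 = (2 * S) ^ 3 / (2 * lam) := by simp only [q]; field_simp
  have h4 : (∫ x, η x * w x) ^ 2 ≤ (M * G * (S ^ 2 * discArea)) ^ 2 :=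
    sq_le_sq' (abs_le.1 hJ).1 (abs_le.1 hJ).2
  rw [h3] at h2
  linarith

variable {ρ : R2 → ℝ} {g s : ℝ}

/-- The mollified self-correlation of a localized derivative, by integration by parts. -/
theorem abs_integral_mollified_le (hu : BC2 L u) (hM : ∀ x, |u x| ≤ M) (hη : Cutoff G S η)
    (hρ : Cutoff g s ρ) (hs : 0 ≤ s) (he : ‖e‖ ≤ 1) :
    |∫ p : R2 × R2, ρ (p.1 - p.2) * ((η p.1 * fderiv ℝ u p.1 e) * (η p.2 * fderiv ℝ u p.2 e))| ≤
      M * (g + G) * (s ^ 2 * discArea) * ∫ x, η x * |fderiv ℝ u x e| := by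
  have hM0 : 0 ≤ M := (abs_nonneg _).trans (hM 0)
  have hG := hη.G_nonneg
  have hg := hρ.G_nonneg
  have hw := hu.bl_fderiv he
  set w : R2 → ℝ := fun x => fderiv ℝ u x e
  have mu := hu.bl.continuous
  have mw : Continuous w := hw.continuous
  have mη := hη.bl.continuous
  have mρ := hρ.bl.continuous
  have mdη := hη.continuous_fderiv_apply e
  have mdρ := hρ.continuous_fderiv_apply e
  have i2 := hη.integrable_mul hw.abs
  have hdom : Integrable (fun p : R2 × R2 => ballInd s (p.1 - p.2) * (η p.2 * |w p.2|)) :=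
    integrable_conv_mul (integrable_ballInd s) i2
  have habs : ∀ p : R2 × R2, |η p.2 * w p.2| = η p.2 * |w p.2| := fun p => by
    rw [abs_mul, abs_of_nonneg (hη.nonneg _)]
  have hnn : ∀ p : R2 × R2, 0 ≤ ballInd s (p.1 - p.2) * (η p.2 * |w p.2|) := fun p =>
    mul_nonneg (ballInd_nonneg _ _) (mul_nonneg (hη.nonneg _) (abs_nonneg _))
  have hρb : ∀ y, |ρ y| ≤ ballInd s y := fun y => by
    rcases lt_or_ge ‖y‖ s with hx | hx
    · rw [ballInd_of_lt hx]; exact hρ.abs_le_one y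
    · simp [hρ.zero y hx, ballInd_of_ge hx]
  have hd : ∀ p : R2 × R2, |(fderiv ℝ ρ (p.1 - p.2) e * η p.1 + ρ (p.1 - p.2) * fderiv ℝ η p.1 e) *
      (η p.2 * w p.2)| ≤ (g + G) * (ballInd s (p.1 - p.2) * (η p.2 * |w p.2|)) := by
    intro p
    have hb := ballInd_nonneg s (p.1 - p.2)
    have e0 : (g + G) * (ballInd s (p.1 - p.2) * (η p.2 * |w p.2|)) =
        (g + G) * ballInd s (p.1 - p.2) * (η p.2 * |w p.2|) := by ring
    rw [abs_mul, habs, e0]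
    gcongr
    · exact mul_nonneg (hη.nonneg _) (abs_nonneg _)
    · refine (abs_add_le _ _).trans ?_
      rw [abs_mul, abs_mul]
      calc _ ≤ (g * ballInd s (p.1 - p.2)) * 1 + ballInd s (p.1 - p.2) * G := by
            gcongr
            · exact hρ.abs_fderiv_le_ballInd he _
            · exact hη.abs_le_one _
            · exact hρb _
            · exact hη.abs_fderiv_apply_le he _
        _ = _ := by ring
  have hd0 : ∀ p : R2 × R2, |(ρ (p.1 - p.2) * η p.1) * (η p.2 * w p.2)| ≤
      1 * (ballInd s (p.1 - p.2) * (η p.2 * |w p.2|)) := by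
    intro p
    have hb := ballInd_nonneg s (p.1 - p.2)
    rw [abs_mul, habs, one_mul, abs_mul]
    gcongr
    · exact mul_nonneg (hη.nonneg _) (abs_nonneg _)
    · calc _ ≤ ballInd s (p.1 - p.2) * 1 := by
            gcongr
            · exact hρb _
            · exact hη.abs_le_one _
        _ = _ := mul_one _
  have I1 : Integrable (fun p : R2 × R2 => ((fderiv ℝ ρ (p.1 - p.2) e * η p.1 +
      ρ (p.1 - p.2) * fderiv ℝ η p.1 e) * (η p.2 * w p.2))) :=
    (hdom.const_mul _).mono' (by fun_prop) (Eventually.of_forall hd)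
  have I0 : Integrable (fun p : R2 × R2 => ((ρ (p.1 - p.2) * η p.1) * (η p.2 * w p.2))) :=
    (hdom.const_mul _).mono' (by fun_prop) (Eventually.of_forall hd0)
  have h := integral_mul_lineDeriv (z := (e, (0 : R2)))
    (f := fun p : R2 × R2 => (ρ (p.1 - p.2) * η p.1) * (η p.2 * w p.2))
    (f' := fun p : R2 × R2 => (fderiv ℝ ρ (p.1 - p.2) e * η p.1 +
      ρ (p.1 - p.2) * fderiv ℝ η p.1 e) * (η p.2 * w p.2))
    (g := fun p => u p.1) (g' := fun p => w p.1)
    (I1.mul_bdd (by fun_prop) (Eventually.of_forall fun p => hM p.1))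
    (I0.mul_bdd (by fun_prop) (Eventually.of_forall fun p => hw.bound p.1))
    (I0.mul_bdd (by fun_prop) (Eventually.of_forall fun p => hM p.1))
    (fun p => by
      have h1 := (hρ.hasLineDerivAt (p.1 - p.2) e).sub_left.mul' (hη.hasLineDerivAt p.1 e).fst
      have h2 := h1.mul' (hasLineDerivAt_snd_left (e := e) (fun x => η x * w x) p)
      simpa using h2)
    (fun p => (hu.hasLineDerivAt p.1 e).fst)
  have e1 : ∀ p : R2 × R2, ρ (p.1 - p.2) * ((η p.1 * w p.1) * (η p.2 * w p.2)) =
      (ρ (p.1 - p.2) * η p.1) * (η p.2 * w p.2) * w p.1 := fun p => by ring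
  change |∫ p : R2 × R2, ρ (p.1 - p.2) * ((η p.1 * w p.1) * (η p.2 * w p.2))| ≤
    M * (g + G) * (s ^ 2 * discArea) * ∫ x, η x * |w x|
  simp only [e1]
  rw [h, abs_neg]
  have e2 : M * (g + G) * (s ^ 2 * discArea) * ∫ x, η x * |w x| =
      ∫ p : R2 × R2, M * (g + G) * (ballInd s (p.1 - p.2) * (η p.2 * |w p.2|)) := by
    rw [integral_const_mul, integral_conv_mul (ballInd s) (fun x => η x * |w x|),
      integral_ballInd hs]; ring
  rw [e2]
  refine norm_integral_le_of_norm_le (f := fun p : R2 × R2 => (fderiv ℝ ρ (p.1 - p.2) e * η p.1 +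
    ρ (p.1 - p.2) * fderiv ℝ η p.1 e) * (η p.2 * w p.2) * u p.1) (hdom.const_mul _)
    (Eventually.of_forall fun p => ?_)
  rw [Real.norm_eq_abs, abs_mul]
  calc _ ≤ ((g + G) * (ballInd s (p.1 - p.2) * (η p.2 * |w p.2|))) * M := by
        gcongr
        · exact mul_nonneg (add_nonneg hg hG) (hnn p)
        · exact hd p
        · exact hM _
    _ = _ := by ring

/-- Interpolation of the localized `L²` norm of a derivative between its fractional energy and its
`L¹` norm. -/
theorem sq_integral_le_interp (hK : EllipticKernel (Kbar v) lam Lam) (hu : BC2 L u)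
    (hM : ∀ x, |u x| ≤ M) (hη : Cutoff G S η) (hρ : Cutoff g s ρ) (hs : 0 < s) (he : ‖e‖ ≤ 1) :
    2 * (∫ x, ρ x) * ∫ x, (η x * fderiv ℝ u x e) ^ 2 ≤
      s ^ 3 / lam * (∫ p, bil (Kbar v) (fun x => η x * fderiv ℝ u x e)
        (fun x => η x * fderiv ℝ u x e) p) +
      2 * (M * (g + G) * (s ^ 2 * discArea) * ∫ x, η x * |fderiv ℝ u x e|) := by
  have hlam := hK.lam_pos
  have hcor := abs_integral_mollified_le hu hM hη hρ hs.le he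
  have hw := hu.bl_fderiv he
  set φ : R2 → ℝ := fun x => η x * fderiv ℝ u x e
  have hφ : BL _ φ := hη.bl_mul hw
  have hφS := hη.mul_zero_of_ge (fun x => fderiv ℝ u x e)
  have hφi : Integrable φ := hη.integrable_mul hw
  have hφ2 : Integrable (fun x => φ x ^ 2) := by
    simp only [sq]
    exact (hφ.mul hφ).integrable (S := S) (fun x hx => by simp [φ, hη.zero x hx])
  have mφ := hφ.continuous
  have mρ := hρ.bl.continuous
  have j1 : Integrable (fun p : R2 × R2 => ρ (p.1 - p.2) * φ p.2 ^ 2) :=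
    integrable_conv_mul hρ.integrable hφ2
  have hρn : Integrable (fun x => ρ (-x)) := hρ.integrable.comp_neg
  have j2' : Integrable (fun p : R2 × R2 => ρ (-(p.1 - p.2)) * φ p.2 ^ 2) :=
    integrable_conv_mul hρn hφ2
  have j2 : Integrable (fun p : R2 × R2 => ρ (p.1 - p.2) * φ p.1 ^ 2) := by
    simpa using integrable_swap_R2.2 j2'
  have j3 : Integrable (fun p : R2 × R2 => ρ (p.1 - p.2) * (φ p.1 * φ p.2)) := by
    refine (j1.add j2).mono' (by fun_prop) (Eventually.of_forall fun p => ?_)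
    rw [Real.norm_eq_abs, abs_mul, abs_of_nonneg (hρ.nonneg _), Pi.add_apply, ← mul_add]
    gcongr
    · exact hρ.nonneg _
    · rw [abs_le]; constructor <;> nlinarith [sq_nonneg (φ p.1 - φ p.2), sq_nonneg (φ p.1 + φ p.2)]
  have v1 : ∫ p : R2 × R2, ρ (p.1 - p.2) * φ p.2 ^ 2 = (∫ x, ρ x) * ∫ x, φ x ^ 2 :=
    integral_conv_mul ρ (fun x => φ x ^ 2)
  have v2 : ∫ p : R2 × R2, ρ (p.1 - p.2) * φ p.1 ^ 2 = (∫ x, ρ x) * ∫ x, φ x ^ 2 := by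
    rw [← integral_neg_eq_self (fun x => ρ x),
      ← integral_conv_mul (fun x => ρ (-x)) (fun x => φ x ^ 2),
      ← integral_swap_R2 (fun p => ρ (p.1 - p.2) * φ p.1 ^ 2)]
    simp
  have hbil := (bil_dominated hK hφ hφ hφS).1
  have hle : ∀ p : R2 × R2, ρ (p.1 - p.2) * φ p.2 ^ 2 + ρ (p.1 - p.2) * φ p.1 ^ 2 -
      2 * (ρ (p.1 - p.2) * (φ p.1 * φ p.2)) ≤ s ^ 3 / lam * bil (Kbar v) φ φ p := by
    intro p
    have e1 : ρ (p.1 - p.2) * φ p.2 ^ 2 + ρ (p.1 - p.2) * φ p.1 ^ 2 -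
      2 * (ρ (p.1 - p.2) * (φ p.1 * φ p.2)) = (φ p.1 - φ p.2) ^ 2 * ρ (p.1 - p.2) := by ring
    have e2 : s ^ 3 / lam * bil (Kbar v) φ φ p =
      (φ p.1 - φ p.2) ^ 2 * (s ^ 3 / lam * Kbar v (p.1 - p.2)) := by unfold bil; ring
    rw [e1, e2]
    rcases eq_or_ne (p.1 - p.2) 0 with h | h
    · rw [sub_eq_zero.1 h]; simp
    gcongr
    rcases lt_or_ge ‖p.1 - p.2‖ s with hy | hy
    · have hy0 := norm_pos_iff.2 h
      calc ρ (p.1 - p.2) ≤ 1 := hρ.le_one _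
        _ = s ^ 3 / lam * (lam * (s ^ 3)⁻¹) := by field_simp
        _ ≤ s ^ 3 / lam * (lam * (‖p.1 - p.2‖ ^ 3)⁻¹) := by gcongr
        _ ≤ _ := by gcongr; exact hK.lower _
    · rw [hρ.zero _ hy]
      have := hK.nonneg (p.1 - p.2)
      positivity
  have j12 : Integrable (fun p : R2 × R2 => ρ (p.1 - p.2) * φ p.2 ^ 2 + ρ (p.1 - p.2) * φ p.1 ^ 2) :=
    j1.add j2
  have hint := integral_mono (j12.sub (j3.const_mul 2)) (hbil.const_mul _) hle
  simp only [Pi.sub_apply] at hint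
  rw [integral_sub j12 (j3.const_mul 2), integral_add j1 j2, integral_const_mul,
    integral_const_mul, v1, v2] at hint
  have := (abs_le.1 hcor).2
  linarith

end dbound

/-- A standard basis vector of the plane. -/
def basisVec (i : Fin 2) : R2 := EuclideanSpace.single i 1

theorem norm_basisVec (i : Fin 2) : ‖basisVec i‖ ≤ 1 := by simp [basisVec]

theorem norm_sq_le_sum_basisVec (T : R2 →L[ℝ] ℝ) :
    ‖T‖ ^ 2 ≤ T (basisVec 0) ^ 2 + T (basisVec 1) ^ 2 := by
  set N := √(T (basisVec 0) ^ 2 + T (basisVec 1) ^ 2) with hN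
  have hN2 : N ^ 2 = T (basisVec 0) ^ 2 + T (basisVec 1) ^ 2 := Real.sq_sqrt (by positivity)
  have : ‖T‖ ≤ N := by
    refine T.opNorm_le_bound (Real.sqrt_nonneg _) fun x => ?_
    have hx : x = x 0 • basisVec 0 + x 1 • basisVec 1 := by
      ext i; fin_cases i <;> simp [basisVec]
    have hTx : T x = x 0 * T (basisVec 0) + x 1 * T (basisVec 1) := by
      conv_lhs => rw [hx]
      simp
    have hn : ‖x‖ ^ 2 = x 0 ^ 2 + x 1 ^ 2 := by
      rw [EuclideanSpace.norm_sq_eq]; simp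
    refine abs_le_of_sq_le_sq ?_ (by positivity)
    rw [mul_pow, hN2, hn, hTx]
    nlinarith [sq_nonneg (x 0 * T (basisVec 1) - x 1 * T (basisVec 0))]
  calc ‖T‖ ^ 2 ≤ N ^ 2 := by gcongr
    _ = _ := hN2

theorem norm_le_sum_basisVec (T : R2 →L[ℝ] ℝ) :
    ‖T‖ ≤ |T (basisVec 0)| + |T (basisVec 1)| := by
  refine le_of_sq_le_sq ((norm_sq_le_sum_basisVec T).trans ?_) (by positivity)
  rw [← sq_abs (T (basisVec 0)), ← sq_abs (T (basisVec 1))]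
  nlinarith [mul_nonneg (abs_nonneg (T (basisVec 0))) (abs_nonneg (T (basisVec 1)))]

theorem integrable_mul_ballInd {F : R2 → ℝ} {B : ℝ} (hF : Continuous F) (hB : ∀ x, |F x| ≤ B) (S : ℝ) :
    Integrable (fun x => F x * ballInd S x) :=
  (integrable_ballInd S).bdd_mul hF.aestronglyMeasurable (Eventually.of_forall hB)

/-- Averaging along a short segment. -/
theorem integral_segment_le {F : R2 → ℝ} {B R : ℝ} (hF : Continuous F) (h0 : ∀ x, 0 ≤ F x)
    (hB : ∀ x, F x ≤ B) {y : R2} (hy : ‖y‖ ≤ R) :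
    Integrable (fun x => (∫ t in Icc (0 : ℝ) 1, F (x + t • y)) * ballInd R x) ∧
    ∫ x, (∫ t in Icc (0 : ℝ) 1, F (x + t • y)) * ballInd R x ≤ ∫ x, F x * ballInd (2 * R) x := by
  have hFa : ∀ x, |F x| ≤ B := fun x => by rw [abs_of_nonneg (h0 x)]; exact hB x
  have hm := measurable_ballInd R
  have hi : Integrable (fun q : R2 × ℝ => F (q.1 + q.2 • y) * ballInd R q.1)
      (volume.prod (volume.restrict (Icc (0 : ℝ) 1))) := by
    have h1 : Integrable (fun q : R2 × ℝ => ballInd R q.1 * (1 : ℝ))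
        (volume.prod (volume.restrict (Icc (0 : ℝ) 1))) :=
      (integrable_ballInd R).mul_prod (integrable_const 1)
    simp only [mul_one] at h1
    exact h1.bdd_mul (Continuous.aestronglyMeasurable (by fun_prop))
      (Eventually.of_forall fun q => hFa _)
  have hI := hi.integral_prod_left
  simp only [integral_mul_const] at hI
  refine ⟨hI, ?_⟩
  have e1 : ∫ x, (∫ t in Icc (0 : ℝ) 1, F (x + t • y)) * ballInd R x =
      ∫ t in Icc (0 : ℝ) 1, ∫ x, F (x + t • y) * ballInd R x := by
    rw [← integral_integral_swap hi]
    simp only [integral_mul_const]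
  have hb : ∀ t ∈ Icc (0 : ℝ) 1, ∫ x, F (x + t • y) * ballInd R x ≤ ∫ x, F x * ballInd (2 * R) x := by
    intro t ht
    have e2 : ∫ x, F (x + t • y) * ballInd R x = ∫ x, F x * ballInd R (x - t • y) := by
      rw [← integral_add_right_eq_self (fun x => F x * ballInd R (x - t • y)) (t • y)]
      simp
    rw [e2]
    refine integral_mono ?_ (integrable_mul_ballInd hF hFa _) fun x => ?_
    · exact ((integrable_ballInd R).comp_sub_right (t • y)).bdd_mul hF.aestronglyMeasurable
        (Eventually.of_forall hFa)
    · refine mul_le_mul_of_nonneg_left ?_ (h0 x)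
      rcases lt_or_ge ‖x - t • y‖ R with h | h
      · have h1 : ‖t • y‖ ≤ 1 * R := by
          rw [norm_smul, Real.norm_of_nonneg ht.1]
          exact mul_le_mul ht.2 hy (norm_nonneg _) zero_le_one
        rw [ballInd_of_lt h, ballInd_of_lt]
        linarith [norm_le_norm_sub_add x (t • y)]
      · rw [ballInd_of_ge h]; exact ballInd_nonneg _ _
  rw [e1]
  calc _ ≤ ∫ t in Icc (0 : ℝ) 1, ∫ x, F x * ballInd (2 * R) x :=
        setIntegral_mono_on hi.integral_prod_right (by simp) measurableSet_Icc hb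
    _ = _ := by simp

section split
variable {u : R2 → ℝ} {L M R δ : ℝ}

theorem BC2.abs_increment_le (hu : BC2 L u) (x y : R2) :
    |u (x + y) - u x| ≤ ‖y‖ * ∫ t in Icc (0 : ℝ) 1, ‖fderiv ℝ u (x + t • y)‖ := by
  have hc := hu.contDiff.continuous_fderiv (by norm_num)
  have hd : ∀ t ∈ uIcc (0 : ℝ) 1, HasDerivAt (fun t : ℝ => u (x + t • y)) (fderiv ℝ u (x + t • y) y) t :=
    fun t _ => by
      have h1 := (hu.differentiable (x + t • y)).hasFDerivAt
      have h2 : HasDerivAt (fun t : ℝ => x + t • y) y t := by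
        simpa using ((hasDerivAt_id t).smul_const y).const_add x
      exact h1.comp_hasDerivAt t h2
  have hcont : Continuous fun t : ℝ => fderiv ℝ u (x + t • y) y := by fun_prop
  have h := intervalIntegral.integral_eq_sub_of_hasDerivAt hd (hcont.intervalIntegrable _ _)
  simp only [one_smul, zero_smul, add_zero] at h
  rw [← h, intervalIntegral.integral_of_le zero_le_one, integral_Icc_eq_integral_Ioc,
    ← integral_const_mul]
  have hi : IntegrableOn (fun t : ℝ => ‖y‖ * ‖fderiv ℝ u (x + t • y)‖) (Ioc 0 1) :=
    (Continuous.integrableOn_Icc (by fun_prop)).mono_set Ioc_subset_Icc_self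
  refine norm_integral_le_of_norm_le (f := fun t : ℝ => fderiv ℝ u (x + t • y) y) hi (Eventually.of_forall fun t => ?_)
  rw [mul_comm]
  exact (fderiv ℝ u (x + t • y)).le_opNorm y

theorem sq_integral_Icc_le {f : ℝ → ℝ} (hf : Continuous f) :
    (∫ t in Icc (0 : ℝ) 1, f t) ^ 2 ≤ ∫ t in Icc (0 : ℝ) 1, f t ^ 2 := by
  set m := ∫ t in Icc (0 : ℝ) 1, f t with hm
  have i1 : IntegrableOn f (Icc 0 1) := hf.integrableOn_Icc
  have i2 : IntegrableOn (fun t => f t ^ 2) (Icc 0 1) := (hf.pow 2).integrableOn_Icc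
  have h : 0 ≤ ∫ t in Icc (0 : ℝ) 1, (f t ^ 2 - 2 * m * f t + m ^ 2) :=
    integral_nonneg fun t => by simp only [Pi.zero_apply]; nlinarith [sq_nonneg (f t - m)]
  have i3 : IntegrableOn (fun t => f t ^ 2 - 2 * m * f t) (Icc 0 1) := i2.sub (i1.const_mul _)
  rw [integral_add i3 (by simp), integral_sub i2 (i1.const_mul _),
    integral_const_mul, ← hm] at h
  simp at h
  nlinarith

theorem BC2.sq_increment_le (hu : BC2 L u) (x y : R2) :
    (u (x + y) - u x) ^ 2 ≤ ‖y‖ ^ 2 * ∫ t in Icc (0 : ℝ) 1, ‖fderiv ℝ u (x + t • y)‖ ^ 2 := by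
  have hc := hu.contDiff.continuous_fderiv (by norm_num)
  rw [← sq_abs]
  calc _ ≤ (‖y‖ * ∫ t in Icc (0 : ℝ) 1, ‖fderiv ℝ u (x + t • y)‖) ^ 2 := by
        gcongr; exact hu.abs_increment_le x y
    _ ≤ _ := by
        rw [mul_pow]; gcongr
        exact sq_integral_Icc_le (by fun_prop)

/-- Interpolation of the local fractional energy between `L¹` and `L²` norms of the gradient. -/
theorem en_le (hu : BC2 L u) (hM : ∀ x, |u x| ≤ M) (hδ : 0 < δ) (hR : δ ≤ R) :
    en u R ≤ (∫ x, ‖fderiv ℝ u x‖ ^ 2 * ballInd (2 * R) x) * (2 * discArea * δ) +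
      2 * M * (∫ x, ‖fderiv ℝ u x‖ * ballInd (2 * R) x) * (2 * discArea * log (R / δ)) +
      4 * M ^ 2 * (R ^ 2 * discArea) * (2 * discArea * R⁻¹) := by
  have hR0 : 0 < R := hδ.trans_le hR
  have hM0 : 0 ≤ M := (abs_nonneg _).trans (hM 0)
  have hL := hu.nonneg
  have hc := hu.contDiff.continuous_fderiv (by norm_num)
  have cu := hu.bl.continuous
  obtain ⟨n1, n2⟩ := radial_near hδ
  obtain ⟨m1, m2⟩ := radial_mid hδ hR
  obtain ⟨f1, f2⟩ := radial_far hR0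
  set D := ∫ x, ‖fderiv ℝ u x‖ ^ 2 * ballInd (2 * R) x
  set A := ∫ x, ‖fderiv ℝ u x‖ * ballInd (2 * R) x
  have hD0 : 0 ≤ D := integral_nonneg fun x => mul_nonneg (sq_nonneg _) (ballInd_nonneg _ _)
  have hA0 : 0 ≤ A := integral_nonneg fun x => mul_nonneg (norm_nonneg _) (ballInd_nonneg _ _)
  set h : R2 → ℝ := fun y => ∫ x, (u (x + y) - u x) ^ 2 * ballInd R x
  have hu2 : ∀ a b, |u a - u b| ≤ 2 * M := fun a b => by
    have := abs_sub (u a) (u b); linarith [hM a, hM b]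
  have hu4 : ∀ a b, (u a - u b) ^ 2 ≤ 4 * M ^ 2 := fun a b => by
    rw [← sq_abs]
    calc _ ≤ (2 * M) ^ 2 := by gcongr; exact hu2 a b
      _ = _ := by ring
  have hint : ∀ y, Integrable (fun x => (u (x + y) - u x) ^ 2 * ballInd R x) := fun y =>
    integrable_mul_ballInd (B := 4 * M ^ 2) (by fun_prop)
      (fun x => by rw [abs_of_nonneg (sq_nonneg _)]; exact hu4 _ _) R
  have h1 : ∀ y, ‖y‖ ≤ R → h y ≤ ‖y‖ ^ 2 * D := by
    intro y hy
    obtain ⟨s1, s2⟩ := integral_segment_le (F := fun x => ‖fderiv ℝ u x‖ ^ 2) (B := L ^ 2)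
      (by fun_prop) (fun x => sq_nonneg _) (fun x => by gcongr; exact hu.dbound x) hy
    calc h y ≤ ∫ x, ‖y‖ ^ 2 * ((∫ t in Icc (0 : ℝ) 1, ‖fderiv ℝ u (x + t • y)‖ ^ 2) * ballInd R x) :=
          integral_mono (hint y) (s1.const_mul _) fun x => by
            rw [← mul_assoc]
            exact mul_le_mul_of_nonneg_right (hu.sq_increment_le x y) (ballInd_nonneg _ _)
      _ ≤ _ := by rw [integral_const_mul]; gcongr
  have h2 : ∀ y, ‖y‖ ≤ R → h y ≤ 2 * M * ‖y‖ * A := by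
    intro y hy
    obtain ⟨s1, s2⟩ := integral_segment_le (F := fun x => ‖fderiv ℝ u x‖) (B := L)
      (by fun_prop) (fun x => norm_nonneg _) hu.dbound hy
    calc h y ≤ ∫ x, 2 * M * ‖y‖ * ((∫ t in Icc (0 : ℝ) 1, ‖fderiv ℝ u (x + t • y)‖) * ballInd R x) :=
          integral_mono (hint y) (s1.const_mul _) fun x => by
            rw [← mul_assoc]
            refine mul_le_mul_of_nonneg_right ?_ (ballInd_nonneg _ _)
            rw [← sq_abs, sq, mul_assoc]
            exact mul_le_mul (hu2 _ _) (hu.abs_increment_le x y) (abs_nonneg _) (by positivity)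
      _ ≤ _ := by rw [integral_const_mul]; gcongr
  have h3 : ∀ y, h y ≤ 4 * M ^ 2 * (R ^ 2 * discArea) := by
    intro y
    rw [← integral_ballInd hR0.le, ← integral_const_mul]
    exact integral_mono (hint y) ((integrable_ballInd R).const_mul _) fun x =>
      mul_le_mul_of_nonneg_right (hu4 _ _) (ballInd_nonneg _ _)
  have hE : Integrable (fun p : R2 × R2 => enInt u R (p.1 + p.2, p.2)) :=
    integrable_shear_symm.2 (integrable_enInt hu.bl R)
  have hEeq : ∀ y x : R2, enInt u R (y + x, x) = (‖y‖ ^ 3)⁻¹ * ((u (x + y) - u x) ^ 2 * ballInd R x) := by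
    intro y x
    simp only [enInt, add_sub_cancel_right]
    rw [add_comm y x]; ring
  have hen : en u R = ∫ y, (‖y‖ ^ 3)⁻¹ * h y := by
    rw [en, ← integral_shear_symm, Measure.volume_eq_prod, integral_prod _ hE]
    simp only [hEeq, integral_const_mul, h]
  have hyi : Integrable (fun y => (‖y‖ ^ 3)⁻¹ * h y) := by
    have := hE.integral_prod_left
    simpa only [hEeq, integral_const_mul] using this
  have hpt : ∀ y, (‖y‖ ^ 3)⁻¹ * h y ≤ D * (Iic δ).indicator (fun r => r⁻¹) ‖y‖ +
      2 * M * A * (Ioc δ R).indicator (fun r => (r ^ 2)⁻¹) ‖y‖ +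
      4 * M ^ 2 * (R ^ 2 * discArea) * (Ioi R).indicator (fun r => (r ^ 3)⁻¹) ‖y‖ := by
    intro y
    rcases eq_or_lt_of_le (norm_nonneg y) with hy0 | hy0
    · obtain rfl : y = 0 := norm_eq_zero.1 hy0.symm
      simp [indicator, hδ.le.not_gt, hR0.le.not_gt]
    rcases le_or_gt ‖y‖ δ with a | a
    · have b : ‖y‖ ≤ R := a.trans hR
      simp only [indicator, mem_Iic, a, mem_Ioc, a.not_gt, mem_Ioi, b.not_gt, if_true, if_false,
        false_and, mul_zero, add_zero]
      calc _ ≤ (‖y‖ ^ 3)⁻¹ * (‖y‖ ^ 2 * D) := by gcongr; exact h1 y b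
        _ = _ := by field_simp
    rcases le_or_gt ‖y‖ R with b | b
    · simp only [indicator, mem_Iic, a.not_ge, mem_Ioc, a, b, mem_Ioi, b.not_gt, if_true, if_false,
        and_self, mul_zero, add_zero, zero_add]
      calc _ ≤ (‖y‖ ^ 3)⁻¹ * (2 * M * ‖y‖ * A) := by gcongr; exact h2 y b
        _ = _ := by field_simp
    · simp only [indicator, mem_Iic, a.not_ge, mem_Ioc, b.not_ge, mem_Ioi, b, if_true, if_false,
        and_false, mul_zero, zero_add]
      rw [mul_comm]; gcongr; exact h3 y
  have J1 := n1.const_mul D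
  have J2 := m1.const_mul (2 * M * A)
  have J3 := f1.const_mul (4 * M ^ 2 * (R ^ 2 * discArea))
  have J12 : Integrable (fun y : R2 => D * (Iic δ).indicator (fun r => r⁻¹) ‖y‖ +
      2 * M * A * (Ioc δ R).indicator (fun r => (r ^ 2)⁻¹) ‖y‖) := J1.add J2
  have := integral_mono hyi (J12.add J3) hpt
  simp only [Pi.add_apply] at this
  rw [integral_add J12 J3, integral_add J1 J2, integral_const_mul, integral_const_mul,
    integral_const_mul, n2, m2, f2, ← hen] at this
  exact this

end split

theorem exists_cutoff_const : ∃ C0 > 0, ∀ R > 0, ∃ η : R2 → ℝ,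
    Cutoff (C0 / R) (2 * R) η ∧ ∀ x, ballInd R x ≤ η x := by
  obtain ⟨C0, hC0, h⟩ := exists_cutoff
  refine ⟨C0, hC0, fun R hR => ?_⟩
  obtain ⟨η, h1, h2, h3, h4, h5, h6, h7⟩ := h R hR
  refine ⟨η, ⟨h1, h2, h3, h5, h6, h7⟩, fun x => ?_⟩
  rcases lt_or_ge ‖x‖ R with hx | hx
  · rw [ballInd_of_lt hx, h4 x hx.le]
  · rw [ballInd_of_ge hx]; exact h2 x

theorem en_nonneg (u : R2 → ℝ) (S : ℝ) : 0 ≤ en u S := integral_nonneg (enInt_nonneg u S)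

section onescale

variable {c M lam Lam Lam' : ℝ} {v : ℝ → ℝ} {e : R2}

theorem le_mul_of_interp {κ lam ε C0 M c L D P A R c1 : ℝ} (hκ : 0 < κ) (hlam : 0 < lam)
    (hC0 : 0 < C0) (hM : 0 < M) (hL : 0 < L) (hc1 : 0 < c1)
    (hε : ε = c1 / L) (hεR : ε ≤ R) (hε1 : ε ≤ 1) (hD : 0 ≤ D) (hP : 0 ≤ P) (hA : 0 ≤ A)
    (hc1' : 32 * π * c * c1 ≤ κ * lam)
    (h : 2 * (ε ^ 2 * κ) * D ≤ (2 * ε) ^ 3 / lam * (P + 4 * π * c * L * D) +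
      2 * (M * (C0 / ε + C0 / R) * ((2 * ε) ^ 2 * κ) * A)) :
    D ≤ 8 / (lam * κ) * P + 16 * M * C0 / c1 * L * A := by
  have hε0 : 0 < ε := hε ▸ div_pos hc1 hL
  have h1 : C0 / R ≤ C0 / ε := by gcongr
  have h2 : 2 * (M * (C0 / ε + C0 / R) * ((2 * ε) ^ 2 * κ) * A) ≤
      2 * (M * (C0 / ε + C0 / ε) * ((2 * ε) ^ 2 * κ) * A) := by gcongr
  have h3 : 2 * (M * (C0 / ε + C0 / ε) * ((2 * ε) ^ 2 * κ) * A) =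
      ε ^ 2 * κ * (16 * M * C0 / c1 * L * A) := by
    rw [hε]; field_simp; ring
  have h4 : (2 * ε) ^ 3 / lam * (P + 4 * π * c * L * D) ≤ ε ^ 2 * κ * (8 / (lam * κ) * P) +
      ε ^ 2 * κ * D := by
    have e1 : (2 * ε) ^ 3 / lam * (P + 4 * π * c * L * D) =
        ε ^ 2 * κ * (8 / (lam * κ) * P) * ε + ε ^ 2 * (32 * π * c * (ε * L) / lam) * D := by
      field_simp; ring
    have e2 : ε * L = c1 := by rw [hε]; field_simp
    rw [e1, e2]
    have e3 : 32 * π * c * c1 / lam ≤ κ := by rwa [div_le_iff₀ hlam]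
    have e4 : 0 ≤ ε ^ 2 * κ * (8 / (lam * κ) * P) := by positivity
    exact add_le_add (mul_le_of_le_one_right e4 hε1)
      (mul_le_mul_of_nonneg_right (mul_le_mul_of_nonneg_left e3 (sq_nonneg ε)) hD)
  have h5 : ε ^ 2 * κ * D ≤ ε ^ 2 * κ * (8 / (lam * κ) * P + 16 * M * C0 / c1 * L * A) := by
    linarith
  exact le_of_mul_le_mul_left h5 (by positivity)

set_option maxHeartbeats 800000 in
/-- Stability estimates for one directional derivative at one scale. -/
theorem exists_directional_bounds (hK : EllipticKernel (Kbar v) lam Lam) (hc : 0 < c) (hM : 0 < M)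
    (he : ‖e‖ ≤ 1) {k0 k1 k2 : ℕ → R2 → ℝ} (hLam : 0 < Lam')
    (hk : KernelApprox (Kbar v) Lam' e k0 k1 k2) :
    ∃ C > 0, ∀ Ls : ℝ, 2 ≤ Ls → ∀ W : ℝ → ℝ, ContDiff ℝ 2 W → (∀ s, |deriv (deriv W) s| ≤ Ls) →
      ∀ (L : ℝ) (u : R2 → ℝ), StableData c v W L u → (∀ x, |u x| ≤ M) → ∀ R, 1 ≤ R →
        (∫ x, |fderiv ℝ u x e| * ballInd R x) ^ 2 ≤ C * (R ^ 2 + R * en u (2 * R)) ∧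
        ∫ x, fderiv ℝ u x e ^ 2 * ballInd R x ≤ C * Ls * (R + en u (2 * R)) := by
  obtain ⟨C0, hC0, hcut⟩ := exists_cutoff_const
  have hκ := discArea_pos
  have hlam := hK.lam_pos
  set κ := discArea
  set a := (4 * M * C0 * κ) ^ 2
  set b := 4 ^ 3 / (2 * lam) * (7 * Lam' * C0 ^ 2)
  have ha : 0 < a := by positivity
  have hb : 0 < b := by positivity
  set c1 := min 1 (κ * lam / (32 * π * c))
  have hc1 : 0 < c1 := lt_min one_pos (by positivity)
  have hc1' : 32 * π * c * c1 ≤ κ * lam := by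
    calc _ ≤ 32 * π * c * (κ * lam / (32 * π * c)) := by gcongr; exact min_le_right _ _
      _ = _ := by field_simp
  set p := 8 / (lam * κ) * (7 * Lam' * C0 ^ 2)
  set q := 16 * M * C0 / c1
  have hp : 0 < p := by positivity
  have hq : 0 < q := by positivity
  refine ⟨a + b + p + q * (1 + a + b), by positivity, ?_⟩
  intro Ls hLs W hW hA L u hu huM R hR
  have hR0 : 0 < R := one_pos.trans_le hR
  have hE := en_nonneg u (2 * R)
  obtain ⟨E, hEdef⟩ : ∃ E, E = en u (2 * R) := ⟨_, rfl⟩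
  rw [← hEdef] at hE ⊢
  obtain ⟨η, hη, hηb⟩ := hcut R hR0
  have hw := hu.bc2.bl_fderiv he
  set w : R2 → ℝ := fun x => fderiv ℝ u x e
  have h1 := sq_integral_abs_le hK hu hW hA huM hLam hk hη (by positivity) he
  have hPle := (le_abs_self _).trans (commut_le_en hLam hk hu.bc2 hη he)
  rw [← hEdef] at h1 hPle
  set A := ∫ x, η x * |w x|
  have hA0 : 0 ≤ A := integral_nonneg fun x => mul_nonneg (hη.nonneg x) (abs_nonneg _)
  change A ^ 2 ≤ _ at h1
  have hAsq : A ^ 2 ≤ a * R ^ 2 + b * (R * E) := by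
    refine h1.trans (le_of_eq ?_)
    simp only [a, b, κ]; field_simp; ring
  have hAle : A ≤ (1 + a + b) * (R + E) := by
    refine le_of_sq_le_sq (hAsq.trans ?_) (by positivity)
    have h2 : a + b ≤ (1 + a + b) ^ 2 := by nlinarith
    calc a * R ^ 2 + b * (R * E) ≤ (a + b) * (R + E) ^ 2 := by
          nlinarith [mul_nonneg ha.le (mul_nonneg hR0.le hE), mul_nonneg hb.le (mul_nonneg hR0.le hE),
            mul_nonneg ha.le (sq_nonneg E), mul_nonneg hb.le (sq_nonneg E),
            mul_nonneg hb.le (sq_nonneg R)]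
      _ ≤ (1 + a + b) ^ 2 * (R + E) ^ 2 := by gcongr
      _ = _ := by ring
  have hmono : ∫ x, |w x| * ballInd R x ≤ A := by
    refine integral_mono (integrable_mul_ballInd hw.abs.continuous hw.abs.bound R)
      (hη.integrable_mul hw.abs) fun x => ?_
    simp only [mul_comm (|w x|)]
    gcongr; exact hηb x
  have hmono0 : 0 ≤ ∫ x, |w x| * ballInd R x :=
    integral_nonneg fun x => mul_nonneg (abs_nonneg _) (ballInd_nonneg _ _)
  constructor
  · calc (∫ x, |w x| * ballInd R x) ^ 2 ≤ A ^ 2 := by gcongr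
      _ ≤ a * R ^ 2 + b * (R * E) := hAsq
      _ ≤ (a + b) * (R ^ 2 + R * E) := by
        nlinarith [mul_nonneg ha.le (mul_nonneg hR0.le hE), mul_nonneg hb.le (sq_nonneg R)]
      _ ≤ _ := by
        have : 0 ≤ p + q * (1 + a + b) := by positivity
        exact mul_le_mul_of_nonneg_right (by linarith) (by positivity)
  · set D := ∫ x, (η x * w x) ^ 2
    have hD0 : 0 ≤ D := integral_nonneg fun x => sq_nonneg _
    have hbl := hη.bl_mul hw
    have hDi : Integrable fun x => (η x * w x) ^ 2 := by
      simp only [sq]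
      exact (hbl.mul hbl).integrable (S := 2 * R) (fun x hx => by simp [hη.zero x hx])
    have hmonoD : ∫ x, w x ^ 2 * ballInd R x ≤ D := by
      refine integral_mono (integrable_mul_ballInd (F := fun x => w x ^ 2) (B := L ^ 2)
        (hw.continuous.pow 2)
        (fun x => by rw [abs_pow]; gcongr; exact hw.bound x) R) hDi fun x => ?_
      simp only [mul_pow, mul_comm (w x ^ 2)]
      gcongr
      rcases lt_or_ge ‖x‖ R with hx | hx
      · have := hηb x
        rw [ballInd_of_lt hx] at this ⊢
        nlinarith
      · rw [ballInd_of_ge hx]; positivity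
    have hLs0 : 0 < Ls := by linarith
    obtain ⟨ε, hε⟩ : ∃ ε, ε = c1 / Ls := ⟨_, rfl⟩
    have hε0 : 0 < ε := hε ▸ div_pos hc1 hLs0
    have hε1 : ε ≤ 1 := by
      rw [hε, div_le_one hLs0]
      exact (min_le_left _ _).trans (by linarith)
    obtain ⟨ρ, hρ, hρb⟩ := hcut ε hε0
    have hI := sq_integral_le_interp hK hu.bc2 huM hη hρ (by positivity) he
    have hQ := integral_bil_localized_le hK hu hc.le hW hA he hη.bl hη.zero
    have hρi : ε ^ 2 * κ ≤ ∫ x, ρ x := by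
      rw [← integral_ballInd hε0.le]
      exact integral_mono (integrable_ballInd ε) hρ.integrable hρb
    have hfin := le_mul_of_interp (κ := κ) (lam := lam) (C0 := C0) (M := M) (c := c) (L := Ls) (D := D)
      (P := 7 * Lam' * (C0 / R) ^ 2 * E) (A := A) (R := R) hκ hlam hC0 hM hLs0 hc1 hε
      (hε1.trans hR) hε1 hD0 (by positivity) hA0 hc1' (by
        calc 2 * (ε ^ 2 * κ) * D ≤ 2 * (∫ x, ρ x) * D := by gcongr
          _ ≤ _ := hI
          _ ≤ _ := by
            gcongr
            exact hQ.trans (by gcongr))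
    have hP2 : 7 * Lam' * (C0 / R) ^ 2 * E ≤ 7 * Lam' * C0 ^ 2 * E := by
      gcongr; exact div_le_self hC0.le hR
    calc ∫ x, w x ^ 2 * ballInd R x ≤ D := hmonoD
      _ ≤ 8 / (lam * κ) * (7 * Lam' * C0 ^ 2 * E) + q * Ls * ((1 + a + b) * (R + E)) := by
        refine hfin.trans ?_
        gcongr
      _ = p * E + q * (1 + a + b) * Ls * (R + E) := by simp only [p]; ring
      _ ≤ (a + b + p) * Ls * (R + E) + q * (1 + a + b) * Ls * (R + E) := by
        refine add_le_add ?_ le_rfl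
        calc p * E ≤ p * 1 * (R + E) := by
              rw [mul_one]; exact mul_le_mul_of_nonneg_left (by linarith) hp.le
          _ ≤ (a + b + p) * Ls * (R + E) :=
            mul_le_mul_of_nonneg_right
              (mul_le_mul (by linarith) (by linarith) one_pos.le (by linarith)) (by linarith)
      _ = _ := by ring

end onescale

theorem half_le_log_mul {Ls R : ℝ} (hLs : 2 ≤ Ls) (hR : 1 ≤ R) : 1 / 2 ≤ log (Ls * R) := by
  have h1 : log 2 ≤ log (Ls * R) := log_le_log (by norm_num) (by nlinarith)
  have := log_two_gt_d9
  linarith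

theorem exists_one_scale_const {κ M C1 : ℝ} (hκ : 0 < κ) (hM : 0 < M) (hC1 : 0 < C1) :
    ∃ C > 0, ∀ Ls R e e4 D A : ℝ, 2 ≤ Ls → 1 ≤ R → 0 ≤ e4 → 0 ≤ A →
      A ^ 2 ≤ C1 * ((2 * R) ^ 2 + 2 * R * e4) → D ≤ C1 * Ls * (2 * R + e4) →
      (∀ δ, 0 < δ → δ ≤ R → e ≤ D * (2 * κ * δ) + 2 * M * A * (2 * κ * log (R / δ)) +
        4 * M ^ 2 * (R ^ 2 * κ) * (2 * κ * R⁻¹)) →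
      e ≤ C * log (Ls * R) ^ 2 * R + e4 / 72 := by
  obtain ⟨c0, hc0⟩ : ∃ c0, c0 = min 1 (1 / (288 * κ * C1)) := ⟨_, rfl⟩
  have hc0pos : 0 < c0 := hc0 ▸ lt_min one_pos (by positivity)
  have hc01 : c0 ≤ 1 := hc0 ▸ min_le_left _ _
  have hc02 : κ * C1 * c0 ≤ 1 / 288 := by
    have : c0 ≤ 1 / (288 * κ * C1) := hc0 ▸ min_le_right _ _
    rw [le_div_iff₀ (by positivity)] at this
    linarith
  obtain ⟨m, hm⟩ : ∃ m, m = -log c0 := ⟨_, rfl⟩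
  have hm0 : 0 ≤ m := by rw [hm]; linarith [log_nonpos hc0pos.le hc01]
  obtain ⟨X, hX⟩ : ∃ X, X = 4 * M * κ * (1 + 2 * m) := ⟨_, rfl⟩
  have hX0 : 0 < X := by rw [hX]; positivity
  refine ⟨72 * C1 * X ^ 2 + 4 * (1 / 36 + 8 * M ^ 2 * κ ^ 2), by positivity, ?_⟩
  intro Ls R e e4 D A hLs hR he4 hA hA2 hD h
  have hLs0 : 0 < Ls := by linarith
  have hR0 : 0 < R := by linarith
  have hl := half_le_log_mul hLs hR
  obtain ⟨l, hldef⟩ : ∃ l, l = log (Ls * R) := ⟨_, rfl⟩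
  rw [← hldef] at hl ⊢
  have hδ := h (c0 / Ls) (by positivity) (by rw [div_le_iff₀ hLs0]; nlinarith)
  have hlog : log (R / (c0 / Ls)) ≤ (1 + 2 * m) * l := by
    have : R / (c0 / Ls) = Ls * R / c0 := by field_simp
    rw [this, log_div (by positivity) hc0pos.ne', ← hldef]
    have := mul_le_mul_of_nonneg_left hl hm0
    linarith
  have t1 : D * (2 * κ * (c0 / Ls)) ≤ R / 72 + e4 / 144 := by
    calc D * (2 * κ * (c0 / Ls)) ≤ C1 * Ls * (2 * R + e4) * (2 * κ * (c0 / Ls)) := by gcongr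
      _ = 2 * (κ * C1 * c0) * (2 * R + e4) := by field_simp
      _ ≤ 2 * (1 / 288) * (2 * R + e4) := by gcongr
      _ = _ := by ring
  have t2 : 2 * M * A * (2 * κ * log (R / (c0 / Ls))) ≤
      72 * C1 * X ^ 2 * l ^ 2 * R + R / 72 + e4 / 144 := by
    have e1 : 2 * M * A * (2 * κ * log (R / (c0 / Ls))) ≤ X * l * A := by
      calc _ ≤ 2 * M * A * (2 * κ * ((1 + 2 * m) * l)) := by gcongr
        _ = _ := by rw [hX]; ring
    have e2 : A ^ 2 / (288 * C1 * R) ≤ R / 72 + e4 / 144 := by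
      rw [div_le_iff₀ (by positivity)]
      refine hA2.trans (le_of_eq ?_)
      ring
    have e3 : X * l * A ≤ 72 * C1 * X ^ 2 * l ^ 2 * R + A ^ 2 / (288 * C1 * R) := by
      have : 72 * C1 * X ^ 2 * l ^ 2 * R + A ^ 2 / (288 * C1 * R) - X * l * A =
          (144 * C1 * R * (X * l) - A) ^ 2 / (288 * C1 * R) := by
        field_simp; ring
      have h0 : 0 ≤ (144 * C1 * R * (X * l) - A) ^ 2 / (288 * C1 * R) := by positivity
      linarith
    linarith
  have t3 : 4 * M ^ 2 * (R ^ 2 * κ) * (2 * κ * R⁻¹) = 8 * M ^ 2 * κ ^ 2 * R := by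
    field_simp; ring
  have t4 : R ≤ 4 * l ^ 2 * R := by
    have : 1 ≤ 4 * l ^ 2 := by nlinarith
    nlinarith
  have t5 := mul_le_mul_of_nonneg_left t4 (show 0 ≤ 1 / 36 + 8 * M ^ 2 * κ ^ 2 by positivity)
  rw [t3] at hδ
  linarith

/-- Absorbing the energy at four times the scale by iteration. -/
theorem le_of_absorption {e : ℝ → ℝ} {C B Ls : ℝ} (hLs : 2 ≤ Ls) (hC : 0 ≤ C)
    (h1 : ∀ R, 1 ≤ R → e R ≤ C * log (Ls * R) ^ 2 * R + e (4 * R) / 72)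
    (h2 : ∀ R, 1 ≤ R → e R ≤ B * R ^ 2) {R : ℝ} (hR : 1 ≤ R) :
    e R ≤ 2 * C * log (Ls * R) ^ 2 * R := by
  have key : ∀ n : ℕ, ∀ R, 1 ≤ R → e R ≤ 2 * C * log (Ls * R) ^ 2 * R + (2 / 9) ^ n * (B * R ^ 2) := by
    intro n
    induction n with
    | zero =>
      intro R hR
      have : 0 ≤ 2 * C * log (Ls * R) ^ 2 * R := by positivity
      have := h2 R hR
      linarith
    | succ n ih =>
      intro R hR
      have hl := half_le_log_mul hLs hR
      have hl4 : log (Ls * (4 * R)) ≤ 3 * log (Ls * R) := by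
        have h2 : 2 ≤ Ls * R := by nlinarith
        rw [show (3 : ℝ) * log (Ls * R) = log ((Ls * R) ^ 3) by rw [log_pow]; norm_num]
        refine log_le_log (by positivity) ?_
        nlinarith [mul_self_nonneg (Ls * R - 2)]
      have hl4' : 0 ≤ log (Ls * (4 * R)) := by
        linarith [half_le_log_mul hLs (show 1 ≤ 4 * R by linarith)]
      have hsq : log (Ls * (4 * R)) ^ 2 ≤ 9 * log (Ls * R) ^ 2 := by
        calc _ ≤ (3 * log (Ls * R)) ^ 2 := by gcongr
          _ = _ := by ring
      have i1 := h1 R hR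
      have i2 := ih (4 * R) (by linarith)
      have i3 : 2 * C * log (Ls * (4 * R)) ^ 2 * (4 * R) ≤ 2 * C * (9 * log (Ls * R) ^ 2) * (4 * R) := by
        gcongr
      rw [pow_succ (2 / 9 : ℝ)]
      linarith
  have hlim : Tendsto (fun n : ℕ => 2 * C * log (Ls * R) ^ 2 * R + (2 / 9 : ℝ) ^ n * (B * R ^ 2)) atTop
      (𝓝 (2 * C * log (Ls * R) ^ 2 * R + 0 * (B * R ^ 2))) :=
    ((tendsto_pow_atTop_nhds_zero_of_lt_one (by norm_num) (by norm_num)).mul_const _).const_add _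
  have := ge_of_tendsto' hlim fun n => key n R hR
  simpa using this

section energy

variable {c M lam Lam : ℝ} {v : ℝ → ℝ}

theorem en_le_sq {L : ℝ} {u : R2 → ℝ} (hu : BL L u) {R : ℝ} (hR : 0 ≤ R) :
    en u R ≤ 4 * L * L * ((∫ y, kmin y) * discArea) * R ^ 2 := by
  have h : en u R ≤ ∫ p : R2 × R2, 4 * L * L * (kmin (p.1 - p.2) * ballInd R p.2) := by
    refine integral_mono (integrable_enInt hu R)
      ((integrable_ballInd_mul integrable_kmin R).const_mul _) fun p => ?_
    have h1 := (le_abs_self _).trans (hu.abs_mul_sub_le hu p.1 p.2)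
    have h2 := ballInd_nonneg R p.2
    rw [enInt, sq, kmin]
    calc _ ≤ 4 * L * L * min 1 (‖p.1 - p.2‖ ^ 2) * (‖p.1 - p.2‖ ^ 3)⁻¹ * ballInd R p.2 := by gcongr
      _ = _ := by ring
  rw [integral_const_mul, integral_ballInd_mul kmin hR] at h
  linarith

/-- Stability estimates for the gradient at one scale. -/
theorem exists_gradient_bounds (hK : EllipticKernel (Kbar v) lam Lam)
    (hk : ∀ e, ∃ k0 k1 k2 Lam', 0 < Lam' ∧ KernelApprox (Kbar v) Lam' e k0 k1 k2)
    (hc : 0 < c) (hM : 0 < M) :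
    ∃ C > 0, ∀ Ls : ℝ, 2 ≤ Ls → ∀ W : ℝ → ℝ, ContDiff ℝ 2 W → (∀ s, |deriv (deriv W) s| ≤ Ls) →
      ∀ (L : ℝ) (u : R2 → ℝ), StableData c v W L u → (∀ x, |u x| ≤ M) → ∀ R, 1 ≤ R →
        (∫ x, ‖fderiv ℝ u x‖ * ballInd R x) ^ 2 ≤ C * (R ^ 2 + R * en u (2 * R)) ∧
        ∫ x, ‖fderiv ℝ u x‖ ^ 2 * ballInd R x ≤ C * Ls * (R + en u (2 * R)) := by
  obtain ⟨_, _, _, _, hl0, hk0⟩ := hk (basisVec 0)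
  obtain ⟨_, _, _, _, hl1, hk1⟩ := hk (basisVec 1)
  obtain ⟨C0, hC0, h0⟩ := exists_directional_bounds hK hc hM (norm_basisVec 0) hl0 hk0
  obtain ⟨C1, hC1, h1⟩ := exists_directional_bounds hK hc hM (norm_basisVec 1) hl1 hk1
  refine ⟨2 * (C0 + C1), by positivity, ?_⟩
  intro Ls hLs W hW hA L u hu huM R hR
  obtain ⟨p0, q0⟩ := h0 Ls hLs W hW hA L u hu huM R hR
  obtain ⟨p1, q1⟩ := h1 Ls hLs W hW hA L u hu huM R hR
  have hE := en_nonneg u (2 * R)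
  have hw := fun i => hu.bc2.bl_fderiv (norm_basisVec i)
  have hdc : Continuous (fderiv ℝ u) := hu.bc2.contDiff.continuous_fderiv (by norm_num)
  have hi := fun i => integrable_mul_ballInd (hw i).abs.continuous (hw i).abs.bound R
  have hi2 := fun i => integrable_mul_ballInd (F := fun x => fderiv ℝ u x (basisVec i) ^ 2) (B := L ^ 2)
    ((hw i).continuous.pow 2)
    (fun x => by rw [abs_pow]; exact pow_le_pow_left₀ (abs_nonneg _) ((hw i).bound x) 2) R
  constructor
  · have hle : ∫ x, ‖fderiv ℝ u x‖ * ballInd R x ≤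
        (∫ x, |fderiv ℝ u x (basisVec 0)| * ballInd R x) +
          ∫ x, |fderiv ℝ u x (basisVec 1)| * ballInd R x := by
      rw [← integral_add (hi 0) (hi 1)]
      refine integral_mono (integrable_mul_ballInd (B := L) hdc.norm
        (fun x => by rw [abs_norm]; exact hu.bc2.dbound x) R) ((hi 0).add (hi 1)) fun x => ?_
      rw [← add_mul]
      exact mul_le_mul_of_nonneg_right (norm_le_sum_basisVec _) (ballInd_nonneg _ _)
    have hn : 0 ≤ ∫ x, ‖fderiv ℝ u x‖ * ballInd R x :=
      integral_nonneg fun x => mul_nonneg (norm_nonneg _) (ballInd_nonneg _ _)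
    refine (pow_le_pow_left₀ hn hle 2).trans (add_sq_le.trans ?_)
    linarith
  · have hle : ∫ x, ‖fderiv ℝ u x‖ ^ 2 * ballInd R x ≤
        (∫ x, fderiv ℝ u x (basisVec 0) ^ 2 * ballInd R x) +
          ∫ x, fderiv ℝ u x (basisVec 1) ^ 2 * ballInd R x := by
      rw [← integral_add (hi2 0) (hi2 1)]
      refine integral_mono (integrable_mul_ballInd (F := fun x => ‖fderiv ℝ u x‖ ^ 2) (B := L ^ 2)
        (hdc.norm.pow 2)
        (fun x => by
          rw [abs_pow, abs_norm]; exact pow_le_pow_left₀ (norm_nonneg _) (hu.bc2.dbound x) 2) R)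
        ((hi2 0).add (hi2 1)) fun x => ?_
      rw [← add_mul]
      exact mul_le_mul_of_nonneg_right (norm_sq_le_sum_basisVec _) (ballInd_nonneg _ _)
    have : 0 ≤ (C0 + C1) * Ls * (R + en u (2 * R)) := by positivity
    linarith

/-- The logarithmic energy and gradient estimates. -/
theorem exists_log_bounds (hK : EllipticKernel (Kbar v) lam Lam)
    (hk : ∀ e, ∃ k0 k1 k2 Lam', 0 < Lam' ∧ KernelApprox (Kbar v) Lam' e k0 k1 k2)
    (hc : 0 < c) (hM : 0 < M) :
    ∃ C > 0, ∀ Ls : ℝ, 2 ≤ Ls → ∀ W : ℝ → ℝ, ContDiff ℝ 2 W → (∀ s, |deriv (deriv W) s| ≤ Ls) →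
      ∀ (L : ℝ) (u : R2 → ℝ), StableData c v W L u → (∀ x, |u x| ≤ M) → ∀ R, 1 ≤ R →
        ∫ x, ‖fderiv ℝ u x‖ * ballInd R x ≤ C * R * log (Ls * R) ∧
        en u R ≤ C * R * log (Ls * R) ^ 2 := by
  obtain ⟨C1, hC1, h1⟩ := exists_gradient_bounds hK hk hc hM
  obtain ⟨C2, hC2, h2⟩ := exists_one_scale_const discArea_pos hM hC1
  refine ⟨2 * C2 + 2 * C1 * (1 + 4 * C2) + 4 , by positivity, ?_⟩
  intro Ls hLs W hW hA L u hu huM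
  have hL := hu.bc2.nonneg
  have hκ := discArea_pos
  have hen : ∀ R, 1 ≤ R → en u R ≤ 2 * C2 * log (Ls * R) ^ 2 * R := by
    intro R hR
    refine le_of_absorption (e := en u) (B := 4 * L * L * ((∫ y, kmin y) * discArea)) hLs hC2.le
      (fun R hR => ?_) (fun R hR => en_le_sq hu.bc2.bl (by linarith)) hR
    obtain ⟨p, q⟩ := h1 Ls hLs W hW hA L u hu huM (2 * R) (by linarith)
    rw [show 2 * (2 * R) = 4 * R by ring] at p q
    exact h2 Ls R (en u R) (en u (4 * R)) _ _ hLs hR (en_nonneg _ _)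
      (integral_nonneg fun x => mul_nonneg (norm_nonneg _) (ballInd_nonneg _ _)) p q
      fun δ hδ hδR => en_le hu.bc2 huM hδ hδR
  intro R hR
  have hR0 : 0 < R := by linarith
  have hl := half_le_log_mul hLs hR
  have e1 := hen R hR
  constructor
  · obtain ⟨p, -⟩ := h1 Ls hLs W hW hA L u hu huM R hR
    have e2 := hen (2 * R) (by linarith)
    have hl2 : log (Ls * (2 * R)) ≤ 2 * log (Ls * R) := by
      have h2 : 2 ≤ Ls * R := by nlinarith
      rw [show (2 : ℝ) * log (Ls * R) = log ((Ls * R) ^ 2) by rw [log_pow]; norm_num]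
      exact log_le_log (by positivity) (by nlinarith)
    have hl2' : 0 ≤ log (Ls * (2 * R)) := by
      linarith [half_le_log_mul hLs (show 1 ≤ 2 * R by linarith)]
    obtain ⟨l, hldef⟩ : ∃ l, l = log (Ls * R) := ⟨_, rfl⟩
    rw [← hldef] at hl hl2 ⊢
    have e3 : en u (2 * R) ≤ 16 * C2 * l ^ 2 * R := by
      calc _ ≤ 2 * C2 * (2 * l) ^ 2 * (2 * R) := e2.trans (by gcongr)
        _ = _ := by ring
    have e4 : (1 : ℝ) ≤ 4 * l ^ 2 := by nlinarith
    refine le_of_sq_le_sq (b := (2 * C2 + 2 * C1 * (1 + 4 * C2) + 4) * R * l) ?_ (by positivity)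
    calc _ ≤ C1 * (R ^ 2 + R * en u (2 * R)) := p
      _ ≤ C1 * (R ^ 2 * (4 * l ^ 2) + R * (16 * C2 * l ^ 2 * R)) := by
        gcongr
        exact le_mul_of_one_le_right (by positivity) e4
      _ = (2 * (2 * C1 * (1 + 4 * C2))) * (R * l) ^ 2 := by ring
      _ ≤ (2 * C2 + 2 * C1 * (1 + 4 * C2) + 4) ^ 2 * (R * l) ^ 2 := by
        refine mul_le_mul_of_nonneg_right ?_ (sq_nonneg _)
        have : 0 < 2 * C1 * (1 + 4 * C2) := by positivity
        nlinarith
      _ = _ := by ring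
  · have : 0 ≤ (2 * C1 * (1 + 4 * C2) + 4) * R * log (Ls * R) ^ 2 := by positivity
    linarith

/-- The nonlocal energy is controlled by the local energy. -/
theorem nEnergy_le_en (hK : EllipticKernel (Kbar v) lam Lam) {L : ℝ} {u : R2 → ℝ} (hu : BL L u) (R : ℝ) :
    nEnergy v u R ≤ ENNReal.ofReal (2 * Lam * en u R) := by
  have i1 := integrable_enInt hu R
  have i2 := integrable_swap_R2.2 i1
  have hLam := hK.Lam_pos
  have hnn : ∀ p : R2 × R2, 0 ≤ enInt u R p + enInt u R (p.2, p.1) := fun p =>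
    add_nonneg (enInt_nonneg _ _ _) (enInt_nonneg _ _ _)
  have hi : Integrable fun p : R2 × R2 => Lam * (enInt u R p + enInt u R (p.2, p.1)) :=
    (i1.add i2).const_mul Lam
  have hint : ∫ p : R2 × R2, Lam * (enInt u R p + enInt u R (p.2, p.1)) = 2 * Lam * en u R := by
    rw [integral_const_mul, integral_add i1 i2, integral_swap_R2 (enInt u R), en]; ring
  rw [← hint, ofReal_integral_eq_lintegral_ofReal hi
    (Eventually.of_forall fun p => mul_nonneg hLam.le (hnn p))]
  have hDm : MeasurableSet (DR R) := (measurableSet_ball.compl.prod measurableSet_ball.compl).compl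
  refine (setLIntegral_mono' hDm fun p hp => ENNReal.ofReal_le_ofReal ?_).trans
    (setLIntegral_le_lintegral (DR R) fun p : R2 × R2 =>
      ENNReal.ofReal (Lam * (enInt u R p + enInt u R (p.2, p.1))))
  have hb : 1 ≤ ballInd R p.1 + ballInd R p.2 := by
    have n1 := ballInd_nonneg R p.1
    have n2 := ballInd_nonneg R p.2
    simp only [DR, mem_compl_iff, mem_prod, mem_ball_zero_iff, not_and_or, not_not] at hp
    rcases hp with h | h
    · rw [ballInd_of_lt h]; linarith
    · rw [ballInd_of_lt h]; linarith
  have hn := norm_sub_rev p.2 p.1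
  have hu2 : (u p.2 - u p.1) ^ 2 = (u p.1 - u p.2) ^ 2 := by ring
  simp only [enInt, hn, hu2, sq_abs]
  calc (u p.1 - u p.2) ^ 2 * Kbar v (p.1 - p.2)
      ≤ (u p.1 - u p.2) ^ 2 * (Lam * (‖p.1 - p.2‖ ^ 3)⁻¹) * 1 := by
        rw [mul_one]; gcongr; exact hK.upper _
    _ ≤ (u p.1 - u p.2) ^ 2 * (Lam * (‖p.1 - p.2‖ ^ 3)⁻¹) * (ballInd R p.1 + ballInd R p.2) := by
        gcongr
    _ = _ := by ring

end energy

/-- the energy estimates in all balls: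
`∫_{B_R} |∇u| ≤ C R log(L* R)` and `ℰ(u; B_R) ≤ C R log²(L* R)` for all `R ≥ 1`, for
bounded stable solutions, where `C` depends only on `β`, `M` and `α`, and `L* ≥ 2`
bounds `‖W‖_∞ + ‖W'‖_∞ + ‖W''‖_∞` and the `α`-Hölder constant of `W''`. -/
theorem stmt17 (β : ℝ) (hβ1 : 2/3 < β) (hβ2 : β < 3/2) (v : ℝ → ℝ) (hv : IsVBeta β v)
    (α : ℝ≥0) (M : ℝ) (hM : 0 < M) :
    ∃ C > (0:ℝ), ∀ Lstar : ℝ, 2 ≤ Lstar → ∀ W : ℝ → ℝ, PotentialAssump α W →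
      (∀ s, |W s| + |deriv W s| + |deriv (deriv W) s| ≤ Lstar) →
      HolderWith (Real.toNNReal Lstar) α (deriv (deriv W)) →
      ∀ u : R2 → ℝ, IsStableSolution β v W u → (∀ x, |u x| ≤ M) →
      ∀ R : ℝ, 1 ≤ R →
        (∫ x in Metric.ball (0:R2) R, ‖fderiv ℝ u x‖) ≤ C * R * Real.log (Lstar * R) ∧
        nEnergy v u R ≤ ENNReal.ofReal (C * R * (Real.log (Lstar * R))^2) := by
  have hc : 0 < β ^ (-(1:ℝ)/2) := rpow_pos_of_pos (by linarith) _
  obtain ⟨lam, Lam, hK, hk⟩ := Kbar_elliptic hβ1 hβ2 hv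
  obtain ⟨C, hC, h⟩ := exists_log_bounds hK hk hc hM
  have hLam := hK.Lam_pos
  refine ⟨(1 + 2 * Lam) * C, by positivity, ?_⟩
  intro Ls hLs W hW hWb _ u hu huM R hR
  obtain ⟨huC, ⟨L, hL⟩, heq, -, hst⟩ := hu
  have hA : ∀ s, |deriv (deriv W) s| ≤ Ls := fun s => by
    linarith [hWb s, abs_nonneg (W s), abs_nonneg (deriv W s)]
  have hbc := BC2.of_bounds huC hL
  obtain ⟨h1, h2⟩ := h Ls hLs W hW.1 hA L u ⟨hbc, heq, hst⟩ huM R hR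
  have hl := half_le_log_mul hLs hR
  constructor
  · have e1 : ∫ x in Metric.ball (0:R2) R, ‖fderiv ℝ u x‖ = ∫ x, ‖fderiv ℝ u x‖ * ballInd R x := by
      rw [← integral_indicator measurableSet_ball]
      congr 1; ext x
      by_cases hx : x ∈ Metric.ball (0:R2) R <;> simp [ballInd, hx]
    rw [e1]
    have : 0 ≤ 2 * Lam * C * R * log (Ls * R) := by positivity
    linarith
  · refine (nEnergy_le_en hK hbc.bl R).trans (ENNReal.ofReal_le_ofReal ?_)
    have e1 := mul_le_mul_of_nonneg_left h2 (show 0 ≤ 2 * Lam by positivity)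
    have : 0 ≤ C * R * log (Ls * R) ^ 2 := by positivity
    linarith
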